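/- Let f : ℝ → ℝ be a continuous odd function satisfying: (f₁) there is C > 0 with |f(s)| ≤ C·exp(4π s²) for all s ∈ ℝ; (f₂) lim_{s→0} f(s)/s = 0; (H₁) there are s₀ > 0 and M > 0 such that 0 < F(s) ≤ M|f(s)| for all |s| ≥ s₀, where F(s) = ∫₀^s f(t) dt; (H₂) 0 < F(s) ≤ (1/2) f(s) s for all s ≠ 0; (H₃) lim_{s→+∞} s f(s) exp(−4π s²) = +∞. Then there exist infinitely many pairwise distinct functions u : ℝ² → ℝ, each continuous on the closed unit ball B̄ of ℝ², continuously differentiable on the open unit ball B, vanishing on ∂B, taking both strictly positive and strictly negative values in B, and satisfying the weak formulation ∫_B ⟨∇u(x), ∇φ(x)⟩ dx = ∫_B f(u(x)) φ(x) dx for every smooth function φ : ℝ² → ℝ with compact support contained in B. -/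

import Mathlib

open MeasureTheory Real Filter Metric Set
open scoped Topology RealInnerProductSpace

/-- `primF f s = ∫₀^s f(t) dt`. -/
noncomputable def primF (f : ℝ → ℝ) (s : ℝ) : ℝ := ∫ t in (0:ℝ)..s, f t

section

open scoped ENNReal

/-- Hilbert space completion of a space with a nonnegative symmetric bilinear form. -/
theorem exists_completion_of_core {E : Type} [AddCommGroup E] [Module ℝ E]
    (c : PreInnerProductSpace.Core ℝ E) :
    ∃ (H : Type) (_ : NormedAddCommGroup H) (_ : InnerProductSpace ℝ H)
      (_ : CompleteSpace H) (ι : E →ₗ[ℝ] H), DenseRange ι ∧ ∀ x y, ⟪ι x, ι y⟫ = c.inner x y := by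
  let i1 : SeminormedAddCommGroup E := @InnerProductSpace.Core.toSeminormedAddCommGroup ℝ E _ _ _ c
  let i2 : InnerProductSpace ℝ E := InnerProductSpace.ofCore c
  refine ⟨UniformSpace.Completion E, inferInstance, inferInstance,
    inferInstance, (UniformSpace.Completion.toComplL (𝕜 := ℝ) (E := E)).toLinearMap, ?_, ?_⟩
  · exact UniformSpace.Completion.denseRange_coe
  · intro x y
    exact UniformSpace.Completion.inner_coe x y

/-- A symmetric nonnegative operator on a Hilbert space is the Gram operator of a bounded map
with dense range into another Hilbert space. -/
theorem exists_gram_factorization {E : Type} [NormedAddCommGroup E] [InnerProductSpace ℝ E]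
    (K : E →L[ℝ] E) (hsymm : ∀ x y, ⟪K x, y⟫ = ⟪x, K y⟫) (hpos : ∀ x, 0 ≤ ⟪K x, x⟫) :
    ∃ (H : Type) (_ : NormedAddCommGroup H) (_ : InnerProductSpace ℝ H) (_ : CompleteSpace H)
      (ι : E →L[ℝ] H), DenseRange ι ∧ ∀ x y, ⟪ι x, ι y⟫ = ⟪K x, y⟫ := by
  let c : PreInnerProductSpace.Core ℝ E :=
    { inner := fun x y => ⟪K x, y⟫
      conj_inner_symm := fun x y => by
        simp only [conj_trivial]
        rw [hsymm, real_inner_comm]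
      re_inner_nonneg := fun x => by simpa using hpos x
      add_left := fun x y z => by simp [inner_add_left]
      smul_left := fun x y r => by simp [inner_smul_left] }
  obtain ⟨H, _, _, _, ι, hd, hi⟩ := exists_completion_of_core c
  refine ⟨H, inferInstance, inferInstance, inferInstance,
    ι.mkContinuous (Real.sqrt ‖K‖) ?_, hd, hi⟩
  intro x
  rw [← Real.sqrt_sq (norm_nonneg x), ← Real.sqrt_mul (norm_nonneg _)]
  apply Real.le_sqrt_of_sq_le
  rw [← real_inner_self_eq_norm_sq, hi]
  calc ⟪K x, x⟫ ≤ ‖K x‖ * ‖x‖ := real_inner_le_norm _ _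
    _ ≤ ‖K‖ * ‖x‖ * ‖x‖ := by gcongr; exact K.le_opNorm x
    _ = _ := by ring

section MountainPass

variable {E : Type*} [NormedAddCommGroup E] [InnerProductSpace ℝ E] [FiniteDimensional ℝ E]

/-- First order Taylor expansion of a `C¹` function, uniform on compact sets. -/
theorem exists_uniform_first_order {J : E → ℝ} {g : E → E} (hg : Continuous g)
    (hJ : ∀ x, HasGradientAt J (g x) x) {S : Set E} (hS : IsCompact S) {η : ℝ} (hη : 0 < η) :
    ∃ s₀ > 0, ∀ x ∈ S, ∀ v : E, ‖v‖ < s₀ → J (x + v) ≤ J x + ⟪g x, v⟫ + η * ‖v‖ := by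
  have hcomp : IsCompact (cthickening 1 S) := hS.cthickening
  have huc := hcomp.uniformContinuousOn_of_continuous hg.continuousOn
  rw [Metric.uniformContinuousOn_iff] at huc
  obtain ⟨δ, hδ, h⟩ := huc η hη
  refine ⟨min δ 1, by positivity, fun x hx v hv => ?_⟩
  have hmv := (convex_ball x (min δ 1)).norm_image_sub_le_of_norm_hasFDerivWithin_le'
    (f := J) (f' := fun y => InnerProductSpace.toDual ℝ E (g y))
    (φ := InnerProductSpace.toDual ℝ E (g x)) (C := η) (x := x) (y := x + v)
    (fun y _ => (hJ y).hasFDerivAt.hasFDerivWithinAt)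
    (fun y hy => by
      rw [← map_sub, LinearIsometryEquiv.norm_map, ← dist_eq_norm]
      have hy' : dist y x < min δ 1 := hy
      refine (h y ?_ x ?_ (hy'.trans_le (min_le_left _ _))).le
      · exact mem_cthickening_of_dist_le y x 1 S hx (hy'.le.trans (min_le_right _ _))
      · exact self_subset_cthickening S hx)
    (mem_ball_self (by positivity)) (by simpa using hv)
  simp only [add_sub_cancel_left, InnerProductSpace.toDual_apply_apply] at hmv
  have := (le_abs_self _).trans hmv
  linarith

/-- Finite-dimensional mountain pass theorem for functions tending to `-∞` at infinity. -/
theorem exists_mountain_pass_point {J : E → ℝ} {g : E → E} (hg : Continuous g)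
    (hJ : ∀ x, HasGradientAt J (g x) x) (hinf : Tendsto J (cocompact E) atBot)
    {ρ α b : ℝ} {e : E} (hρ : 0 < ρ) (hρe : ρ < ‖e‖) (hJ0 : J 0 ≤ 0) (hJe : J e ≤ 0) (hα : 0 < α)
    (hsph : ∀ x, ‖x‖ = ρ → α ≤ J x) (hb : ∀ t ∈ Icc (0 : ℝ) 1, J (t • e) ≤ b) :
    ∃ x, g x = 0 ∧ α ≤ J x ∧ J x ≤ b := by
  have hJc : Continuous J := continuous_iff_continuousAt.2 fun x => (hJ x).continuousAt
  set Γ : Set ℝ := {l | ∃ γ : ℝ → E, Continuous γ ∧ γ 0 = 0 ∧ γ 1 = e ∧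
    ∀ t ∈ Icc (0 : ℝ) 1, J (γ t) ≤ l} with hΓ
  have hbΓ : b ∈ Γ := ⟨fun t => t • e, by fun_prop, by simp, by simp, hb⟩
  have hlow : ∀ l ∈ Γ, α ≤ l := by
    rintro l ⟨γ, hγ, h0, h1, hl⟩
    obtain ⟨t, ht, hte⟩ : ρ ∈ (fun t => ‖γ t‖) '' Icc (0 : ℝ) 1 := by
      apply intermediate_value_Icc zero_le_one (hγ.norm.continuousOn)
      simp [h0, h1, hρ.le, hρe.le]
    exact (hsph _ hte).trans (hl t ht)
  have hbdd : BddBelow Γ := ⟨α, hlow⟩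
  set c := sInf Γ with hc
  have hαc : α ≤ c := le_csInf ⟨b, hbΓ⟩ hlow
  have hcb : c ≤ b := csInf_le hbdd hbΓ
  by_contra! hcon
  have hnc : ∀ x, J x = c → g x ≠ 0 := by
    intro x hx h0
    exact absurd (hcon x h0 (hx ▸ hαc)) (by rw [hx]; exact not_lt.2 hcb)
  set S : Set E := {x | α / 2 ≤ J x} with hSdef
  have hSc : IsCompact S := by
    have hcl : IsClosed S := isClosed_le continuous_const hJc
    have := hinf.eventually (eventually_lt_atBot (α / 2))
    rw [Filter.Eventually, mem_cocompact] at this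
    obtain ⟨t, ht, hts⟩ := this
    refine ht.of_isClosed_subset hcl fun x hx => ?_
    by_contra hxt
    exact absurd (show J x < α / 2 from hts hxt) (not_lt.2 hx)
  obtain ⟨G, hG0, hG⟩ : ∃ G > 0, ∀ x ∈ S, ‖g x‖ ≤ G := by
    obtain ⟨G, hG⟩ := hSc.exists_bound_of_continuousOn hg.continuousOn
    exact ⟨max G 1, by positivity, fun x hx => (hG x hx).trans (le_max_left _ _)⟩
  obtain ⟨ε, δ, hε, hδ, hδα, hgε⟩ : ∃ ε δ : ℝ, 0 < ε ∧ 0 < δ ∧ 2 * δ ≤ α / 2 ∧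
      ∀ x, |J x - c| ≤ 2 * δ → ε ≤ ‖g x‖ := by
    by_contra! hno
    have hseq : ∀ n : ℕ, ∃ x, |J x - c| ≤ 2 * (α / 4 / (n + 1)) ∧ ‖g x‖ < 1 / ((n : ℝ) + 1) := by
      intro n
      refine hno (1 / ((n : ℝ) + 1)) (α / 4 / (n + 1)) (by positivity) (by positivity) ?_
      have : α / 4 / ((n : ℝ) + 1) ≤ α / 4 :=
        div_le_self (by positivity) (by linarith [n.cast_nonneg (α := ℝ)])
      linarith
    choose x hx1 hx2 using hseq
    have hxS : ∀ n, x n ∈ S := by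
      intro n
      have : α / 4 / ((n : ℝ) + 1) ≤ α / 4 :=
        div_le_self (by positivity) (by linarith [n.cast_nonneg (α := ℝ)])
      have := (abs_le.1 (hx1 n)).1
      simp only [hSdef, mem_ofPred_eq]
      linarith
    obtain ⟨a, -, φ, hφ, hlim⟩ := hSc.tendsto_subseq hxS
    have h0 : Tendsto (fun n : ℕ => 1 / ((n : ℝ) + 1)) atTop (𝓝 0) :=
      tendsto_one_div_add_atTop_nhds_zero_nat
    have hga : g a = 0 := by
      have l1 : Tendsto (fun n => ‖g (x (φ n))‖) atTop (𝓝 ‖g a‖) := (hg.norm.tendsto a).comp hlim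
      have l2 : Tendsto (fun n => ‖g (x (φ n))‖) atTop (𝓝 0) :=
        squeeze_zero (fun _ => norm_nonneg _) (fun n => (hx2 (φ n)).le) (h0.comp hφ.tendsto_atTop)
      exact norm_eq_zero.1 (tendsto_nhds_unique l1 l2)
    have hJa : J a = c := by
      have l1 : Tendsto (fun n => |J (x (φ n)) - c|) atTop (𝓝 |J a - c|) :=
        (((hJc.sub continuous_const).abs).tendsto a).comp hlim
      have l2 : Tendsto (fun n => |J (x (φ n)) - c|) atTop (𝓝 0) := by
        refine squeeze_zero (fun _ => abs_nonneg _) (fun n => hx1 (φ n)) ?_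
        have := (h0.comp hφ.tendsto_atTop).const_mul (2 * (α / 4))
        simp only [mul_zero] at this
        refine this.congr fun n => ?_
        simp only [Function.comp]
        ring
      have := tendsto_nhds_unique l1 l2
      linarith [abs_eq_zero.1 this]
    exact hnc a hJa hga
  obtain ⟨s₀, hs₀, hexp⟩ := exists_uniform_first_order hg hJ hSc
    (η := ε ^ 2 / (2 * G)) (by positivity)
  set s := s₀ / (2 * G) with hs
  have hspos : 0 < s := by positivity
  set χ : ℝ → ℝ := fun r => max 0 (min 1 ((r - (c - 2 * δ)) / δ)) with hχ
  have hχc : Continuous χ := by fun_prop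
  have hχ0 : ∀ r, 0 ≤ χ r := fun r => le_max_left _ _
  have hχ1 : ∀ r, χ r ≤ 1 := fun r => max_le zero_le_one (min_le_left _ _)
  have hχz : ∀ r, r ≤ c - 2 * δ → χ r = 0 := by
    intro r hr
    apply max_eq_left
    exact (min_le_right _ _).trans (div_nonpos_of_nonpos_of_nonneg (by linarith) hδ.le)
  have hχo : ∀ r, c - δ ≤ r → χ r = 1 := by
    intro r hr
    have : 1 ≤ (r - (c - 2 * δ)) / δ := by rw [le_div_iff₀ hδ]; linarith
    simp [hχ, this]
  set Φ : E → E := fun x => x + (-(s * χ (J x))) • g x with hΦ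
  have hΦc : Continuous Φ := by fun_prop
  have hstep : ∀ x, c - 2 * δ ≤ J x → J x ≤ c + 2 * δ →
      J (Φ x) ≤ J x - s * χ (J x) * (ε ^ 2 / 2) := by
    intro x h1 h2
    have hxS : x ∈ S := by
      simp only [hSdef, mem_ofPred_eq]; linarith
    have hge : ε ≤ ‖g x‖ := hgε x (abs_le.2 ⟨by linarith, by linarith⟩)
    have hgG := hG x hxS
    set τ := s * χ (J x) with hτ
    have hτ0 : 0 ≤ τ := mul_nonneg hspos.le (hχ0 _)
    have hτs : τ ≤ s := mul_le_of_le_one_right hspos.le (hχ1 _)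
    have hn : ‖(-τ) • g x‖ = τ * ‖g x‖ := by
      rw [norm_smul, norm_neg, Real.norm_eq_abs, abs_of_nonneg hτ0]
    have hlt : ‖(-τ) • g x‖ < s₀ := by
      rw [hn]
      calc τ * ‖g x‖ ≤ s * G := by gcongr
        _ = s₀ / 2 := by rw [hs]; field_simp
        _ < s₀ := by linarith
    have := hexp x hxS _ hlt
    rw [hn, inner_smul_right, real_inner_self_eq_norm_sq] at this
    have h3 : ε ^ 2 / (2 * G) * (τ * ‖g x‖) ≤ τ * (ε ^ 2 / 2) := by
      calc ε ^ 2 / (2 * G) * (τ * ‖g x‖) ≤ ε ^ 2 / (2 * G) * (τ * G) := by gcongr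
        _ = _ := by field_simp
    have h4 : τ * ε ^ 2 ≤ τ * ‖g x‖ ^ 2 := by gcongr
    calc J (Φ x) ≤ _ := this
      _ ≤ _ := by nlinarith
  set κ := min δ (s * (ε ^ 2 / 4)) with hκ
  have hκpos : 0 < κ := by positivity
  obtain ⟨l, ⟨γ, hγ, hγ0, hγ1, hγl⟩, hlc⟩ :=
    exists_lt_of_csInf_lt ⟨b, hbΓ⟩ (show sInf Γ < c + κ by linarith)
  have hfix : ∀ x, J x ≤ c - 2 * δ → Φ x = x := fun x hx => by simp [hΦ, hχz _ hx]
  have hmem : c - κ ∈ Γ := by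
    refine ⟨fun t => Φ (γ t), hΦc.comp hγ, ?_, ?_, fun t ht => ?_⟩
    · simp only [hγ0]; exact hfix 0 (by linarith)
    · simp only [hγ1]; exact hfix e (by linarith)
    · have hJl := (hγl t ht).trans hlc.le
      have hκδ : κ ≤ δ := min_le_left _ _
      have hκs : κ ≤ s * (ε ^ 2 / 4) := min_le_right _ _
      by_cases h1 : J (γ t) ≤ c - 2 * δ
      · simp only [hfix _ h1]; linarith
      push Not at h1
      have hst := hstep (γ t) h1.le (by linarith)
      by_cases h2 : c - δ ≤ J (γ t)
      · rw [hχo _ h2] at hst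
        simp only [mul_one] at hst
        linarith
      · push Not at h2
        have : 0 ≤ s * χ (J (γ t)) * (ε ^ 2 / 2) :=
          mul_nonneg (mul_nonneg hspos.le (hχ0 _)) (by positivity)
        linarith
  have := csInf_le hbdd hmem
  linarith

end MountainPass

theorem hasDerivAt_primF {f : ℝ → ℝ} (hf : Continuous f) (s : ℝ) :
    HasDerivAt (primF f) (f s) s :=
  intervalIntegral.integral_hasDerivAt_right (hf.intervalIntegrable _ _)
    hf.aestronglyMeasurable.stronglyMeasurableAtFilter hf.continuousAt

theorem continuous_primF {f : ℝ → ℝ} (hf : Continuous f) : Continuous (primF f) :=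
  continuous_iff_continuousAt.2 fun s => (hasDerivAt_primF hf s).continuousAt

@[simp] theorem primF_zero (f : ℝ → ℝ) : primF f 0 = 0 := by simp [primF]

theorem exists_bound_comp_inner {E X : Type*} [NormedAddCommGroup E]
    [InnerProductSpace ℝ E] {F : ℝ → ℝ} (hF : Continuous F) {ℓ : X → E} {B : ℝ}
    (hB : ∀ x, ‖ℓ x‖ ≤ B) (R : ℝ) : ∃ C, ∀ x, ∀ h : E, ‖h‖ ≤ R → |F ⟪ℓ x, h⟫| ≤ C := by
  obtain ⟨C, hC⟩ := (isCompact_Icc (a := -(B * R)) (b := B * R)).exists_bound_of_continuousOn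
    hF.continuousOn
  refine ⟨C, fun x h hh => hC _ ?_⟩
  refine abs_le.1 ((abs_real_inner_le_norm _ _).trans ?_)
  have := (norm_nonneg _).trans (hB x)
  gcongr
  exact hB x

section Energy

variable {E : Type*} [NormedAddCommGroup E] [InnerProductSpace ℝ E]
  {X : Type*} [MeasurableSpace X] {μ : Measure X}

/-- The energy functional restricted to a finite-dimensional space. -/
noncomputable def energy (μ : Measure X) (f : ℝ → ℝ) (ℓ : X → E) (h : E) : ℝ :=
  1 / 2 * ‖h‖ ^ 2 - ∫ x, primF f ⟪ℓ x, h⟫ ∂μ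

/-- The gradient of `energy`. -/
noncomputable def energyGrad (μ : Measure X) (f : ℝ → ℝ) (ℓ : X → E) (h : E) : E :=
  h - ∫ x, f ⟪ℓ x, h⟫ • ℓ x ∂μ

variable [IsFiniteMeasure μ] {f : ℝ → ℝ} {ℓ : X → E} {B : ℝ}

theorem continuous_energyGrad (hf : Continuous f) (hℓ : StronglyMeasurable ℓ)
    (hB : ∀ x, ‖ℓ x‖ ≤ B) : Continuous (energyGrad μ f ℓ) := by
  refine continuous_id.sub (continuous_iff_continuousAt.2 fun h₀ => ?_)
  obtain ⟨C, hC⟩ := exists_bound_comp_inner hf hB (‖h₀‖ + 1)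
  refine continuousAt_of_dominated (bound := fun _ => C * B) ?_ ?_ (integrable_const _) ?_
  · exact .of_forall fun h => ((hf.comp_stronglyMeasurable (hℓ.inner stronglyMeasurable_const)).smul
      hℓ).aestronglyMeasurable
  · filter_upwards [ball_mem_nhds h₀ one_pos] with h hh
    refine .of_forall fun x => ?_
    have h1 : ‖h‖ ≤ ‖h₀‖ + 1 := by
      have : ‖h - h₀‖ < 1 := by simpa [dist_eq_norm] using hh
      linarith [norm_le_norm_add_norm_sub' h h₀]
    rw [norm_smul]
    have := hC x h h1
    exact mul_le_mul this (hB x) (norm_nonneg _) ((abs_nonneg _).trans this)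
  · exact .of_forall fun x => by fun_prop

variable [FiniteDimensional ℝ E]

theorem hasGradientAt_energy (hf : Continuous f) (hℓ : StronglyMeasurable ℓ)
    (hB : ∀ x, ‖ℓ x‖ ≤ B) (h₀ : E) :
    HasGradientAt (energy μ f ℓ) (energyGrad μ f ℓ h₀) h₀ := by
  have hFc := continuous_primF hf
  obtain ⟨C, hC⟩ := exists_bound_comp_inner hf hB (‖h₀‖ + 1)
  obtain ⟨C', hC'⟩ := exists_bound_comp_inner hFc hB ‖h₀‖
  have hmeas : StronglyMeasurable fun x => f ⟪ℓ x, h₀⟫ • ℓ x :=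
    (hf.comp_stronglyMeasurable (hℓ.inner stronglyMeasurable_const)).smul hℓ
  have hInt : Integrable (fun x => f ⟪ℓ x, h₀⟫ • ℓ x) μ := by
    refine Integrable.of_bound hmeas.aestronglyMeasurable (C * B) (.of_forall fun x => ?_)
    rw [norm_smul]
    have := hC x h₀ (by linarith)
    exact mul_le_mul this (hB x) (norm_nonneg _) ((abs_nonneg _).trans this)
  have h1 : HasFDerivAt (fun h => ∫ x, primF f ⟪ℓ x, h⟫ ∂μ)
      (∫ x, InnerProductSpace.toDual ℝ E (f ⟪ℓ x, h₀⟫ • ℓ x) ∂μ) h₀ := by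
    refine hasFDerivAt_integral_of_dominated_of_fderiv_le
      (F' := fun h x => InnerProductSpace.toDual ℝ E (f ⟪ℓ x, h⟫ • ℓ x))
      (bound := fun _ => C * B) (ball_mem_nhds h₀ one_pos) ?_ ?_ ?_ ?_ (integrable_const _) ?_
    · exact .of_forall fun h => (hFc.comp_stronglyMeasurable
        (hℓ.inner stronglyMeasurable_const)).aestronglyMeasurable
    · exact Integrable.of_bound (hFc.comp_stronglyMeasurable
        (hℓ.inner stronglyMeasurable_const)).aestronglyMeasurable C'
        (.of_forall fun x => hC' x h₀ le_rfl)
    · exact ((InnerProductSpace.toDual ℝ E).continuous.comp_stronglyMeasurable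
        hmeas).aestronglyMeasurable
    · refine .of_forall fun x h hh => ?_
      have h1 : ‖h‖ ≤ ‖h₀‖ + 1 := by
        have : ‖h - h₀‖ < 1 := by simpa [dist_eq_norm] using hh
        linarith [norm_le_norm_add_norm_sub' h h₀]
      rw [LinearIsometryEquiv.norm_map, norm_smul]
      have := hC x h h1
      exact mul_le_mul this (hB x) (norm_nonneg _) ((abs_nonneg _).trans this)
    · refine .of_forall fun x h _ => ?_
      have := (hasDerivAt_primF hf ⟪ℓ x, h⟫).hasFDerivAt.comp h (innerSL ℝ (ℓ x)).hasFDerivAt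
      refine this.congr_fderiv ?_
      ext v
      simp [mul_comm]
  have h2 : HasFDerivAt (fun h : E => 1 / 2 * ‖h‖ ^ 2) (InnerProductSpace.toDual ℝ E h₀) h₀ := by
    have := (hasStrictFDerivAt_norm_sq h₀).hasFDerivAt.const_mul (1 / 2 : ℝ)
    refine this.congr_fderiv ?_
    ext v
    simp
  rw [hasGradientAt_iff_hasFDerivAt]
  refine (h2.sub h1).congr_fderiv ?_
  rw [energyGrad, map_sub]
  congr 1
  exact (InnerProductSpace.toDual ℝ E).toContinuousLinearEquiv.toContinuousLinearMap
    |>.integral_comp_comm hInt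

theorem exists_lower_bound_integral_inner_sq (hℓ : StronglyMeasurable ℓ)
    (hB : ∀ x, ‖ℓ x‖ ≤ B) (hinj : ∀ h : E, (∀ᵐ x ∂μ, ⟪ℓ x, h⟫ = 0) → h = 0) :
    ∃ κ > 0, ∀ h : E, κ * ‖h‖ ^ 2 ≤ ∫ x, ⟪ℓ x, h⟫ ^ 2 ∂μ := by
  set q : E → ℝ := fun h => ∫ x, ⟪ℓ x, h⟫ ^ 2 ∂μ with hq
  have hbd : ∀ R, ∃ C, ∀ x, ∀ h : E, ‖h‖ ≤ R → |(fun s : ℝ => s ^ 2) ⟪ℓ x, h⟫| ≤ C := fun R =>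
    exists_bound_comp_inner (F := fun s : ℝ => s ^ 2) (by fun_prop) hB R
  have hmeas : ∀ h : E, StronglyMeasurable fun x => ⟪ℓ x, h⟫ ^ 2 := fun h =>
    (hℓ.inner stronglyMeasurable_const).pow 2
  have hqc : Continuous q := by
    refine continuous_iff_continuousAt.2 fun h₀ => ?_
    obtain ⟨C, hC⟩ := hbd (‖h₀‖ + 1)
    refine continuousAt_of_dominated (bound := fun _ => C) ?_ ?_ (integrable_const _) ?_
    · exact .of_forall fun h => (hmeas h).aestronglyMeasurable
    · filter_upwards [ball_mem_nhds h₀ one_pos] with h hh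
      refine .of_forall fun x => hC x h ?_
      have : ‖h - h₀‖ < 1 := by simpa [dist_eq_norm] using hh
      linarith [norm_le_norm_add_norm_sub' h h₀]
    · exact .of_forall fun x => by fun_prop
  have hInt : ∀ h : E, Integrable (fun x => ⟪ℓ x, h⟫ ^ 2) μ := fun h => by
    obtain ⟨C, hC⟩ := hbd ‖h‖
    exact Integrable.of_bound (hmeas h).aestronglyMeasurable C (.of_forall fun x => hC x h le_rfl)
  have hpos : ∀ h : E, h ≠ 0 → 0 < q h := by
    intro h hh
    refine lt_of_le_of_ne (integral_nonneg fun x => sq_nonneg _) fun h0 => hh (hinj h ?_)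
    have := (integral_eq_zero_iff_of_nonneg (fun x => sq_nonneg _) (hInt h)).1 h0.symm
    filter_upwards [this] with x hx
    exact pow_eq_zero_iff two_ne_zero |>.1 hx
  have hscale : ∀ (r : ℝ) (h : E), q (r • h) = r ^ 2 * q h := by
    intro r h
    simp only [hq, inner_smul_right, mul_pow, integral_const_mul]
  rcases (sphere (0 : E) 1).eq_empty_or_nonempty with he | hne
  · refine ⟨1, one_pos, fun h => ?_⟩
    have : h = 0 := by
      by_contra hh
      have : ‖h‖⁻¹ • h ∈ sphere (0 : E) 1 := by simp [norm_smul, hh]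
      simp [he] at this
    simp [this]
  · obtain ⟨a, ha, hmin⟩ := (isCompact_sphere (0 : E) 1).exists_isMinOn hne hqc.continuousOn
    have ha0 : a ≠ 0 := by
      rintro rfl; simp at ha
    refine ⟨q a, hpos a ha0, fun h => ?_⟩
    by_cases hh : h = 0
    · simp [hh]
    have hm : ‖h‖⁻¹ • h ∈ sphere (0 : E) 1 := by simp [norm_smul, hh]
    have h1 : q a ≤ q (‖h‖⁻¹ • h) := hmin hm
    have h2 : q h = ‖h‖ ^ 2 * q (‖h‖⁻¹ • h) := by
      rw [← hscale, smul_smul, mul_inv_cancel₀ (norm_ne_zero_iff.2 hh), one_smul]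
    calc q a * ‖h‖ ^ 2 ≤ q (‖h‖⁻¹ • h) * ‖h‖ ^ 2 := by gcongr
      _ = q h := by rw [h2, mul_comm]

theorem tendsto_energy_cocompact (hf : Continuous f) (hℓ : StronglyMeasurable ℓ)
    (hB : ∀ x, ‖ℓ x‖ ≤ B) (hinj : ∀ h : E, (∀ᵐ x ∂μ, ⟪ℓ x, h⟫ = 0) → h = 0)
    (hF : ∀ A, ∃ C, ∀ s, A * s ^ 2 - C ≤ primF f s) :
    Tendsto (energy μ f ℓ) (cocompact E) atBot := by
  obtain ⟨κ, hκ, hκh⟩ := exists_lower_bound_integral_inner_sq hℓ hB hinj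
  obtain ⟨C, hC⟩ := hF κ⁻¹
  have hle : ∀ h, energy μ f ℓ h ≤ -(1 / 2) * ‖h‖ ^ 2 + C * μ.real univ := by
    intro h
    obtain ⟨C1, hC1⟩ := exists_bound_comp_inner (continuous_primF hf) hB ‖h‖
    obtain ⟨C2, hC2⟩ := exists_bound_comp_inner (F := fun s : ℝ => s ^ 2) (by fun_prop) hB ‖h‖
    have i1 : Integrable (fun x => primF f ⟪ℓ x, h⟫) μ :=
      Integrable.of_bound ((continuous_primF hf).comp_stronglyMeasurable
        (hℓ.inner stronglyMeasurable_const)).aestronglyMeasurable C1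
        (.of_forall fun x => hC1 x h le_rfl)
    have i2 : Integrable (fun x => ⟪ℓ x, h⟫ ^ 2) μ :=
      Integrable.of_bound ((hℓ.inner stronglyMeasurable_const).pow 2).aestronglyMeasurable C2
        (.of_forall fun x => hC2 x h le_rfl)
    have h1 : ∫ x, (κ⁻¹ * ⟪ℓ x, h⟫ ^ 2 - C) ∂μ ≤ ∫ x, primF f ⟪ℓ x, h⟫ ∂μ :=
      integral_mono ((i2.const_mul _).sub (integrable_const _)) i1 fun x => hC _
    rw [integral_sub (i2.const_mul _) (integrable_const _), integral_const_mul, integral_const,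
      smul_eq_mul] at h1
    have h2 : ‖h‖ ^ 2 ≤ κ⁻¹ * ∫ x, ⟪ℓ x, h⟫ ^ 2 ∂μ := by
      rw [le_inv_mul_iff₀ hκ]; exact hκh h
    simp only [energy]
    linarith
  refine tendsto_atBot_mono hle ?_
  refine tendsto_atBot_add_const_right _ _ ?_
  refine Tendsto.const_mul_atTop_of_neg (by norm_num) ?_
  exact (tendsto_pow_atTop two_ne_zero).comp tendsto_norm_cocompact_atTop

end Energy

/-- Symmetric positive kernels with a logarithmic singularity, in the sense of sharp uniform
exponential integrability below the exponent `4π`. -/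
structure IsGreenKernel {X : Type*} [MeasurableSpace X] (μ : Measure X) (k : X → X → ℝ) :
    Prop where
  meas : Measurable (Function.uncurry k)
  symm : ∀ x y, k x y = k y x
  nonneg : ∀ x y, 0 ≤ k x y
  exp_bound : ∀ α, 0 < α → α < 4 * π → ∃ C : ℝ, ∀ x,
    ∫⁻ y, ENNReal.ofReal (exp (α * k x y)) ∂μ ≤ ENNReal.ofReal C
  pos : ∀ g : X → ℝ, MemLp g 2 μ → 0 ≤ ∫ x, (∫ y, k x y * g y ∂μ) * g x ∂μ

namespace IsGreenKernel

variable {X : Type*} [MeasurableSpace X] {μ : Measure X} {k : X → X → ℝ}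

theorem measurable_right (hk : IsGreenKernel μ k) (x : X) : Measurable (k x) :=
  hk.meas.comp measurable_prodMk_left

theorem lintegral_pow_le (hk : IsGreenKernel μ k) {α C : ℝ} (hα : 0 < α)
    (hC : ∀ x, ∫⁻ y, ENNReal.ofReal (exp (α * k x y)) ∂μ ≤ ENNReal.ofReal C) (q : ℕ) (x : X) :
    ∫⁻ y, ENNReal.ofReal (k x y ^ q) ∂μ ≤ ENNReal.ofReal (q.factorial / α ^ q * C) := by
  calc ∫⁻ y, ENNReal.ofReal (k x y ^ q) ∂μ
      ≤ ∫⁻ y, ENNReal.ofReal (q.factorial / α ^ q) * ENNReal.ofReal (exp (α * k x y)) ∂μ := by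
        refine lintegral_mono fun y => ?_
        rw [← ENNReal.ofReal_mul (by positivity)]
        refine ENNReal.ofReal_le_ofReal ?_
        have := Real.pow_div_factorial_le_exp (α * k x y) (mul_nonneg hα.le (hk.nonneg x y)) q
        rw [mul_pow, div_le_iff₀ (by positivity)] at this
        rw [div_mul_eq_mul_div, le_div_iff₀ (by positivity)]
        linarith
    _ = ENNReal.ofReal (q.factorial / α ^ q) * ∫⁻ y, ENNReal.ofReal (exp (α * k x y)) ∂μ := by
        rw [lintegral_const_mul']
        exact ENNReal.ofReal_ne_top
    _ ≤ ENNReal.ofReal (q.factorial / α ^ q) * ENNReal.ofReal C := by gcongr; exact hC x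
    _ = _ := by rw [ENNReal.ofReal_mul (by positivity)]

theorem exists_eLpNorm_le (hk : IsGreenKernel μ k) :
    ∃ C : ℝ, 0 ≤ C ∧ ∀ x, eLpNorm (k x) 2 μ ≤ ENNReal.ofReal C := by
  obtain ⟨C, hC⟩ := hk.exp_bound 1 one_pos (by linarith [pi_gt_three])
  refine ⟨√(2 / 1 ^ 2 * max C 0), by positivity, fun x => ?_⟩
  have h := hk.lintegral_pow_le one_pos hC 2 x
  rw [eLpNorm_eq_lintegral_rpow_enorm_toReal (by norm_num) (by norm_num)]
  have h2 : ∫⁻ y, ‖k x y‖ₑ ^ (ENNReal.toReal 2) ∂μ = ∫⁻ y, ENNReal.ofReal (k x y ^ 2) ∂μ := by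
    refine lintegral_congr fun y => ?_
    rw [Real.enorm_of_nonneg (hk.nonneg x y), ENNReal.ofReal_pow (hk.nonneg x y)]
    norm_num
  rw [h2, Real.sqrt_eq_rpow, ← ENNReal.ofReal_rpow_of_nonneg (by positivity) (by norm_num)]
  norm_num only [ENNReal.toReal_ofNat]
  refine ENNReal.rpow_le_rpow (h.trans (ENNReal.ofReal_le_ofReal ?_)) (by norm_num)
  norm_num [Nat.factorial]

theorem memLp_right (hk : IsGreenKernel μ k) (x : X) : MemLp (k x) 2 μ := by
  obtain ⟨C, -, hC⟩ := hk.exists_eLpNorm_le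
  exact ⟨(hk.measurable_right x).aestronglyMeasurable, (hC x).trans_lt ENNReal.ofReal_lt_top⟩

/-- The section `k x` as an element of `L²`. -/
noncomputable def vec (hk : IsGreenKernel μ k) (x : X) : Lp ℝ 2 μ := (hk.memLp_right x).toLp (k x)

theorem exists_norm_vec_le (hk : IsGreenKernel μ k) :
    ∃ C : ℝ, 0 ≤ C ∧ ∀ x, ‖hk.vec x‖ ≤ C := by
  obtain ⟨C, hC0, hC⟩ := hk.exists_eLpNorm_le
  refine ⟨C, hC0, fun x => ?_⟩
  rw [vec, Lp.norm_toLp]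
  exact ENNReal.toReal_le_of_le_ofReal hC0 (hC x)

theorem inner_vec (hk : IsGreenKernel μ k) (x : X) (g : Lp ℝ 2 μ) :
    ⟪hk.vec x, g⟫ = ∫ y, k x y * g y ∂μ := by
  rw [L2.inner_def]
  refine integral_congr_ae ?_
  filter_upwards [(hk.memLp_right x).coeFn_toLp] with y hy
  simp only [vec]
  rw [hy]
  simp [mul_comm]

theorem stronglyMeasurable_inner_vec [SFinite μ] (hk : IsGreenKernel μ k) (g : Lp ℝ 2 μ) :
    StronglyMeasurable fun x => ⟪hk.vec x, g⟫ := by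
  simp_rw [inner_vec]
  refine StronglyMeasurable.integral_prod_right (f := fun x y => k x y * g y) ?_
  exact hk.meas.stronglyMeasurable.mul ((Lp.stronglyMeasurable g).comp_measurable measurable_snd)

variable {K : Lp ℝ 2 μ →L[ℝ] Lp ℝ 2 μ}

theorem inner_operator (hk : IsGreenKernel μ k) (hK : ∀ g, K g =ᵐ[μ] fun x => ⟪hk.vec x, g⟫)
    (g g' : Lp ℝ 2 μ) : ⟪K g, g'⟫ = ∫ x, (∫ y, k x y * g y ∂μ) * g' x ∂μ := by
  rw [L2.inner_def]
  refine integral_congr_ae ?_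
  filter_upwards [hK g] with x hx
  rw [hx, inner_vec]
  simp [mul_comm]

theorem operator_pos (hk : IsGreenKernel μ k) (hK : ∀ g, K g =ᵐ[μ] fun x => ⟪hk.vec x, g⟫)
    (g : Lp ℝ 2 μ) : 0 ≤ ⟪K g, g⟫ := by
  rw [hk.inner_operator hK]
  exact hk.pos _ (Lp.memLp g)

variable [IsFiniteMeasure μ]

theorem memLp_inner_vec (hk : IsGreenKernel μ k) (g : Lp ℝ 2 μ) (p : ℝ≥0∞) :
    MemLp (fun x => ⟪hk.vec x, g⟫) p μ := by
  obtain ⟨C, hC0, hC⟩ := hk.exists_norm_vec_le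
  refine MemLp.of_bound (hk.stronglyMeasurable_inner_vec g).aestronglyMeasurable (C * ‖g‖)
    (.of_forall fun x => ?_)
  exact (norm_inner_le_norm _ _).trans (by gcongr; exact hC x)

/-- The integral operator on `L²` with kernel `k`. -/
theorem exists_operator (hk : IsGreenKernel μ k) :
    ∃ K : Lp ℝ 2 μ →L[ℝ] Lp ℝ 2 μ, ∀ g, K g =ᵐ[μ] fun x => ⟪hk.vec x, g⟫ := by
  obtain ⟨C, hC0, hC⟩ := hk.exists_norm_vec_le
  let L : Lp ℝ 2 μ →ₗ[ℝ] Lp ℝ 2 μ :=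
    { toFun := fun g => (hk.memLp_inner_vec g 2).toLp _
      map_add' := fun g g' => by
        rw [← MemLp.toLp_add]
        refine MemLp.toLp_congr _ _ (.of_forall fun x => ?_)
        simp [inner_add_right]
      map_smul' := fun r g => by
        rw [RingHom.id_apply, ← MemLp.toLp_const_smul]
        refine MemLp.toLp_congr _ _ (.of_forall fun x => ?_)
        simp [inner_smul_right] }
  refine ⟨L.mkContinuous ((μ.real univ) ^ ((2 : ℝ≥0∞).toReal⁻¹) * C) fun g => ?_,
    fun g => (hk.memLp_inner_vec g 2).coeFn_toLp⟩
  rw [mul_assoc]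
  refine Lp.norm_le_of_ae_bound (by positivity) ?_
  filter_upwards [(hk.memLp_inner_vec g 2).coeFn_toLp] with x hx
  change ‖((hk.memLp_inner_vec g 2).toLp _ : X → ℝ) x‖ ≤ _
  rw [hx]
  exact (norm_inner_le_norm _ _).trans (by gcongr; exact hC x)

theorem integrable_mul_mul (hk : IsGreenKernel μ k) (g g' : Lp ℝ 2 μ) :
    Integrable (fun p : X × X => k p.1 p.2 * g p.2 * g' p.1) (μ.prod μ) := by
  obtain ⟨C, hC0, hC⟩ := hk.exists_norm_vec_le
  have hm : AEStronglyMeasurable (fun p : X × X => k p.1 p.2 * g p.2 * g' p.1) (μ.prod μ) :=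
    ((hk.meas.stronglyMeasurable.mul ((Lp.stronglyMeasurable g).comp_measurable measurable_snd)).mul
      ((Lp.stronglyMeasurable g').comp_measurable measurable_fst)).aestronglyMeasurable
  have habs : MemLp (fun y => |g y|) 2 μ := (Lp.memLp g).abs
  have hig : ∀ x, Integrable (fun y => k x y * g y) μ := fun x =>
    (hk.memLp_right x).integrable_mul (Lp.memLp g)
  rw [integrable_prod_iff hm]
  refine ⟨.of_forall fun x => (hig x).mul_const (g' x), ?_⟩
  refine Integrable.mono' (((Lp.memLp g').integrable (by norm_num)).abs.const_mul (C * ‖g‖))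
    hm.norm.integral_prod_right' (.of_forall fun x => ?_)
  simp only [norm_mul, Real.norm_eq_abs]
  rw [integral_mul_const]
  have h1 : ∫ y, |k x y| * |g y| ∂μ = ⟪hk.vec x, habs.toLp _⟫ := by
    rw [inner_vec]
    refine integral_congr_ae ?_
    filter_upwards [habs.coeFn_toLp] with y hy
    rw [hy, abs_of_nonneg (hk.nonneg x y)]
  rw [h1, abs_mul, abs_abs]
  gcongr
  refine (abs_real_inner_le_norm _ _).trans ?_
  gcongr
  · exact hC x
  · rw [Lp.norm_toLp, Lp.norm_def]
    refine le_of_eq ?_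
    congr 1
    exact eLpNorm_norm (g : X → ℝ)

theorem operator_symm (hk : IsGreenKernel μ k) (hK : ∀ g, K g =ᵐ[μ] fun x => ⟪hk.vec x, g⟫)
    (g g' : Lp ℝ 2 μ) : ⟪K g, g'⟫ = ⟪g, K g'⟫ := by
  rw [real_inner_comm (K g') g, hk.inner_operator hK, hk.inner_operator hK]
  simp_rw [← integral_mul_const]
  rw [integral_integral_swap (hk.integrable_mul_mul g g')]
  refine integral_congr_ae (.of_forall fun x => integral_congr_ae (.of_forall fun y => ?_))
  simp only [hk.symm y x]
  ring

/-- The operator maps weakly convergent sequences to strongly convergent ones. -/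
theorem tendsto_operator_of_weak (hk : IsGreenKernel μ k)
    (hK : ∀ g, K g =ᵐ[μ] fun x => ⟪hk.vec x, g⟫) {g : ℕ → Lp ℝ 2 μ} {R : ℝ}
    (hR : ∀ n, ‖g n‖ ≤ R) (hw : ∀ v, Tendsto (fun n => ⟪v, g n⟫) atTop (𝓝 0)) :
    Tendsto (fun n => ‖K (g n)‖) atTop (𝓝 0) := by
  obtain ⟨C, hC0, hC⟩ := hk.exists_norm_vec_le
  have h1 : ∀ n, ‖K (g n)‖ ^ 2 = ∫ x, ⟪hk.vec x, g n⟫ ^ 2 ∂μ := by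
    intro n
    rw [← real_inner_self_eq_norm_sq, L2.inner_def]
    refine integral_congr_ae ?_
    filter_upwards [hK (g n)] with x hx
    rw [hx]
    simp [sq]
  have h2 : Tendsto (fun n => ∫ x, ⟪hk.vec x, g n⟫ ^ 2 ∂μ) atTop (𝓝 (∫ _, (0 : ℝ) ∂μ)) := by
    refine tendsto_integral_of_dominated_convergence (fun _ => (C * R) ^ 2)
      (fun n => ((hk.stronglyMeasurable_inner_vec (g n)).pow 2).aestronglyMeasurable)
      (integrable_const _) (fun n => .of_forall fun x => ?_) (.of_forall fun x => ?_)
    · rw [norm_pow]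
      gcongr
      exact (norm_inner_le_norm _ _).trans (by gcongr; exacts [hC x, hR n])
    · simpa using (hw (hk.vec x)).pow 2
  simp_rw [← h1] at h2
  simpa using h2.sqrt

end IsGreenKernel

theorem natCast_mul_pow_mul_le {a b : ℝ} (ha : 0 ≤ a) (hb : 0 ≤ b) {q : ℕ} (hq : 1 ≤ q) :
    q * (a ^ (q - 1) * b) ≤ (q - 1) * a ^ q + b ^ q := by
  obtain ⟨n, rfl⟩ : ∃ n, q = n + 1 := ⟨q - 1, by omega⟩
  simp only [add_tsub_cancel_right]
  rcases ha.eq_or_lt with rfl | ha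
  · rcases Nat.eq_zero_or_pos n with rfl | hn
    · simp
    · rw [zero_pow hn.ne', zero_pow (by omega)]
      simp only [zero_mul, mul_zero, zero_add]
      positivity
  · have h := one_add_mul_le_pow (a := b / a - 1) (by
      have : 0 ≤ b / a := by positivity
      linarith) (n + 1)
    rw [add_sub_cancel, div_pow, le_div_iff₀ (by positivity)] at h
    calc ((n + 1 : ℕ) : ℝ) * (a ^ n * b)
        = ((n + 1 : ℕ) - 1) * a ^ (n + 1) +
          (1 + ((n + 1 : ℕ) : ℝ) * (b / a - 1)) * a ^ (n + 1) := by
          field_simp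
          push_cast
          ring
      _ ≤ _ := by gcongr

namespace IsGreenKernel

variable {X : Type*} [MeasurableSpace X] {μ : Measure X} {k : X → X → ℝ} [IsFiniteMeasure μ]

theorem lintegral_kernel_mul_pow_le (hk : IsGreenKernel μ k) {w : X → ℝ} (hw : Measurable w)
    {q : ℕ} (hq : 1 ≤ q) {A lam : ℝ} (hlam : 0 < lam) (hA0 : 0 ≤ A)
    (hA : ∀ x, ∫⁻ y, ENNReal.ofReal (k x y ^ q) ∂μ ≤ ENNReal.ofReal A) {U : ℝ}
    (hU0 : 0 ≤ U) (hU : ∫⁻ x, ENNReal.ofReal (w x ^ (2 * q)) ∂μ = ENNReal.ofReal U)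
    (hAU : A = lam ^ q * U) :
    ∫⁻ x, ∫⁻ y, ENNReal.ofReal (k x y * |w y| ^ (2 * q - 1) * |w x| ^ (2 * q - 1)) ∂μ ∂μ ≤
      ENNReal.ofReal (lam * U ^ 2) := by
  have hq0 : (0 : ℝ) < q := by exact_mod_cast hq
  have hq1 : (0 : ℝ) ≤ (q : ℝ) - 1 := by
    have : (1 : ℝ) ≤ q := by exact_mod_cast hq
    linarith
  have hkm := hk.meas
  have hkr := hk.measurable_right
  have hpt : ∀ x y, ENNReal.ofReal (q * lam ^ (q - 1)) *
      ENNReal.ofReal (k x y * |w y| ^ (2 * q - 1) * |w x| ^ (2 * q - 1)) ≤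
      ENNReal.ofReal ((q - 1) * lam ^ q) *
        (ENNReal.ofReal (w x ^ (2 * q)) * ENNReal.ofReal (w y ^ (2 * q))) +
      (ENNReal.ofReal (1 / 2) * (ENNReal.ofReal (w x ^ (2 * q)) * ENNReal.ofReal (k x y ^ q)) +
      ENNReal.ofReal (1 / 2) * (ENNReal.ofReal (w y ^ (2 * q)) * ENNReal.ofReal (k x y ^ q))) := by
    intro x y
    have hx : 0 ≤ w x ^ (2 * q) := by rw [pow_mul]; positivity
    have hy : 0 ≤ w y ^ (2 * q) := by rw [pow_mul]; positivity
    have hkx := hk.nonneg x y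
    have hkq : 0 ≤ k x y ^ q := by positivity
    rw [← ENNReal.ofReal_mul (by positivity), ← ENNReal.ofReal_mul hx, ← ENNReal.ofReal_mul
      (by positivity), ← ENNReal.ofReal_mul hx, ← ENNReal.ofReal_mul hy,
      ← ENNReal.ofReal_mul (by positivity), ← ENNReal.ofReal_mul (by positivity),
      ← ENNReal.ofReal_add (by positivity) (by positivity),
      ← ENNReal.ofReal_add (by positivity) (by positivity)]
    refine ENNReal.ofReal_le_ofReal ?_
    set z := |w x| * |w y| with hz
    have hz0 : 0 ≤ z := by positivity
    have h := natCast_mul_pow_mul_le (a := lam * z ^ 2) (b := z * k x y) (by positivity)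
      (by positivity) hq
    have e1 : (lam * z ^ 2) ^ (q - 1) * (z * k x y) =
        lam ^ (q - 1) * (k x y * |w y| ^ (2 * q - 1) * |w x| ^ (2 * q - 1)) := by
      have : 2 * q - 1 = 2 * (q - 1) + 1 := by omega
      rw [this, hz]
      ring
    have e2 : (lam * z ^ 2) ^ q = lam ^ q * (w x ^ (2 * q) * w y ^ (2 * q)) := by
      rw [hz, mul_pow, mul_pow, mul_pow, sq_abs, sq_abs, pow_mul, pow_mul]
    have e3 : (z * k x y) ^ q ≤
        1 / 2 * (w x ^ (2 * q) * k x y ^ q) + 1 / 2 * (w y ^ (2 * q) * k x y ^ q) := by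
      have hx2 : w x ^ (2 * q) = (|w x| ^ q) ^ 2 := by
        rw [pow_mul, ← sq_abs, ← pow_mul, ← pow_mul, mul_comm]
      have hy2 : w y ^ (2 * q) = (|w y| ^ q) ^ 2 := by
        rw [pow_mul, ← sq_abs, ← pow_mul, ← pow_mul, mul_comm]
      rw [mul_pow, hx2, hy2, hz, mul_pow]
      nlinarith [mul_nonneg hkq (sq_nonneg (|w x| ^ q - |w y| ^ q))]
    rw [e1, e2] at h
    calc q * lam ^ (q - 1) * (k x y * |w y| ^ (2 * q - 1) * |w x| ^ (2 * q - 1))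
        = q * (lam ^ (q - 1) * (k x y * |w y| ^ (2 * q - 1) * |w x| ^ (2 * q - 1))) := by ring
      _ ≤ _ := h
      _ ≤ _ := by rw [← mul_assoc]; gcongr
  have hwm : Measurable fun x => ENNReal.ofReal (w x ^ (2 * q)) := (hw.pow_const _).ennreal_ofReal
  have hkqm : Measurable (Function.uncurry fun x y => ENNReal.ofReal (k x y ^ q)) :=
    (hkm.pow_const q).ennreal_ofReal
  have hI1 : ∫⁻ x, ∫⁻ y, ENNReal.ofReal (w x ^ (2 * q)) * ENNReal.ofReal (k x y ^ q) ∂μ ∂μ ≤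
      ENNReal.ofReal U * ENNReal.ofReal A := by
    rw [← hU, ← lintegral_mul_const _ hwm]
    refine lintegral_mono fun x => ?_
    rw [lintegral_const_mul' _ _ ENNReal.ofReal_ne_top]
    gcongr
    exact hA x
  have hI2 : ∫⁻ x, ∫⁻ y, ENNReal.ofReal (w y ^ (2 * q)) * ENNReal.ofReal (k x y ^ q) ∂μ ∂μ ≤
      ENNReal.ofReal U * ENNReal.ofReal A := by
    rw [lintegral_lintegral_swap
      ((hwm.comp measurable_snd).mul hkqm).aemeasurable]
    simp_rw [fun x y => hk.symm x y] at hI1 ⊢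
    convert hI1 using 6
  have hI := lintegral_mono (μ := μ) fun x => lintegral_mono (μ := μ) fun y => hpt x y
  have hm1 : Measurable (Function.uncurry fun x y =>
      ENNReal.ofReal (w x ^ (2 * q)) * ENNReal.ofReal (k x y ^ q)) :=
    (hwm.comp measurable_fst).mul hkqm
  have hI3 : ∫⁻ x, ∫⁻ y, ENNReal.ofReal (w x ^ (2 * q)) * ENNReal.ofReal (w y ^ (2 * q)) ∂μ ∂μ =
      ENNReal.ofReal U * ENNReal.ofReal U := by
    simp_rw [fun x => lintegral_const_mul' (ENNReal.ofReal (w x ^ (2 * q)))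
      (fun y => ENNReal.ofReal (w y ^ (2 * q))) (μ := μ) ENNReal.ofReal_ne_top, hU]
    rw [lintegral_mul_const _ hwm, hU]
  have hkw : Measurable (Function.uncurry fun x y =>
      ENNReal.ofReal (k x y * |w y| ^ (2 * q - 1) * |w x| ^ (2 * q - 1))) := by
    have h1 : Measurable fun x => |w x| ^ (2 * q - 1) := hw.abs.pow_const _
    exact ((hkm.mul (h1.comp measurable_snd)).mul (h1.comp measurable_fst)).ennreal_ofReal
  have hL : ∀ x, ∫⁻ y, (ENNReal.ofReal ((q - 1) * lam ^ q) *
        (ENNReal.ofReal (w x ^ (2 * q)) * ENNReal.ofReal (w y ^ (2 * q))) +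
      (ENNReal.ofReal (1 / 2) * (ENNReal.ofReal (w x ^ (2 * q)) * ENNReal.ofReal (k x y ^ q)) +
      ENNReal.ofReal (1 / 2) * (ENNReal.ofReal (w y ^ (2 * q)) * ENNReal.ofReal (k x y ^ q)))) ∂μ =
      ENNReal.ofReal ((q - 1) * lam ^ q) *
        ∫⁻ y, (ENNReal.ofReal (w x ^ (2 * q)) * ENNReal.ofReal (w y ^ (2 * q))) ∂μ +
      (ENNReal.ofReal (1 / 2) *
        ∫⁻ y, (ENNReal.ofReal (w x ^ (2 * q)) * ENNReal.ofReal (k x y ^ q)) ∂μ +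
      ENNReal.ofReal (1 / 2) *
        ∫⁻ y, (ENNReal.ofReal (w y ^ (2 * q)) * ENNReal.ofReal (k x y ^ q)) ∂μ) := by
    intro x
    have hkx : Measurable fun y => ENNReal.ofReal (k x y ^ q) :=
      ((hkr x).pow_const q).ennreal_ofReal
    rw [lintegral_add_left ((hwm.const_mul _).const_mul _),
      lintegral_add_left ((hkx.const_mul _).const_mul _),
      lintegral_const_mul' (ENNReal.ofReal ((q - 1) * lam ^ q)) _ ENNReal.ofReal_ne_top,
      lintegral_const_mul' (ENNReal.ofReal (1 / 2))
        (fun y => ENNReal.ofReal (w x ^ (2 * q)) * ENNReal.ofReal (k x y ^ q))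
        ENNReal.ofReal_ne_top,
      lintegral_const_mul' (ENNReal.ofReal (1 / 2))
        (fun y => ENNReal.ofReal (w y ^ (2 * q)) * ENNReal.ofReal (k x y ^ q))
        ENNReal.ofReal_ne_top]
  have hm2 : Measurable (Function.uncurry fun x y =>
      ENNReal.ofReal (w x ^ (2 * q)) * ENNReal.ofReal (w y ^ (2 * q))) :=
    (hwm.comp measurable_fst).mul (hwm.comp measurable_snd)
  simp_rw [hL] at hI
  rw [lintegral_add_left (hm2.lintegral_prod_right.const_mul _),
    lintegral_add_left (hm1.lintegral_prod_right.const_mul _),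
    lintegral_const_mul' _ _ ENNReal.ofReal_ne_top, lintegral_const_mul' _ _ ENNReal.ofReal_ne_top,
    lintegral_const_mul' _ _ ENNReal.ofReal_ne_top, hI3] at hI
  simp_rw [lintegral_const_mul' (ENNReal.ofReal (q * lam ^ (q - 1))) _ ENNReal.ofReal_ne_top] at hI
  have hc : ENNReal.ofReal (q * lam ^ (q - 1)) ≠ 0 := by
    rw [Ne, ENNReal.ofReal_eq_zero, not_le]; positivity
  rw [← ENNReal.mul_le_mul_iff_right hc ENNReal.ofReal_ne_top]
  refine hI.trans ?_
  calc _ ≤ ENNReal.ofReal ((q - 1) * lam ^ q) * (ENNReal.ofReal U * ENNReal.ofReal U) +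
        (ENNReal.ofReal (1 / 2) * (ENNReal.ofReal U * ENNReal.ofReal A) +
          ENNReal.ofReal (1 / 2) * (ENNReal.ofReal U * ENNReal.ofReal A)) := by gcongr
    _ = _ := by
      rw [← ENNReal.ofReal_mul hU0, ← ENNReal.ofReal_mul hU0, ← ENNReal.ofReal_mul (by positivity),
        ← ENNReal.ofReal_mul (by positivity), ← ENNReal.ofReal_mul (by positivity),
        ← ENNReal.ofReal_add (by positivity) (by positivity),
        ← ENNReal.ofReal_add (by positivity) (by positivity)]
      congr 1
      obtain ⟨n, rfl⟩ : ∃ n, q = n + 1 := ⟨q - 1, by omega⟩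
      rw [hAU, add_tsub_cancel_right]
      ring

end IsGreenKernel

namespace IsGreenKernel

variable {X : Type*} [MeasurableSpace X] {μ : Measure X} {k : X → X → ℝ}
  {K : Lp ℝ 2 μ →L[ℝ] Lp ℝ 2 μ}
  {H : Type*} [NormedAddCommGroup H] [InnerProductSpace ℝ H] {ι : Lp ℝ 2 μ →L[ℝ] H}

theorem ofReal_inner_operator_le (hk : IsGreenKernel μ k)
    (hK : ∀ g, K g =ᵐ[μ] fun x => ⟪hk.vec x, g⟫) (v : Lp ℝ 2 μ) :
    ENNReal.ofReal ⟪K v, v⟫ ≤ ∫⁻ x, ∫⁻ y, ENNReal.ofReal (k x y * |v y| * |v x|) ∂μ ∂μ := by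
  rw [hk.inner_operator hK]
  calc ENNReal.ofReal (∫ x, (∫ y, k x y * v y ∂μ) * v x ∂μ)
      ≤ ‖∫ x, (∫ y, k x y * v y ∂μ) * v x ∂μ‖ₑ := Real.ofReal_le_enorm _
    _ ≤ ∫⁻ x, ‖(∫ y, k x y * v y ∂μ) * v x‖ₑ ∂μ := enorm_integral_le_lintegral_enorm _
    _ ≤ _ := by
      refine lintegral_mono fun x => ?_
      rw [← integral_mul_const]
      refine (enorm_integral_le_lintegral_enorm _).trans (lintegral_mono fun y => le_of_eq ?_)
      rw [← ofReal_norm]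
      simp only [norm_mul, Real.norm_eq_abs]
      rw [abs_of_nonneg (hk.nonneg x y)]

variable [IsFiniteMeasure μ]

theorem lintegral_inner_vec_pow_le (hk : IsGreenKernel μ k)
    (hK : ∀ g, K g =ᵐ[μ] fun x => ⟪hk.vec x, g⟫) (hι : ∀ x y, ⟪ι x, ι y⟫ = ⟪K x, y⟫)
    {q : ℕ} (hq : 1 ≤ q) {A : ℝ} (hA0 : 0 < A)
    (hA : ∀ x, ∫⁻ y, ENNReal.ofReal (k x y ^ q) ∂μ ≤ ENNReal.ofReal A) (g : Lp ℝ 2 μ) :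
    ∫⁻ x, ENNReal.ofReal (⟪hk.vec x, g⟫ ^ (2 * q)) ∂μ ≤ ENNReal.ofReal ((‖ι g‖ ^ 2) ^ q * A) := by
  obtain ⟨C, hC0, hC⟩ := hk.exists_norm_vec_le
  set w : X → ℝ := fun x => ⟪hk.vec x, g⟫ with hwdef
  have hwm : Measurable w := (hk.stronglyMeasurable_inner_vec g).measurable
  have hwb : ∀ x, |w x| ≤ C * ‖g‖ := fun x =>
    (abs_real_inner_le_norm _ _).trans (by gcongr; exact hC x)
  have hpow : ∀ m, Integrable (fun x => w x ^ m) μ := fun m =>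
    Integrable.of_bound (hwm.pow_const m).aestronglyMeasurable ((C * ‖g‖) ^ m)
      (.of_forall fun x => by rw [norm_pow]; gcongr; exact hwb x)
  have hnn : ∀ x, 0 ≤ w x ^ (2 * q) := fun x => by rw [pow_mul]; positivity
  set U : ℝ := ∫ x, w x ^ (2 * q) ∂μ with hUdef
  have hU : ∫⁻ x, ENNReal.ofReal (w x ^ (2 * q)) ∂μ = ENNReal.ofReal U :=
    (ofReal_integral_eq_lintegral_ofReal (hpow _) (.of_forall hnn)).symm
  have hU0 : 0 ≤ U := integral_nonneg hnn
  rw [hU]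
  refine ENNReal.ofReal_le_ofReal ?_
  rcases hU0.eq_or_lt with h0 | hUpos
  · rw [← h0]; positivity
  have hv : MemLp (fun x => w x ^ (2 * q - 1)) 2 μ :=
    MemLp.of_bound (hwm.pow_const _).aestronglyMeasurable ((C * ‖g‖) ^ (2 * q - 1))
      (.of_forall fun x => by rw [norm_pow]; gcongr; exact hwb x)
  set v : Lp ℝ 2 μ := hv.toLp _ with hvdef
  have hva := hv.coeFn_toLp
  have hUv : ⟪ι g, ι v⟫ = U := by
    rw [hι, L2.inner_def]
    refine integral_congr_ae ?_
    filter_upwards [hva, hK g] with x hx hx'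
    rw [hx', hvdef, hx]
    change w x ^ (2 * q - 1) * w x = _
    rw [← pow_succ]
    congr 1
    omega
  set lam : ℝ := (A / U) ^ ((1 : ℝ) / q) with hlam
  have hlam0 : 0 < lam := by positivity
  have hq0 : (q : ℝ) ≠ 0 := by positivity
  have hlamq : lam ^ q = A / U := by
    rw [hlam, ← Real.rpow_natCast, ← Real.rpow_mul (by positivity), one_div_mul_cancel hq0,
      Real.rpow_one]
  have hvv : ‖ι v‖ ^ 2 ≤ lam * U ^ 2 := by
    rw [← real_inner_self_eq_norm_sq, hι]
    have h1 := hk.lintegral_kernel_mul_pow_le hwm hq hlam0 hA0.le hA hU0 hU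
      (by rw [hlamq]; field_simp)
    have h2 := (hk.ofReal_inner_operator_le hK v)
    have h3 : ∫⁻ x, ∫⁻ y, ENNReal.ofReal (k x y * |v y| * |v x|) ∂μ ∂μ =
        ∫⁻ x, ∫⁻ y, ENNReal.ofReal (k x y * |w y| ^ (2 * q - 1) * |w x| ^ (2 * q - 1)) ∂μ ∂μ := by
      refine lintegral_congr_ae ?_
      filter_upwards [hva] with x hx
      refine lintegral_congr_ae ?_
      filter_upwards [hva] with y hy
      rw [hvdef, hx, hy, abs_pow, abs_pow]
    rw [h3] at h2
    exact (ENNReal.ofReal_le_ofReal_iff (by positivity)).1 (h2.trans h1)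
  have hcs : U ≤ ‖ι g‖ * ‖ι v‖ := hUv ▸ real_inner_le_norm _ _
  have h1 : U ^ 2 * 1 ≤ U ^ 2 * (‖ι g‖ ^ 2 * lam) := by
    calc U ^ 2 * 1 = U ^ 2 := mul_one _
      _ ≤ (‖ι g‖ * ‖ι v‖) ^ 2 := by gcongr
      _ = ‖ι g‖ ^ 2 * ‖ι v‖ ^ 2 := by ring
      _ ≤ ‖ι g‖ ^ 2 * (lam * U ^ 2) := by gcongr
      _ = _ := by ring
  have h2 : 1 ≤ ‖ι g‖ ^ 2 * lam := le_of_mul_le_mul_left h1 (by positivity)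
  have h3 : 1 ≤ (‖ι g‖ ^ 2 * lam) ^ q := one_le_pow₀ h2
  rw [mul_pow, hlamq, ← mul_div_assoc, le_div_iff₀ hUpos, one_mul] at h3
  exact h3

/-- Trudinger–Moser inequality on the range of `ι`. -/
theorem exists_lintegral_exp_inner_vec_le (hk : IsGreenKernel μ k)
    (hK : ∀ g, K g =ᵐ[μ] fun x => ⟪hk.vec x, g⟫) (hι : ∀ x y, ⟪ι x, ι y⟫ = ⟪K x, y⟫)
    {β N : ℝ} (hβ : 0 ≤ β) (hN : 0 ≤ N) (hβN : β * N < 4 * π) :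
    ∃ C : ℝ, ∀ g : Lp ℝ 2 μ, ‖ι g‖ ^ 2 ≤ N →
      ∫⁻ x, ENNReal.ofReal (exp (β * ⟪hk.vec x, g⟫ ^ 2)) ∂μ ≤ ENNReal.ofReal C := by
  obtain ⟨α, hα1, hα2⟩ := exists_between hβN
  have hα : 0 < α := (mul_nonneg hβ hN).trans_lt hα1
  obtain ⟨C, hC⟩ := hk.exp_bound α hα hα2
  set D : ℝ := max (max C 1) (μ.real univ) with hD
  have hD1 : 1 ≤ D := (le_max_right _ _).trans (le_max_left _ _)
  have hr0 : 0 ≤ β * N / α := by positivity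
  have hr1 : β * N / α < 1 := by rw [div_lt_one hα]; exact hα1
  refine ⟨∑' q : ℕ, (β * N / α) ^ q * D, fun g hg => ?_⟩
  have hterm : ∀ q : ℕ, ∫⁻ x, ENNReal.ofReal ((β * ⟪hk.vec x, g⟫ ^ 2) ^ q / q.factorial) ∂μ ≤
      ENNReal.ofReal ((β * N / α) ^ q * D) := by
    intro q
    rcases Nat.eq_zero_or_pos q with rfl | hq
    · simp only [pow_zero, Nat.factorial_zero, Nat.cast_one, div_one, ENNReal.ofReal_one,
        lintegral_const, one_mul]
      rw [← ENNReal.ofReal_toReal (measure_ne_top μ univ)]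
      exact ENNReal.ofReal_le_ofReal (le_max_right _ _)
    · have hA : ∀ x, ∫⁻ y, ENNReal.ofReal (k x y ^ q) ∂μ ≤
          ENNReal.ofReal (q.factorial / α ^ q * D) := fun x =>
        (hk.lintegral_pow_le hα hC q x).trans (ENNReal.ofReal_le_ofReal (by
          gcongr
          exact (le_max_left _ _).trans (le_max_left _ _)))
      have h := hk.lintegral_inner_vec_pow_le hK hι hq (by positivity) hA g
      calc ∫⁻ x, ENNReal.ofReal ((β * ⟪hk.vec x, g⟫ ^ 2) ^ q / q.factorial) ∂μ
          = ∫⁻ x, ENNReal.ofReal (β ^ q / q.factorial) *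
              ENNReal.ofReal (⟪hk.vec x, g⟫ ^ (2 * q)) ∂μ := by
            refine lintegral_congr fun x => ?_
            rw [← ENNReal.ofReal_mul (by positivity)]
            congr 1
            rw [pow_mul]
            ring
        _ = ENNReal.ofReal (β ^ q / q.factorial) *
              ∫⁻ x, ENNReal.ofReal (⟪hk.vec x, g⟫ ^ (2 * q)) ∂μ :=
            lintegral_const_mul' _ _ ENNReal.ofReal_ne_top
        _ ≤ ENNReal.ofReal (β ^ q / q.factorial) *
              ENNReal.ofReal ((‖ι g‖ ^ 2) ^ q * (q.factorial / α ^ q * D)) := by gcongr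
        _ ≤ _ := by
            rw [← ENNReal.ofReal_mul (by positivity)]
            refine ENNReal.ofReal_le_ofReal ?_
            calc β ^ q / q.factorial * ((‖ι g‖ ^ 2) ^ q * (q.factorial / α ^ q * D))
                = (β ^ q / α ^ q * D) * (‖ι g‖ ^ 2) ^ q := by field_simp
              _ ≤ (β ^ q / α ^ q * D) * N ^ q := by gcongr
              _ = _ := by rw [div_pow, mul_pow]; ring
  have hsum : Summable fun q : ℕ => (β * N / α) ^ q * D :=
    (summable_geometric_of_lt_one hr0 hr1).mul_right D
  have hexp : ∀ x, ENNReal.ofReal (exp (β * ⟪hk.vec x, g⟫ ^ 2)) =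
      ∑' q : ℕ, ENNReal.ofReal ((β * ⟪hk.vec x, g⟫ ^ 2) ^ q / q.factorial) := by
    intro x
    rw [Real.exp_eq_exp_ℝ, NormedSpace.exp_eq_tsum_div]
    exact ENNReal.ofReal_tsum_of_nonneg (fun q => by positivity)
      (NormedSpace.expSeries_div_summable _)
  simp_rw [hexp]
  have hwm := (hk.stronglyMeasurable_inner_vec g).measurable
  rw [lintegral_tsum fun q => ((((hwm.pow_const 2).const_mul β).pow_const q).div_const
    _).ennreal_ofReal.aemeasurable, ENNReal.ofReal_tsum_of_nonneg (fun q => by positivity) hsum]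
  exact ENNReal.tsum_le_tsum hterm

end IsGreenKernel

theorem exists_seq_tendsto_ae_of_tendsto_Lp {X : Type*} [MeasurableSpace X] {μ : Measure X}
    {u : ℕ → Lp ℝ 2 μ} {v : Lp ℝ 2 μ} (h : Tendsto u atTop (𝓝 v)) :
    ∃ ns : ℕ → ℕ, StrictMono ns ∧
      ∀ᵐ x ∂μ, Tendsto (fun i => u (ns i) x) atTop (𝓝 (v x)) :=
  (tendstoInMeasure_of_tendsto_Lp h).exists_seq_tendsto_ae

namespace IsGreenKernel

variable {X : Type*} [MeasurableSpace X] {μ : Measure X} {k : X → X → ℝ} [IsFiniteMeasure μ]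
  {K : Lp ℝ 2 μ →L[ℝ] Lp ℝ 2 μ}
  {H : Type*} [NormedAddCommGroup H] [InnerProductSpace ℝ H] {ι : Lp ℝ 2 μ →L[ℝ] H}
  {T : H →L[ℝ] Lp ℝ 2 μ}

/-- Trudinger–Moser inequality. -/
theorem exists_lintegral_exp_le (hk : IsGreenKernel μ k)
    (hK : ∀ g, K g =ᵐ[μ] fun x => ⟪hk.vec x, g⟫) (hι : ∀ x y, ⟪ι x, ι y⟫ = ⟪K x, y⟫)
    (hd : DenseRange ι) (hT : ∀ g, T (ι g) = K g)
    {β N : ℝ} (hβ : 0 ≤ β) (hN : 0 ≤ N) (hβN : β * N < 4 * π) :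
    ∃ C : ℝ, ∀ h : H, ‖h‖ ^ 2 ≤ N →
      ∫⁻ x, ENNReal.ofReal (exp (β * (T h x) ^ 2)) ∂μ ≤ ENNReal.ofReal C := by
  obtain ⟨N', hN', hβN'⟩ : ∃ N', N < N' ∧ β * N' < 4 * π := by
    rcases hβ.eq_or_lt with rfl | hβ
    · exact ⟨N + 1, by linarith, by simpa using hβN⟩
    · obtain ⟨α, h1, h2⟩ := exists_between hβN
      exact ⟨α / β, by rw [lt_div_iff₀ hβ]; linarith, by rw [mul_div_cancel₀ _ hβ.ne']; exact h2⟩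
  obtain ⟨C, hC⟩ := hk.exists_lintegral_exp_inner_vec_le hK hι hβ (hN.trans hN'.le) hβN'
  refine ⟨C, fun h hh => ?_⟩
  obtain ⟨h', hmem, hlim⟩ := mem_closure_iff_seq_limit.1 (hd h)
  choose g hg using hmem
  have hlimT : Tendsto (fun n => K (g n)) atTop (𝓝 (T h)) := by
    have := (T.continuous.tendsto h).comp hlim
    refine this.congr fun n => ?_
    simp [← hg, hT]
  obtain ⟨ns, hns, hae⟩ := exists_seq_tendsto_ae_of_tendsto_Lp hlimT
  have hev : ∀ᶠ n in atTop, ‖ι (g (ns n))‖ ^ 2 ≤ N' := by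
    have h1 : Tendsto (fun n => ‖h' (ns n)‖ ^ 2) atTop (𝓝 (‖h‖ ^ 2)) :=
      ((hlim.comp hns.tendsto_atTop).norm).pow 2
    filter_upwards [h1.eventually (gt_mem_nhds (hh.trans_lt hN'))] with n hn
    rw [hg]; exact hn.le
  have hae2 : ∀ᵐ x ∂μ, Tendsto
      (fun n => ENNReal.ofReal (exp (β * ⟪hk.vec x, g (ns n)⟫ ^ 2))) atTop
      (𝓝 (ENNReal.ofReal (exp (β * (T h x) ^ 2)))) := by
    filter_upwards [hae, ae_all_iff.2 fun n => hK (g (ns n))] with x hx hx'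
    have h1 : Tendsto (fun n => ⟪hk.vec x, g (ns n)⟫) atTop (𝓝 (T h x)) :=
      hx.congr fun n => hx' n
    exact ENNReal.tendsto_ofReal ((continuous_exp.tendsto _).comp ((h1.pow 2).const_mul β))
  calc ∫⁻ x, ENNReal.ofReal (exp (β * (T h x) ^ 2)) ∂μ
      = ∫⁻ x, liminf (fun n => ENNReal.ofReal (exp (β * ⟪hk.vec x, g (ns n)⟫ ^ 2))) atTop ∂μ := by
        refine lintegral_congr_ae ?_
        filter_upwards [hae2] with x hx
        exact hx.liminf_eq.symm
    _ ≤ liminf (fun n => ∫⁻ x, ENNReal.ofReal (exp (β * ⟪hk.vec x, g (ns n)⟫ ^ 2)) ∂μ) atTop :=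
        lintegral_liminf_le fun n => ((((hk.stronglyMeasurable_inner_vec _).measurable.pow_const
          2).const_mul β).exp).ennreal_ofReal
    _ ≤ ENNReal.ofReal C := by
        refine liminf_le_of_frequently_le' (Eventually.frequently ?_)
        filter_upwards [hev] with n hn
        exact hC _ hn

/-- Exponential integrability of every element of the energy space. -/
theorem integrable_exp (hk : IsGreenKernel μ k)
    (hK : ∀ g, K g =ᵐ[μ] fun x => ⟪hk.vec x, g⟫) (hι : ∀ x y, ⟪ι x, ι y⟫ = ⟪K x, y⟫)
    (hd : DenseRange ι) (hT : ∀ g, T (ι g) = K g) {β : ℝ} (hβ : 0 ≤ β) (h : H) :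
    Integrable (fun x => exp (β * (T h x) ^ 2)) μ := by
  obtain ⟨C, hC⟩ := hk.exists_lintegral_exp_le hK hι hd hT (β := 2 * β) (N := π / (1 + β))
    (by positivity) (by positivity) (by
      rw [← mul_div_assoc, div_lt_iff₀ (by positivity)]
      nlinarith [pi_pos, mul_nonneg hβ pi_pos.le])
  obtain ⟨h', ⟨g, rfl⟩, hg⟩ := Metric.mem_closure_iff.1 (hd h) (√(π / (1 + β))) (by positivity)
  have h1 : ‖h - ι g‖ ^ 2 ≤ π / (1 + β) := by
    rw [dist_eq_norm] at hg
    calc ‖h - ι g‖ ^ 2 ≤ (√(π / (1 + β))) ^ 2 := by gcongr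
      _ = _ := Real.sq_sqrt (by positivity)
  obtain ⟨B, hB0, hB⟩ := hk.exists_norm_vec_le
  have hmeas : ∀ h, StronglyMeasurable fun x => exp (β * (T h x) ^ 2) := fun h =>
    continuous_exp.comp_stronglyMeasurable (((Lp.stronglyMeasurable (T h)).pow 2).const_mul β)
  have hInt : Integrable (fun x => exp (2 * β * (T (h - ι g) x) ^ 2)) μ := by
    refine ⟨(continuous_exp.comp_stronglyMeasurable (((Lp.stronglyMeasurable
      (T (h - ι g))).pow 2).const_mul (2 * β))).aestronglyMeasurable, ?_⟩
    rw [hasFiniteIntegral_iff_ofReal (.of_forall fun x => (exp_pos _).le)]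
    exact (hC _ h1).trans_lt ENNReal.ofReal_lt_top
  refine (hInt.mul_const (exp (2 * β * (B * ‖g‖) ^ 2))).mono' (hmeas h).aestronglyMeasurable ?_
  have hsub : T (h - ι g) = T h - K g := by rw [map_sub, hT]
  filter_upwards [hK g, Lp.coeFn_sub (T h) (K g)] with x hx hx'
  rw [hsub, hx', ← exp_add, Real.norm_of_nonneg (exp_pos _).le]
  refine exp_le_exp.2 ?_
  have h2 : |K g x| ≤ B * ‖g‖ := by
    rw [hx]; exact (abs_real_inner_le_norm _ _).trans (by gcongr; exact hB x)
  have h3 : (K g x) ^ 2 ≤ (B * ‖g‖) ^ 2 := sq_le_sq' (by linarith [abs_le.1 h2]) (abs_le.1 h2).2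
  simp only [Pi.sub_apply]
  nlinarith [mul_nonneg hβ (sq_nonneg (T h x - 2 * K g x)), mul_le_mul_of_nonneg_left h3 hβ]

end IsGreenKernel

/-- Bounded sequences in a separable Hilbert space have weakly convergent subsequences. -/
theorem exists_subseq_tendsto_weak {H : Type*} [NormedAddCommGroup H] [InnerProductSpace ℝ H]
    [CompleteSpace H] [TopologicalSpace.SeparableSpace H] {h : ℕ → H} {R : ℝ}
    (hR : ∀ n, ‖h n‖ ≤ R) :
    ∃ (a : H) (ns : ℕ → ℕ), StrictMono ns ∧
      ∀ v, Tendsto (fun n => ⟪v, h (ns n)⟫) atTop (𝓝 ⟪v, a⟫) := by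
  obtain ⟨a, -, ns, hns, hlim⟩ := WeakDual.isSeqCompact_closedBall ℝ H (0 : StrongDual ℝ H) R
    (x := fun n => StrongDual.toWeakDual (InnerProductSpace.toDual ℝ H (h n))) (by
      intro n
      simpa using hR n)
  refine ⟨(InnerProductSpace.toDual ℝ H).symm (WeakDual.toStrongDual a), ns, hns, fun v => ?_⟩
  have h1 := (WeakDual.eval_continuous (𝕜 := ℝ) v).continuousAt.tendsto.comp hlim
  rw [real_inner_comm, InnerProductSpace.toDual_symm_apply]
  refine h1.congr fun n => ?_
  simp [real_inner_comm]

/-- Convergence of superposition operators controlled by a functional of higher growth. -/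
theorem integrable_and_tendsto_integral_comp {X : Type*} [MeasurableSpace X] {μ : Measure X}
    [IsFiniteMeasure μ] {u : ℕ → X → ℝ} {v : X → ℝ} (hu : ∀ n, StronglyMeasurable (u n))
    (hv : StronglyMeasurable v) (hlim : ∀ᵐ x ∂μ, Tendsto (fun n => u n x) atTop (𝓝 (v x)))
    {g D : ℝ → ℝ} (hg : Continuous g)
    (hgD : ∀ ε > 0, ∃ R, ∀ s, R < |s| → |g s| ≤ ε * D s) {C : ℝ}
    (hC : ∀ n, ∫⁻ x, ENNReal.ofReal (D (u n x)) ∂μ ≤ ENNReal.ofReal C) :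
    Integrable (fun x => g (v x)) μ ∧
    Tendsto (fun n => ∫⁻ x, ‖g (u n x) - g (v x)‖ₑ ∂μ) atTop (𝓝 0) := by
  have hgm : ∀ n, StronglyMeasurable fun x => g (u n x) := fun n =>
    hg.comp_stronglyMeasurable (hu n)
  have hgv : StronglyMeasurable fun x => g (v x) := hg.comp_stronglyMeasurable hv
  have hglim : ∀ᵐ x ∂μ, Tendsto (fun n => g (u n x)) atTop (𝓝 (g (v x))) := by
    filter_upwards [hlim] with x hx
    exact (hg.tendsto _).comp hx
  have hcpt : ∀ R : ℝ, ∃ M : ℝ, 0 ≤ M ∧ ∀ s, |s| ≤ R → |g s| ≤ M := fun R => by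
    obtain ⟨M, hM⟩ := (isCompact_Icc (a := -R) (b := R)).exists_bound_of_continuousOn
      hg.continuousOn
    exact ⟨max M 0, le_max_right _ _, fun s hs => (hM s (abs_le.1 hs)).trans (le_max_left _ _)⟩
  have hInt : Integrable (fun x => g (v x)) μ := by
    obtain ⟨R, hR⟩ := hgD 1 one_pos
    obtain ⟨M, hM0, hM⟩ := hcpt R
    have hbd : ∀ n, ∫⁻ x, ‖g (u n x)‖ₑ ∂μ ≤ ENNReal.ofReal M * μ univ + ENNReal.ofReal C := by
      intro n
      calc ∫⁻ x, ‖g (u n x)‖ₑ ∂μ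
          ≤ ∫⁻ x, (ENNReal.ofReal M + ENNReal.ofReal (D (u n x))) ∂μ := by
            refine lintegral_mono fun x => ?_
            rw [← ofReal_norm]
            rcases le_or_gt |u n x| R with h | h
            · exact (ENNReal.ofReal_le_ofReal (hM _ h)).trans le_self_add
            · refine (ENNReal.ofReal_le_ofReal ?_).trans le_add_self
              simpa using hR _ h
        _ ≤ _ := by
            rw [lintegral_add_left measurable_const, lintegral_const]
            gcongr
            exact hC n
    refine ⟨hgv.aestronglyMeasurable, ?_⟩
    calc ∫⁻ x, ‖g (v x)‖ₑ ∂μ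
        = ∫⁻ x, liminf (fun n => ‖g (u n x)‖ₑ) atTop ∂μ := by
          refine lintegral_congr_ae ?_
          filter_upwards [hglim] with x hx
          exact (hx.enorm).liminf_eq.symm
      _ ≤ liminf (fun n => ∫⁻ x, ‖g (u n x)‖ₑ ∂μ) atTop :=
          lintegral_liminf_le fun n => (hgm n).measurable.enorm
      _ ≤ ENNReal.ofReal M * μ univ + ENNReal.ofReal C :=
          liminf_le_of_frequently_le' (Eventually.frequently (.of_forall hbd))
      _ < ∞ := by finiteness
  refine ⟨hInt, ?_⟩
  have hui : UnifIntegrable (fun n x => g (u n x)) 1 μ := by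
    refine unifIntegrable_of le_rfl (by norm_num) (fun n => (hgm n).aestronglyMeasurable)
      fun ε hε => ?_
    obtain ⟨R, hR⟩ := hgD (ε / (|C| + 1)) (by positivity)
    obtain ⟨M, hM0, hM⟩ := hcpt R
    refine ⟨⟨M + 1, by positivity⟩, fun n => ?_⟩
    rw [eLpNorm_one_eq_lintegral_enorm]
    calc ∫⁻ x, ‖({x | (⟨M + 1, by positivity⟩ : NNReal) ≤ ‖g (u n x)‖₊}.indicator
          (fun x => g (u n x))) x‖ₑ ∂μ
        ≤ ∫⁻ x, ENNReal.ofReal (ε / (|C| + 1)) * ENNReal.ofReal (D (u n x)) ∂μ := by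
          refine lintegral_mono fun x => ?_
          rw [enorm_indicator_eq_indicator_enorm]
          by_cases hy : x ∈ {x | (⟨M + 1, by positivity⟩ : NNReal) ≤ ‖g (u n x)‖₊}
          swap
          · simp [indicator_of_notMem hy]
          rw [indicator_of_mem hy]
          have hy' : M + 1 ≤ |g (u n x)| := hy
          have : R < |u n x| := by
            by_contra! h
            linarith [hM _ h]
          rw [← ofReal_norm, ← ENNReal.ofReal_mul (by positivity)]
          exact ENNReal.ofReal_le_ofReal (hR _ this)
      _ = ENNReal.ofReal (ε / (|C| + 1)) * ∫⁻ x, ENNReal.ofReal (D (u n x)) ∂μ :=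
          lintegral_const_mul' _ _ ENNReal.ofReal_ne_top
      _ ≤ ENNReal.ofReal (ε / (|C| + 1)) * ENNReal.ofReal C := by gcongr; exact hC n
      _ ≤ ENNReal.ofReal ε := by
          rw [← ENNReal.ofReal_mul (by positivity)]
          refine ENNReal.ofReal_le_ofReal ?_
          rw [div_mul_eq_mul_div, div_le_iff₀ (by positivity)]
          nlinarith [le_abs_self C]
  have := tendsto_Lp_finite_of_tendsto_ae le_rfl (by norm_num)
    (fun n => (hgm n).aestronglyMeasurable) (memLp_one_iff_integrable.2 hInt) hui hglim
  simpa [eLpNorm_one_eq_lintegral_enorm] using this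

section Nonlinearity

variable {f : ℝ → ℝ}

theorem mul_self_nonneg_of_superquadratic
    (hH2 : ∀ s : ℝ, s ≠ 0 → 0 < primF f s ∧ primF f s ≤ (1/2) * f s * s) (s : ℝ) :
    0 ≤ s * f s := by
  rcases eq_or_ne s 0 with rfl | hs
  · simp
  · have := hH2 s hs
    linarith [mul_comm s (f s)]

theorem abs_mul_abs_eq_of_superquadratic
    (hH2 : ∀ s : ℝ, s ≠ 0 → 0 < primF f s ∧ primF f s ≤ (1/2) * f s * s) (s : ℝ) :
    |s| * |f s| = s * f s := by
  rw [← abs_mul, abs_of_nonneg (mul_self_nonneg_of_superquadratic hH2 s)]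

theorem primF_nonneg (hH2 : ∀ s : ℝ, s ≠ 0 → 0 < primF f s ∧ primF f s ≤ (1/2) * f s * s)
    (s : ℝ) : 0 ≤ primF f s := by
  rcases eq_or_ne s 0 with rfl | hs
  · simp
  · exact (hH2 s hs).1.le

theorem primF_neg (hodd : ∀ s : ℝ, f (-s) = - f s) (s : ℝ) : primF f (-s) = primF f s := by
  have h := intervalIntegral.integral_comp_neg (a := 0) (b := s) f
  simp only [hodd, intervalIntegral.integral_neg, neg_zero] at h
  rw [primF, primF, intervalIntegral.integral_symm, ← h, neg_neg]

theorem primF_abs (hodd : ∀ s : ℝ, f (-s) = - f s) (s : ℝ) : primF f |s| = primF f s := by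
  rcases abs_choice s with h | h <;> rw [h]
  exact primF_neg hodd s

theorem abs_le_mul_of_lt (hH2 : ∀ s : ℝ, s ≠ 0 → 0 < primF f s ∧ primF f s ≤ (1/2) * f s * s) :
    ∀ ε > 0, ∃ R, ∀ s, R < |s| → |f s| ≤ ε * (s * f s) := by
  intro ε hε
  refine ⟨1 / ε, fun s hs => ?_⟩
  rw [div_lt_iff₀ hε] at hs
  rw [← abs_mul_abs_eq_of_superquadratic hH2]
  nlinarith [abs_nonneg (f s)]

theorem primF_le_mul_of_lt
    (hH1 : ∃ s₀ > 0, ∃ M > 0, ∀ s : ℝ, s₀ ≤ |s| → 0 < primF f s ∧ primF f s ≤ M * |f s|)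
    (hH2 : ∀ s : ℝ, s ≠ 0 → 0 < primF f s ∧ primF f s ≤ (1/2) * f s * s) :
    ∀ ε > 0, ∃ R, ∀ s, R < |s| → |primF f s| ≤ ε * (s * f s) := by
  intro ε hε
  obtain ⟨s₀, hs₀, M, hM, h⟩ := hH1
  refine ⟨max s₀ (M / ε), fun s hs => ?_⟩
  have h1 := h s ((le_max_left _ _).trans hs.le)
  have h2 : M / ε < |s| := (le_max_right _ _).trans_lt hs
  rw [div_lt_iff₀ hε] at h2
  rw [← abs_mul_abs_eq_of_superquadratic hH2, abs_of_pos h1.1]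
  nlinarith [abs_nonneg (f s)]

theorem exists_primF_le (hf : Continuous f)
    (hH1 : ∃ s₀ > 0, ∃ M > 0, ∀ s : ℝ, s₀ ≤ |s| → 0 < primF f s ∧ primF f s ≤ M * |f s|)
    (hH2 : ∀ s : ℝ, s ≠ 0 → 0 < primF f s ∧ primF f s ≤ (1/2) * f s * s) :
    ∃ C, ∀ s, primF f s ≤ 1 / 4 * (s * f s) + C := by
  obtain ⟨R, hR⟩ := primF_le_mul_of_lt hH1 hH2 (1 / 4) (by norm_num)
  obtain ⟨M, hM⟩ := (isCompact_Icc (a := -R) (b := R)).exists_bound_of_continuousOn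
    (continuous_primF hf).continuousOn
  refine ⟨|M|, fun s => ?_⟩
  have h0 := mul_self_nonneg_of_superquadratic hH2 s
  rcases le_or_gt |s| R with h | h
  · have := (le_abs_self _).trans ((hM s (abs_le.1 h)).trans (le_abs_self M))
    linarith
  · linarith [(le_abs_self _).trans (hR s h), abs_nonneg M]

theorem exists_exp_le_primF (hf : Continuous f)
    (hH2 : ∀ s : ℝ, s ≠ 0 → 0 < primF f s ∧ primF f s ≤ (1/2) * f s * s)
    (hH3 : Tendsto (fun s : ℝ => s * f s * Real.exp (-(4 * π * s ^ 2))) atTop atTop) (L : ℝ) :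
    ∃ R > 0, ∀ s, R ≤ s → L * exp (4 * π * s ^ 2) / s ^ 2 ≤ primF f s := by
  set L' := max L 0 * exp (8 * π) with hL'
  have hL'0 : 0 ≤ L' := by positivity
  obtain ⟨R, hR⟩ := eventually_atTop.1 (hH3.eventually_ge_atTop L')
  refine ⟨max R 1 + 1, by positivity, fun s hs => ?_⟩
  have hs1 : 2 ≤ s := by linarith [le_max_right R 1]
  have hs0 : 0 < s := by linarith
  have hsR : R ≤ s - 1 / s := by
    have : 1 / s ≤ 1 := by rw [div_le_one hs0]; linarith
    linarith [le_max_left R 1]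
  have hss : 0 < s - 1 / s := by
    have : 1 / s ≤ 1 := by rw [div_le_one hs0]; linarith
    linarith
  have hpt : ∀ t ∈ Icc (s - 1 / s) s, max L 0 * exp (4 * π * s ^ 2) / s ≤ f t := by
    intro t ht
    have ht0 : 0 < t := hss.trans_le ht.1
    have h1 := hR t (hsR.trans ht.1)
    rw [exp_neg, ← div_eq_mul_inv, le_div_iff₀ (exp_pos _)] at h1
    have h2 : s ^ 2 - 2 ≤ t ^ 2 := by
      have h3 : (s - 1 / s) ^ 2 ≤ t ^ 2 := by gcongr; exact ht.1
      have h4 : (s - 1 / s) ^ 2 = s ^ 2 - 2 + (1 / s) ^ 2 := by field_simp; ring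
      linarith [sq_nonneg (1 / s)]
    have h5 : max L 0 * exp (4 * π * s ^ 2) ≤ t * f t := by
      refine le_trans ?_ h1
      rw [hL', mul_assoc (max L 0), ← exp_add]
      gcongr
      nlinarith [pi_pos]
    have hft : 0 ≤ f t := by
      by_contra! h
      nlinarith [mul_self_nonneg_of_superquadratic hH2 t]
    rw [div_le_iff₀ hs0]
    nlinarith [ht.2]
  have hle : s - 1 / s ≤ s := by
    have : 0 < 1 / s := by positivity
    linarith
  have hInt : ∫ t in (s - 1 / s)..s, max L 0 * exp (4 * π * s ^ 2) / s ≤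
      ∫ t in (s - 1 / s)..s, f t :=
    intervalIntegral.integral_mono_on hle (by simp) (hf.intervalIntegrable _ _) hpt
  have hadd : primF f s = primF f (s - 1 / s) + ∫ t in (s - 1 / s)..s, f t :=
    (intervalIntegral.integral_add_adjacent_intervals (hf.intervalIntegrable _ _)
      (hf.intervalIntegrable _ _)).symm
  rw [intervalIntegral.integral_const, smul_eq_mul] at hInt
  rw [hadd]
  have h6 := primF_nonneg hH2 (s - 1 / s)
  calc L * exp (4 * π * s ^ 2) / s ^ 2 ≤ max L 0 * exp (4 * π * s ^ 2) / s ^ 2 := by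
        gcongr; exact le_max_left _ _
    _ = (s - (s - 1 / s)) * (max L 0 * exp (4 * π * s ^ 2) / s) := by field_simp; ring
    _ ≤ _ := by linarith

theorem exists_mul_sq_sub_le_primF (hf : Continuous f) (hodd : ∀ s : ℝ, f (-s) = - f s)
    (hH2 : ∀ s : ℝ, s ≠ 0 → 0 < primF f s ∧ primF f s ≤ (1/2) * f s * s)
    (hH3 : Tendsto (fun s : ℝ => s * f s * Real.exp (-(4 * π * s ^ 2))) atTop atTop) (A : ℝ) :
    ∃ C, ∀ s, A * s ^ 2 - C ≤ primF f s := by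
  obtain ⟨R, hR0, hR⟩ := exists_exp_le_primF hf hH2 hH3 |A|
  refine ⟨|A| * R ^ 2, fun s => ?_⟩
  have hA := mul_le_mul_of_nonneg_right (le_abs_self A) (sq_nonneg s)
  rcases le_or_gt |s| R with h | h
  · have : s ^ 2 ≤ R ^ 2 := sq_le_sq' (by linarith [abs_le.1 h]) (abs_le.1 h).2
    nlinarith [primF_nonneg hH2 s, abs_nonneg A]
  · rw [← primF_abs hodd]
    refine le_trans ?_ (hR _ h.le)
    have hs : 0 < |s| := hR0.trans h
    rw [sq_abs]
    have hs2 : 0 < s ^ 2 := by rw [← sq_abs]; positivity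
    rw [le_div_iff₀ hs2]
    have h1 := quadratic_le_exp_of_nonneg (x := 4 * π * s ^ 2) (by positivity)
    have h2 : s ^ 2 * s ^ 2 ≤ exp (4 * π * s ^ 2) := by
      have h4 : 1 ≤ (4 * π) ^ 2 / 2 := by nlinarith [pi_gt_three]
      have h5 : s ^ 2 * s ^ 2 ≤ (4 * π) ^ 2 / 2 * (s ^ 2 * s ^ 2) :=
        le_mul_of_one_le_left (by positivity) h4
      have h6 : 0 ≤ 4 * π * s ^ 2 := by positivity
      have h7 : (4 * π * s ^ 2) ^ 2 / 2 = (4 * π) ^ 2 / 2 * (s ^ 2 * s ^ 2) := by ring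
      linarith
    have h3 : 0 ≤ |A| * R ^ 2 := by positivity
    nlinarith [mul_le_mul_of_nonneg_left h2 (abs_nonneg A)]

theorem exists_primF_le_sq_add (hf1 : ∃ C > 0, ∀ s : ℝ, |f s| ≤ C * Real.exp (4 * π * s ^ 2))
    (hf2 : Tendsto (fun s : ℝ => f s / s) (𝓝[≠] 0) (𝓝 0))
    (hH2 : ∀ s : ℝ, s ≠ 0 → 0 < primF f s ∧ primF f s ≤ (1/2) * f s * s) {ε : ℝ} (hε : 0 < ε) :
    ∃ C ≥ 0, ∀ s, primF f s ≤ ε * s ^ 2 + C * (s ^ 4 * exp (4 * π * s ^ 2)) := by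
  obtain ⟨C, hC0, hC⟩ := hf1
  have h := hf2.eventually (ball_mem_nhds 0 hε)
  rw [eventually_nhdsWithin_iff, Metric.eventually_nhds_iff] at h
  obtain ⟨δ, hδ, h⟩ := h
  refine ⟨C / δ ^ 3, by positivity, fun s => ?_⟩
  rcases eq_or_ne s 0 with rfl | hs
  · simp
  have h2 := (hH2 s hs).2
  have h3 := mul_self_nonneg_of_superquadratic hH2 s
  rcases lt_or_ge |s| δ with hsd | hsd
  · have h4 := h (by simpa using hsd) hs
    rw [dist_zero_right, norm_div, Real.norm_eq_abs, Real.norm_eq_abs, div_lt_iff₀ (by positivity)]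
      at h4
    have h5 : s * f s ≤ ε * s ^ 2 := by
      rw [← abs_mul_abs_eq_of_superquadratic hH2, ← sq_abs]
      nlinarith [abs_nonneg s]
    have : 0 ≤ C / δ ^ 3 * (s ^ 4 * exp (4 * π * s ^ 2)) := by positivity
    linarith
  · have h4 : s * f s ≤ |s| * (C * exp (4 * π * s ^ 2)) := by
      rw [← abs_mul_abs_eq_of_superquadratic hH2]
      gcongr
      exact hC s
    have h5 : |s| ≤ s ^ 4 / δ ^ 3 := by
      rw [le_div_iff₀ (by positivity)]
      have e : s ^ 4 = |s| * |s| ^ 3 := by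
        rw [← pow_succ', ← abs_pow, abs_of_nonneg (Even.pow_nonneg (by decide) s)]
      rw [e]
      gcongr
    have h6 : |s| * (C * exp (4 * π * s ^ 2)) ≤ s ^ 4 / δ ^ 3 * (C * exp (4 * π * s ^ 2)) := by
      gcongr
    have h7 : s ^ 4 / δ ^ 3 * (C * exp (4 * π * s ^ 2)) =
        C / δ ^ 3 * (s ^ 4 * exp (4 * π * s ^ 2)) := by ring
    have : 0 ≤ ε * s ^ 2 := by positivity
    linarith

theorem mul_le_exp_of_lt (hf1 : ∃ C > 0, ∀ s : ℝ, |f s| ≤ C * Real.exp (4 * π * s ^ 2))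
    {β : ℝ} (hβ : 4 * π < β) : ∀ ε > 0, ∃ R, ∀ s, R < |s| → |s * f s| ≤ ε * exp (β * s ^ 2) := by
  obtain ⟨C, hC0, hC⟩ := hf1
  intro ε hε
  refine ⟨max 0 (C / (ε * (β - 4 * π))), fun s hs => ?_⟩
  have hβ' : 0 < β - 4 * π := sub_pos.2 hβ
  have hs0 : 0 < |s| := (le_max_left _ _).trans_lt hs
  have h1 : C / (ε * (β - 4 * π)) < |s| := (le_max_right _ _).trans_lt hs
  rw [div_lt_iff₀ (by positivity)] at h1
  have h2 : (β - 4 * π) * s ^ 2 ≤ exp ((β - 4 * π) * s ^ 2) := by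
    linarith [add_one_le_exp ((β - 4 * π) * s ^ 2)]
  have e : exp (β * s ^ 2) = exp ((β - 4 * π) * s ^ 2) * exp (4 * π * s ^ 2) := by
    rw [← exp_add]; ring_nf
  calc |s * f s| = |s| * |f s| := abs_mul _ _
    _ ≤ |s| * (C * exp (4 * π * s ^ 2)) := by gcongr; exact hC s
    _ = (C * |s|) * exp (4 * π * s ^ 2) := by ring
    _ ≤ (ε * ((β - 4 * π) * s ^ 2)) * exp (4 * π * s ^ 2) := by
        refine mul_le_mul_of_nonneg_right ?_ (exp_pos _).le
        rw [← sq_abs s]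
        nlinarith
    _ ≤ (ε * exp ((β - 4 * π) * s ^ 2)) * exp (4 * π * s ^ 2) := by gcongr
    _ = _ := by rw [e]; ring

end Nonlinearity

section TruncatedProblem

variable {X : Type*} [MeasurableSpace X] {μ : Measure X}
  {H : Type*} [NormedAddCommGroup H] [InnerProductSpace ℝ H]

theorem coeFn_finset_sum_Lp {κ : Type*} (s : Finset κ) (g : κ → Lp ℝ 2 μ) :
    ⇑(∑ i ∈ s, g i) =ᵐ[μ] fun x => ∑ i ∈ s, g i x := by
  classical
  induction s using Finset.induction_on with
  | empty =>
    simp only [Finset.sum_empty]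
    exact Lp.coeFn_zero ℝ 2 μ
  | insert a s ha ih =>
    rw [Finset.sum_insert ha]
    filter_upwards [Lp.coeFn_add (g a) (∑ i ∈ s, g i), ih] with x h1 h2
    rw [h1, Pi.add_apply, h2, Finset.sum_insert ha]

/-- Abstract Trudinger–Moser embeddings of a Hilbert space into `L²`. -/
structure IsMoserEmbedding (T : H →L[ℝ] Lp ℝ 2 μ) : Prop where
  moser : ∀ β N, 0 ≤ β → 0 ≤ N → β * N < 4 * π → ∃ C : ℝ, ∀ h : H, ‖h‖ ^ 2 ≤ N →
    ∫⁻ x, ENNReal.ofReal (exp (β * (T h x) ^ 2)) ∂μ ≤ ENNReal.ofReal C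
  exp_integrable : ∀ β, 0 ≤ β → ∀ h, Integrable (fun x => exp (β * (T h x) ^ 2)) μ
  compact : ∀ (h : ℕ → H) (R : ℝ), (∀ n, ‖h n‖ ≤ R) →
    (∀ v, Tendsto (fun n => ⟪v, h n⟫) atTop (𝓝 0)) → Tendsto (fun n => ‖T (h n)‖) atTop (𝓝 0)
  injective : ∀ h, T h = 0 → h = 0

/-- The energy functional on the energy space. -/
noncomputable def action (f : ℝ → ℝ) (T : H →L[ℝ] Lp ℝ 2 μ) (h : H) : ℝ :=
  1 / 2 * ‖h‖ ^ 2 - ∫ x, primF f (T h x) ∂μ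

theorem exists_bound_of_mem_span {T : H →L[ℝ] Lp ℝ 2 μ} {s : Set H}
    (hs : ∀ h ∈ s, ∃ B : ℝ, ∀ᵐ x ∂μ, |T h x| ≤ B) {h : H} (hh : h ∈ Submodule.span ℝ s) :
    ∃ B : ℝ, ∀ᵐ x ∂μ, |T h x| ≤ B := by
  induction hh using Submodule.span_induction with
  | mem h hh => exact hs h hh
  | zero =>
    refine ⟨0, ?_⟩
    rw [map_zero]
    filter_upwards [Lp.coeFn_zero ℝ 2 μ] with x hx
    rw [hx]
    simp
  | add a b _ _ ha hb =>
    obtain ⟨A, hA⟩ := ha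
    obtain ⟨B, hB⟩ := hb
    refine ⟨A + B, ?_⟩
    rw [map_add]
    filter_upwards [hA, hB, Lp.coeFn_add (T a) (T b)] with x h1 h2 h3
    rw [h3]
    exact (abs_add_le _ _).trans (add_le_add h1 h2)
  | smul r a _ ha =>
    obtain ⟨A, hA⟩ := ha
    refine ⟨|r| * A, ?_⟩
    rw [map_smul]
    filter_upwards [hA, Lp.coeFn_smul r (T a)] with x h1 h3
    rw [h3, Pi.smul_apply, smul_eq_mul, abs_mul]
    gcongr

theorem exists_representing_map (T : H →L[ℝ] Lp ℝ 2 μ) (E : Submodule ℝ H)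
    [FiniteDimensional ℝ E] (hE : ∀ h ∈ E, ∃ B : ℝ, ∀ᵐ x ∂μ, |T h x| ≤ B) :
    ∃ ℓ : X → E, StronglyMeasurable ℓ ∧ (∃ B, ∀ x, ‖ℓ x‖ ≤ B) ∧
      ∀ h : E, ∀ᵐ x ∂μ, ⟪ℓ x, h⟫ = T h x := by
  let b := stdOrthonormalBasis ℝ E
  choose B hB using fun i => hE (b i) (b i).2
  let c : Fin (Module.finrank ℝ E) → X → ℝ := fun i x =>
    max (-|B i|) (min |B i| (T (b i) x))
  have hc : ∀ i x, |c i x| ≤ |B i| := fun i x => by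
    have := abs_nonneg (B i)
    refine abs_le.2 ⟨le_max_left _ _, max_le (by linarith) (min_le_left _ _)⟩
  have hcm : ∀ i, StronglyMeasurable (c i) := fun i =>
    stronglyMeasurable_const.sup (stronglyMeasurable_const.inf (Lp.stronglyMeasurable _))
  refine ⟨fun x => ∑ i, c i x • b i, ?_, ⟨∑ i, |B i|, fun x => ?_⟩, fun h => ?_⟩
  · exact Finset.stronglyMeasurable_fun_sum _ fun i _ => (hcm i).smul stronglyMeasurable_const
  · refine (norm_sum_le _ _).trans (Finset.sum_le_sum fun i _ => ?_)
    rw [norm_smul, b.orthonormal.1 i, mul_one]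
    exact hc i x
  · have hsum : T h = ∑ i, ⟪b i, h⟫ • T (b i) := by
      conv_lhs => rw [← b.sum_repr' h]
      simp
    have hae : ∀ᵐ x ∂μ, ∀ i, |T (b i) x| ≤ B i := ae_all_iff.2 hB
    have hae2 : ∀ᵐ x ∂μ, ∀ i, (⟪b i, h⟫ • T (b i) : Lp ℝ 2 μ) x = ⟪b i, h⟫ * T (b i) x :=
      ae_all_iff.2 fun i => by
        filter_upwards [Lp.coeFn_smul ⟪b i, h⟫ (T (b i))] with x hx
        rw [hx]; rfl
    filter_upwards [hae, hae2, coeFn_finset_sum_Lp Finset.univ fun i =>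
      (⟪b i, h⟫ • T (b i) : Lp ℝ 2 μ)]
      with x h1 h2 h3
    rw [hsum, h3, sum_inner]
    refine Finset.sum_congr rfl fun i _ => ?_
    rw [h2, real_inner_smul_left, mul_comm]
    congr 1
    have := abs_le.1 ((h1 i).trans (le_abs_self _))
    simp only [c]
    rw [min_eq_right this.2, max_eq_right this.1]

theorem IsMoserEmbedding.exists_mountain {f : ℝ → ℝ} (hf : Continuous f)
    (hf1 : ∃ C > 0, ∀ s : ℝ, |f s| ≤ C * Real.exp (4 * π * s ^ 2))
    (hf2 : Tendsto (fun s : ℝ => f s / s) (𝓝[≠] 0) (𝓝 0))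
    (hH2 : ∀ s : ℝ, s ≠ 0 → 0 < primF f s ∧ primF f s ≤ (1/2) * f s * s)
    {T : H →L[ℝ] Lp ℝ 2 μ} (hT : IsMoserEmbedding T) :
    ∃ ρ > 0, ∃ α > 0, ∀ h : H, ‖h‖ = ρ → α ≤ action f T h := by
  obtain ⟨C₁, hC₁⟩ := hT.moser (2 * π) 1 (by positivity) zero_le_one (by linarith [pi_pos])
  set ε := 1 / (8 * (‖T‖ ^ 2 + 1)) with hε
  obtain ⟨C, hC0, hC⟩ := exists_primF_le_sq_add hf1 hf2 hH2 (ε := ε) (by positivity)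
  set ρ : ℝ := √(min (1 / 4) (1 / (8 * (C * |C₁| + 1)))) with hρdef
  have hρ2 : ρ ^ 2 = min (1 / 4) (1 / (8 * (C * |C₁| + 1))) := Real.sq_sqrt (by positivity)
  have hρ0 : 0 < ρ := by positivity
  have hρ4 : ρ ^ 2 ≤ 1 / 4 := hρ2 ▸ min_le_left _ _
  have hρC : ρ ^ 2 * (C * |C₁|) ≤ 1 / 8 := by
    have h1 : ρ ^ 2 ≤ 1 / (8 * (C * |C₁| + 1)) := hρ2 ▸ min_le_right _ _
    rw [le_div_iff₀ (by positivity)] at h1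
    nlinarith [sq_nonneg ρ]
  refine ⟨ρ, hρ0, 1 / 4 * ρ ^ 2, by positivity, fun h hh => ?_⟩
  set v := ρ⁻¹ • h with hv
  have hv1 : ‖v‖ ^ 2 ≤ 1 := by
    rw [hv, norm_smul, hh, norm_inv, Real.norm_of_nonneg hρ0.le, inv_mul_cancel₀ hρ0.ne']
    norm_num
  have hTv : ∀ᵐ x ∂μ, T h x = ρ * T v x := by
    have e : T h = ρ • T v := by rw [hv, map_smul, smul_smul, mul_inv_cancel₀ hρ0.ne', one_smul]
    rw [e]
    filter_upwards [Lp.coeFn_smul ρ (T v)] with x hx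
    rw [hx]; rfl
  have hexpm : Measurable fun x => exp (2 * π * (T v x) ^ 2) :=
    (((Lp.stronglyMeasurable (T v)).measurable.pow_const 2).const_mul (2 * π)).exp
  have hi1 : Integrable (fun x => exp (2 * π * (T v x) ^ 2)) μ := by
    refine ⟨hexpm.aestronglyMeasurable, ?_⟩
    rw [hasFiniteIntegral_iff_ofReal (.of_forall fun x => (exp_pos _).le)]
    exact (hC₁ v hv1).trans_lt ENNReal.ofReal_lt_top
  have hi1' : ∫ x, exp (2 * π * (T v x) ^ 2) ∂μ ≤ |C₁| := by
    rw [← ENNReal.ofReal_le_ofReal_iff (abs_nonneg _), ofReal_integral_eq_lintegral_ofReal hi1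
      (.of_forall fun x => (exp_pos _).le)]
    exact (hC₁ v hv1).trans (ENNReal.ofReal_le_ofReal (le_abs_self _))
  have hi2 : Integrable (fun x => (T h x) ^ 2) μ := (Lp.memLp (T h)).integrable_sq
  have hi2' : ∫ x, (T h x) ^ 2 ∂μ ≤ ‖T‖ ^ 2 * ρ ^ 2 := by
    have e : ∫ x, (T h x) ^ 2 ∂μ = ‖T h‖ ^ 2 := by
      rw [← real_inner_self_eq_norm_sq, L2.inner_def]
      refine integral_congr_ae (.of_forall fun x => ?_)
      simp [sq]
    rw [e, ← mul_pow, ← hh]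
    gcongr
    exact T.le_opNorm h
  have hpt : ∀ᵐ x ∂μ, primF f (T h x) ≤
      ε * (T h x) ^ 2 + C * ρ ^ 4 * exp (2 * π * (T v x) ^ 2) := by
    filter_upwards [hTv] with x hx
    refine (hC _).trans ?_
    rw [hx]
    have h0 : 0 ≤ T v x ^ 2 := sq_nonneg _
    set z := T v x ^ 2 with hz
    have h1 : z ^ 2 ≤ exp (π * z) := by
      have := quadratic_le_exp_of_nonneg (x := π * z) (by positivity)
      have h2 : 1 ≤ π ^ 2 / 2 := by nlinarith [pi_gt_three]
      have h3 : z ^ 2 ≤ π ^ 2 / 2 * z ^ 2 := le_mul_of_one_le_left (by positivity) h2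
      have h4 : 0 ≤ π * z := by positivity
      have h5 : (π * z) ^ 2 / 2 = π ^ 2 / 2 * z ^ 2 := by ring
      linarith
    have h2 : exp (4 * π * (ρ * T v x) ^ 2) ≤ exp (π * z) := by
      refine exp_le_exp.2 ?_
      rw [mul_pow, ← hz]
      have : 0 ≤ π * z := by positivity
      nlinarith
    have h3 : (ρ * T v x) ^ 4 = ρ ^ 4 * z ^ 2 := by rw [hz]; ring
    rw [h3]
    have h4 : ρ ^ 4 * z ^ 2 * exp (4 * π * (ρ * T v x) ^ 2) ≤
        ρ ^ 4 * exp (π * z) * exp (π * z) := by gcongr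
    have h5 : ρ ^ 4 * exp (π * z) * exp (π * z) = ρ ^ 4 * exp (2 * π * z) := by
      rw [mul_assoc, ← exp_add]; ring_nf
    calc _ ≤ ε * (ρ * T v x) ^ 2 + C * (ρ ^ 4 * exp (2 * π * z)) := by
          rw [← h5]; gcongr
      _ = _ := by ring
  have hInt : Integrable (fun x => ε * (T h x) ^ 2 + C * ρ ^ 4 * exp (2 * π * (T v x) ^ 2)) μ :=
    (hi2.const_mul _).add (hi1.const_mul _)
  have hFi : Integrable (fun x => primF f (T h x)) μ := by
    refine hInt.mono' ((continuous_primF hf).comp_stronglyMeasurable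
      (Lp.stronglyMeasurable _)).aestronglyMeasurable ?_
    filter_upwards [hpt] with x hx
    rwa [Real.norm_of_nonneg (primF_nonneg hH2 _)]
  have hle := integral_mono_ae hFi hInt hpt
  rw [integral_add (hi2.const_mul _) (hi1.const_mul _), integral_const_mul, integral_const_mul]
    at hle
  have h1 : ε * ∫ x, (T h x) ^ 2 ∂μ ≤ 1 / 8 * ρ ^ 2 := by
    calc _ ≤ ε * (‖T‖ ^ 2 * ρ ^ 2) := by gcongr
      _ = (‖T‖ ^ 2 / (‖T‖ ^ 2 + 1)) * (1 / 8 * ρ ^ 2) := by rw [hε]; field_simp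
      _ ≤ 1 * (1 / 8 * ρ ^ 2) := by
        gcongr
        rw [div_le_one (by positivity)]
        linarith
      _ = _ := one_mul _
  have h2 : C * ρ ^ 4 * ∫ x, exp (2 * π * (T v x) ^ 2) ∂μ ≤ 1 / 8 * ρ ^ 2 := by
    calc _ ≤ C * ρ ^ 4 * |C₁| := by gcongr
      _ = (ρ ^ 2 * (C * |C₁|)) * ρ ^ 2 := by ring
      _ ≤ _ := by gcongr
  rw [action, hh]
  linarith

end TruncatedProblem

section Galerkin

variable {X : Type*} [MeasurableSpace X] {μ : Measure X} [IsFiniteMeasure μ]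
  {H : Type*} [NormedAddCommGroup H] [InnerProductSpace ℝ H] {f : ℝ → ℝ} {T : H →L[ℝ] Lp ℝ 2 μ}

theorem IsMoserEmbedding.exists_galerkin_solution (hf : Continuous f)
    (hodd : ∀ s : ℝ, f (-s) = - f s)
    (hH2 : ∀ s : ℝ, s ≠ 0 → 0 < primF f s ∧ primF f s ≤ (1/2) * f s * s)
    (hH3 : Tendsto (fun s : ℝ => s * f s * Real.exp (-(4 * π * s ^ 2))) atTop atTop)
    (hT : IsMoserEmbedding T) {ρ α c : ℝ} (hρ : 0 < ρ) (hα : 0 < α)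
    (hmt : ∀ h : H, ‖h‖ = ρ → α ≤ action f T h) (E : Submodule ℝ H) [FiniteDimensional ℝ E]
    (hE : ∀ h ∈ E, ∃ B : ℝ, ∀ᵐ x ∂μ, |T h x| ≤ B) {e : H} (he : e ∈ E) (he0 : e ≠ 0)
    (hc : ∀ t : ℝ, action f T (t • e) ≤ c) :
    ∃ h ∈ E, (∀ v ∈ E, ⟪h, v⟫ = ∫ x, f (T h x) * T v x ∂μ) ∧ α ≤ action f T h ∧
      action f T h ≤ c := by
  obtain ⟨ℓ, hℓ, ⟨B, hB⟩, hℓT⟩ := exists_representing_map T E hE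
  have henergy : ∀ h : E, energy μ f ℓ h = action f T (h : H) := by
    intro h
    rw [energy, action]
    congr 1
    refine integral_congr_ae ?_
    filter_upwards [hℓT h] with x hx
    rw [hx]
  have hinj : ∀ h : E, (∀ᵐ x ∂μ, ⟪ℓ x, h⟫ = 0) → h = 0 := by
    intro h hh
    refine Subtype.ext (hT.injective _ ?_)
    rw [Lp.eq_zero_iff_ae_eq_zero]
    filter_upwards [hh, hℓT h] with x h1 h2
    rw [← h2, h1]; rfl
  have htend := tendsto_energy_cocompact hf hℓ hB hinj
    (exists_mul_sq_sub_le_primF hf hodd hH2 hH3)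
  let e' : E := ⟨e, he⟩
  have he' : 0 < ‖e'‖ := norm_pos_iff.2 fun h => he0 (congrArg Subtype.val h)
  have hray : Tendsto (fun t : ℝ => t • e') atTop (cocompact E) := by
    refine tendsto_cocompact_of_tendsto_dist_comp_atTop (0 : E) ?_
    simp only [dist_zero_right, norm_smul]
    exact (tendsto_norm_atTop_atTop).atTop_mul_const he'
  obtain ⟨t, ht1, ht2⟩ := (((htend.comp hray).eventually_le_atBot 0).and
    (eventually_gt_atTop (ρ / ‖e'‖))).exists
  have ht0 : 0 < t := lt_trans (by positivity) ht2
  obtain ⟨h, hg, h1, h2⟩ := exists_mountain_pass_point (J := energy μ f ℓ)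
    (continuous_energyGrad hf hℓ hB) (hasGradientAt_energy hf hℓ hB) htend (e := t • e') (b := c)
    hρ (by
      rw [norm_smul, Real.norm_of_nonneg ht0.le]
      rwa [div_lt_iff₀ he'] at ht2) (by simp [energy]) ht1 hα
    (fun x hx => by rw [henergy]; exact hmt _ hx)
    (fun r _ => by rw [henergy, smul_smul]; exact hc (r * t))
  rw [henergy] at h1 h2
  refine ⟨h, h.2, fun v hv => ?_, h1, h2⟩
  obtain ⟨C, hC⟩ := exists_bound_comp_inner hf hB ‖h‖
  have hInt : Integrable (fun x => f ⟪ℓ x, h⟫ • ℓ x) μ := by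
    refine Integrable.of_bound ((hf.comp_stronglyMeasurable
      (hℓ.inner stronglyMeasurable_const)).smul hℓ).aestronglyMeasurable (C * B)
      (.of_forall fun x => ?_)
    rw [norm_smul]
    have := hC x h le_rfl
    exact mul_le_mul this (hB x) (norm_nonneg _) ((abs_nonneg _).trans this)
  have hh : h = ∫ x, f ⟪ℓ x, h⟫ • ℓ x ∂μ := sub_eq_zero.1 hg
  have h3 : ⟪(⟨v, hv⟩ : E), h⟫ = ∫ x, ⟪(⟨v, hv⟩ : E), f ⟪ℓ x, h⟫ • ℓ x⟫ ∂μ := by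
    rw [integral_inner hInt, ← hh]
  have h4 : ⟪(h : H), v⟫ = ⟪(⟨v, hv⟩ : E), h⟫ := by
    rw [real_inner_comm]; rfl
  rw [h4, h3]
  refine integral_congr_ae ?_
  filter_upwards [hℓT h, hℓT ⟨v, hv⟩] with x h5 h6
  rw [real_inner_smul_right, h5, real_inner_comm, h6]

end Galerkin

namespace IsMoserEmbedding

variable {X : Type*} [MeasurableSpace X] {μ : Measure X}
  {H : Type*} [NormedAddCommGroup H] [InnerProductSpace ℝ H] {f : ℝ → ℝ} {T : H →L[ℝ] Lp ℝ 2 μ}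

theorem memLp_comp (hf : Continuous f)
    (hf1 : ∃ C > 0, ∀ s : ℝ, |f s| ≤ C * Real.exp (4 * π * s ^ 2))
    (hT : IsMoserEmbedding T) (h : H) : MemLp (fun x => f (T h x)) 2 μ := by
  obtain ⟨C, hC0, hC⟩ := hf1
  have hm : StronglyMeasurable fun x => f (T h x) :=
    hf.comp_stronglyMeasurable (Lp.stronglyMeasurable (T h))
  rw [memLp_two_iff_integrable_sq hm.aestronglyMeasurable]
  refine ((hT.exp_integrable (8 * π) (by positivity) h).const_mul (C ^ 2)).mono'
    (hm.pow 2).aestronglyMeasurable (.of_forall fun x => ?_)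
  rw [Real.norm_of_nonneg (sq_nonneg _), ← sq_abs]
  calc |f (T h x)| ^ 2 ≤ (C * exp (4 * π * (T h x) ^ 2)) ^ 2 := by gcongr; exact hC _
    _ = C ^ 2 * exp (8 * π * (T h x) ^ 2) := by
      rw [mul_pow, ← Real.exp_nat_mul]
      congr 2
      push_cast
      ring

theorem integrable_mul_comp (hf : Continuous f)
    (hf1 : ∃ C > 0, ∀ s : ℝ, |f s| ≤ C * Real.exp (4 * π * s ^ 2))
    (hT : IsMoserEmbedding T) (h : H) : Integrable (fun x => T h x * f (T h x)) μ :=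
  (Lp.memLp (T h)).integrable_mul (hT.memLp_comp hf hf1 h)

theorem integrable_primF_comp (hf : Continuous f)
    (hf1 : ∃ C > 0, ∀ s : ℝ, |f s| ≤ C * Real.exp (4 * π * s ^ 2))
    (hH2 : ∀ s : ℝ, s ≠ 0 → 0 < primF f s ∧ primF f s ≤ (1/2) * f s * s)
    (hT : IsMoserEmbedding T) (h : H) : Integrable (fun x => primF f (T h x)) μ := by
  refine (hT.integrable_mul_comp hf hf1 h).mono'
    ((continuous_primF hf).comp_stronglyMeasurable
      (Lp.stronglyMeasurable (T h))).aestronglyMeasurable (.of_forall fun x => ?_)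
  rw [Real.norm_of_nonneg (primF_nonneg hH2 _)]
  have h0 := mul_self_nonneg_of_superquadratic hH2 (T h x)
  rcases eq_or_ne (T h x) 0 with hx | hx
  · rw [hx]; simp
  · linarith [(hH2 _ hx).2, mul_comm (T h x) (f (T h x))]

/-- Below the critical level `1 / 2`, sequences satisfying the Nehari identity have nonzero weak
limit points along which the nonlinearity converges. -/
theorem exists_subseq_tendsto [IsFiniteMeasure μ] [CompleteSpace H]
    [TopologicalSpace.SeparableSpace H] (hf : Continuous f)
    (hf1 : ∃ C > 0, ∀ s : ℝ, |f s| ≤ C * Real.exp (4 * π * s ^ 2))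
    (hH1 : ∃ s₀ > 0, ∃ M > 0, ∀ s : ℝ, s₀ ≤ |s| → 0 < primF f s ∧ primF f s ≤ M * |f s|)
    (hH2 : ∀ s : ℝ, s ≠ 0 → 0 < primF f s ∧ primF f s ≤ (1/2) * f s * s)
    (hT : IsMoserEmbedding T) {α c : ℝ} (hα : 0 < α) (hc : c < 1 / 2) {h : ℕ → H}
    (hN : ∀ n, ‖h n‖ ^ 2 = ∫ x, T (h n) x * f (T (h n) x) ∂μ)
    (h1 : ∀ n, α ≤ action f T (h n)) (h2 : ∀ n, action f T (h n) ≤ c) :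
    ∃ (a : H) (ns : ℕ → ℕ), StrictMono ns ∧ a ≠ 0 ∧
      (∀ v, Tendsto (fun n => ⟪v, h (ns n)⟫) atTop (𝓝 ⟪v, a⟫)) ∧
      Tendsto (fun n => ∫⁻ x, ‖f (T (h (ns n)) x) - f (T a x)‖ₑ ∂μ) atTop (𝓝 0) := by
  obtain ⟨C, hC⟩ := exists_primF_le hf hH1 hH2
  have hbound : ∀ n, ‖h n‖ ^ 2 ≤ 4 * (c + C * μ.real univ) := by
    intro n
    have e1 : ∫ x, primF f (T (h n) x) ∂μ ≤
        ∫ x, (1 / 4 * (T (h n) x * f (T (h n) x)) + C) ∂μ :=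
      integral_mono (hT.integrable_primF_comp hf hf1 hH2 _)
        (((hT.integrable_mul_comp hf hf1 _).const_mul _).add (integrable_const _))
        fun x => hC _
    rw [integral_add ((hT.integrable_mul_comp hf hf1 _).const_mul _) (integrable_const _),
      integral_const_mul, ← hN, integral_const, smul_eq_mul] at e1
    have := h2 n
    rw [action] at this
    linarith [mul_comm C (μ.real univ)]
  have hR : ∀ n, ‖h n‖ ≤ √(4 * (c + C * μ.real univ)) := fun n => Real.le_sqrt_of_sq_le (hbound n)
  obtain ⟨a, ns, hns, hweak⟩ := exists_subseq_tendsto_weak hR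
  have hstrong : Tendsto (fun n => T (h (ns n))) atTop (𝓝 (T a)) := by
    rw [tendsto_iff_norm_sub_tendsto_zero]
    have := hT.compact (fun n => h (ns n) - a) (√(4 * (c + C * μ.real univ)) + ‖a‖)
      (fun n => (norm_sub_le _ _).trans (by gcongr; exact hR _)) (fun v => by
        simp only [inner_sub_right]
        simpa using (hweak v).sub_const ⟪v, a⟫)
    simpa using this
  obtain ⟨ms, hms, hae⟩ := exists_seq_tendsto_ae_of_tendsto_Lp hstrong
  have hlin : ∀ n, ∫⁻ x, ENNReal.ofReal (T (h n) x * f (T (h n) x)) ∂μ ≤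
      ENNReal.ofReal (4 * (c + C * μ.real univ)) := fun n => by
    rw [← ofReal_integral_eq_lintegral_ofReal (hT.integrable_mul_comp hf hf1 _)
      (.of_forall fun x => mul_self_nonneg_of_superquadratic hH2 _), ← hN]
    exact ENNReal.ofReal_le_ofReal (hbound n)
  refine ⟨a, ns ∘ ms, hns.comp hms, ?_, fun v => (hweak v).comp hms.tendsto_atTop,
    (integrable_and_tendsto_integral_comp (u := fun n => T (h (ns (ms n))))
      (fun n => Lp.stronglyMeasurable _) (Lp.stronglyMeasurable _) hae hf
      (D := fun s => s * f s) (abs_le_mul_of_lt hH2) fun n => hlin _).2⟩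
  rintro rfl
  have hT0 : ∀ᵐ x ∂μ, T (0 : H) x = 0 := by
    rw [map_zero]
    filter_upwards [Lp.coeFn_zero ℝ 2 μ] with x hx
    rw [hx]; rfl
  have hF := integrable_and_tendsto_integral_comp (u := fun n => T (h (ns (ms n))))
      (fun n => Lp.stronglyMeasurable _) (Lp.stronglyMeasurable _) hae (continuous_primF hf)
      (D := fun s => s * f s) (primF_le_mul_of_lt hH1 hH2) fun n => hlin _
  have hF' : Tendsto (fun n => ∫ x, primF f (T (h (ns (ms n))) x) ∂μ) atTop (𝓝 0) := by
    have := tendsto_integral_of_L1 _ hF.1.aestronglyMeasurable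
      (.of_forall fun n => hT.integrable_primF_comp hf hf1 hH2 _) hF.2
    rwa [integral_eq_zero_of_ae (f := fun x => primF f (T (0 : H) x)) (by
      filter_upwards [hT0] with x hx
      simp only [hx, primF_zero, Pi.zero_apply])] at this
  have hc0 : 0 < c := hα.trans_le ((h1 0).trans (h2 0))
  set N := c + 1 / 2 with hNdef
  have hN0 : 0 < N := by positivity
  have hN1 : N < 1 := by rw [hNdef]; linarith
  obtain ⟨n₀, hn₀⟩ := eventually_atTop.1 (hF'.eventually_lt_const
    (show (0 : ℝ) < (1 / 2 - c) / 2 by linarith))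
  have hsmall : ∀ n, ‖h (ns (ms (n + n₀)))‖ ^ 2 ≤ N := fun n => by
    have e1 := hn₀ (n + n₀) (by omega)
    have e2 := h2 (ns (ms (n + n₀)))
    rw [action] at e2
    linarith
  set β := 2 * π * (1 + 1 / N) with hβ
  have hβN : β * N < 4 * π := by
    have : β * N = 2 * π * (N + 1) := by rw [hβ]; field_simp
    rw [this]
    nlinarith [pi_pos]
  have hβ4 : 4 * π < β := by
    have : 1 < 1 / N := by rw [lt_div_iff₀ hN0]; linarith
    rw [hβ]; nlinarith [pi_pos]
  obtain ⟨C', hC'⟩ := hT.moser β N (by positivity) hN0.le hβN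
  have hG := integrable_and_tendsto_integral_comp (u := fun n => T (h (ns (ms (n + n₀)))))
      (fun n => Lp.stronglyMeasurable _) (Lp.stronglyMeasurable _) (by
        filter_upwards [hae] with x hx
        exact (tendsto_add_atTop_iff_nat n₀).2 hx) (continuous_id.mul hf)
      (D := fun s => exp (β * s ^ 2)) (mul_le_exp_of_lt hf1 hβ4) fun n => hC' _ (hsmall n)
  have hG' : Tendsto (fun n => ‖h (ns (ms (n + n₀)))‖ ^ 2) atTop (𝓝 0) := by
    have := tendsto_integral_of_L1 _ hG.1.aestronglyMeasurable
      (.of_forall fun n => hT.integrable_mul_comp hf hf1 _) hG.2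
    rw [integral_eq_zero_of_ae (by
      filter_upwards [hT0] with x hx
      simp only [hx, Pi.mul_apply, id, zero_mul, Pi.zero_apply])] at this
    exact this.congr fun n => (hN _).symm
  have hlim : Tendsto (fun n => action f T (h (ns (ms (n + n₀))))) atTop (𝓝 0) := by
    have := (hG'.const_mul (1 / 2)).sub ((tendsto_add_atTop_iff_nat n₀).2 hF')
    rwa [mul_zero, sub_zero] at this
  exact absurd (ge_of_tendsto' hlim fun n => h1 _) (not_le.2 hα)

/-- Existence of a nonzero critical point of the action when a ray stays below the critical
level `1 / 2`. -/
theorem exists_solution [IsFiniteMeasure μ] [CompleteSpace H]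
    [TopologicalSpace.SeparableSpace H] (hf : Continuous f) (hodd : ∀ s : ℝ, f (-s) = - f s)
    (hf1 : ∃ C > 0, ∀ s : ℝ, |f s| ≤ C * Real.exp (4 * π * s ^ 2))
    (hf2 : Tendsto (fun s : ℝ => f s / s) (𝓝[≠] 0) (𝓝 0))
    (hH1 : ∃ s₀ > 0, ∃ M > 0, ∀ s : ℝ, s₀ ≤ |s| → 0 < primF f s ∧ primF f s ≤ M * |f s|)
    (hH2 : ∀ s : ℝ, s ≠ 0 → 0 < primF f s ∧ primF f s ≤ (1/2) * f s * s)
    (hH3 : Tendsto (fun s : ℝ => s * f s * Real.exp (-(4 * π * s ^ 2))) atTop atTop)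
    (hT : IsMoserEmbedding T) {e : ℕ → H} (he : ∀ j, ∃ B : ℝ, ∀ᵐ x ∂μ, |T (e j) x| ≤ B)
    (he0 : e 0 ≠ 0) {c : ℝ} (hc : c < 1 / 2) (hray : ∀ t : ℝ, action f T (t • e 0) ≤ c) :
    ∃ h : H, h ≠ 0 ∧ ∀ j, ⟪h, e j⟫ = ∫ x, f (T h x) * T (e j) x ∂μ := by
  obtain ⟨ρ, hρ, α, hα, hmt⟩ := hT.exists_mountain hf hf1 hf2 hH2
  have hgal : ∀ n : ℕ, ∃ h ∈ Submodule.span ℝ (e '' Iic n),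
      (∀ v ∈ Submodule.span ℝ (e '' Iic n), ⟪h, v⟫ = ∫ x, f (T h x) * T v x ∂μ) ∧
      α ≤ action f T h ∧ action f T h ≤ c := by
    intro n
    have : FiniteDimensional ℝ (Submodule.span ℝ (e '' Iic n)) :=
      FiniteDimensional.span_of_finite ℝ ((finite_Iic n).image e)
    refine hT.exists_galerkin_solution hf hodd hH2 hH3 hρ hα hmt _ (fun h hh =>
      exists_bound_of_mem_span ?_ hh) (Submodule.subset_span ⟨0, by simp, rfl⟩) he0 hray
    rintro _ ⟨j, -, rfl⟩
    exact he j
  choose h hmem hsol h1 h2 using hgal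
  obtain ⟨a, ns, hns, ha, hw, hlim⟩ := hT.exists_subseq_tendsto hf hf1 hH1 hH2 hα hc (h := h)
    (fun n => by
      rw [← real_inner_self_eq_norm_sq, hsol n _ (hmem n)]
      exact integral_congr_ae (.of_forall fun x => mul_comm _ _)) h1 h2
  refine ⟨a, ha, fun j => ?_⟩
  obtain ⟨B, hB⟩ := he j
  have hInt : ∀ b : H, Integrable (fun x => f (T b x) * T (e j) x) μ := fun b =>
    (hT.memLp_comp hf hf1 b).integrable_mul (Lp.memLp (T (e j)))
  have hr : Tendsto (fun n => ∫ x, f (T (h (ns n)) x) * T (e j) x ∂μ) atTop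
      (𝓝 (∫ x, f (T a x) * T (e j) x ∂μ)) := by
    refine tendsto_integral_of_L1 _ (hInt a).aestronglyMeasurable (.of_forall fun n => hInt _) ?_
    have h0 : Tendsto (fun n => ENNReal.ofReal B *
        ∫⁻ x, ‖f (T (h (ns n)) x) - f (T a x)‖ₑ ∂μ) atTop (𝓝 0) := by
      simpa using ENNReal.Tendsto.const_mul hlim (.inr (ENNReal.ofReal_ne_top (r := B)))
    refine tendsto_of_tendsto_of_tendsto_of_le_of_le tendsto_const_nhds h0
      (fun _ => zero_le) fun n => ?_
    dsimp only
    rw [← lintegral_const_mul' _ _ ENNReal.ofReal_ne_top]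
    refine lintegral_mono_ae ?_
    filter_upwards [hB] with x hx
    rw [← sub_mul, enorm_mul, mul_comm]
    gcongr
    rw [← ofReal_norm]
    exact ENNReal.ofReal_le_ofReal hx
  have hl : Tendsto (fun n => ⟪h (ns n), e j⟫) atTop (𝓝 ⟪a, e j⟫) := by
    simpa only [real_inner_comm] using hw (e j)
  refine tendsto_nhds_unique (hl.congr' ?_) hr
  filter_upwards [eventually_ge_atTop j] with n hn
  exact hsol _ _ (Submodule.subset_span ⟨j, hn.trans (hns.id_le n), rfl⟩)

end IsMoserEmbedding

namespace IsGreenKernel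

variable {X : Type} [MeasurableSpace X] {μ : Measure X} {k : X → X → ℝ} [IsFiniteMeasure μ]
  {K : Lp ℝ 2 μ →L[ℝ] Lp ℝ 2 μ} {f : ℝ → ℝ}
  {H : Type*} [NormedAddCommGroup H] [InnerProductSpace ℝ H] [CompleteSpace H]
  {ι : Lp ℝ 2 μ →L[ℝ] H}

theorem adjoint_apply (hk : IsGreenKernel μ k)
    (hK : ∀ g, K g =ᵐ[μ] fun x => ⟪hk.vec x, g⟫) (hι : ∀ x y, ⟪ι x, ι y⟫ = ⟪K x, y⟫)
    (g : Lp ℝ 2 μ) : ContinuousLinearMap.adjoint ι (ι g) = K g := by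
  refine ext_inner_left ℝ fun v => ?_
  rw [ContinuousLinearMap.adjoint_inner_right, hι, hk.operator_symm hK]

theorem isMoserEmbedding_adjoint (hk : IsGreenKernel μ k)
    (hK : ∀ g, K g =ᵐ[μ] fun x => ⟪hk.vec x, g⟫) (hι : ∀ x y, ⟪ι x, ι y⟫ = ⟪K x, y⟫)
    (hd : DenseRange ι) : IsMoserEmbedding (ContinuousLinearMap.adjoint ι) where
  moser _ _ hβ hN hβN :=
    hk.exists_lintegral_exp_le hK hι hd (hk.adjoint_apply hK hι) hβ hN hβN
  exp_integrable _ hβ h := hk.integrable_exp hK hι hd (hk.adjoint_apply hK hι) hβ h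
  injective h hh := by
    have h1 : ∀ v : H, ⟪v, h⟫ = 0 := by
      intro v
      refine congrFun (hd.equalizer (g := fun v => ⟪v, h⟫) (h := fun _ => (0 : ℝ))
        (by fun_prop) continuous_const (funext fun g => ?_)) v
      change ⟪ι g, h⟫ = 0
      rw [← ContinuousLinearMap.adjoint_inner_right, hh, inner_zero_right]
    exact inner_self_eq_zero.1 (h1 h)
  compact h R hR hw := by
    set T := ContinuousLinearMap.adjoint ι with hT
    have hg : ∀ n, ‖T (h n)‖ ≤ ‖T‖ * R := fun n =>
      (T.le_opNorm _).trans (by gcongr; exact hR n)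
    have hlim := hk.tendsto_operator_of_weak hK hg (fun v => by
      simpa only [hT, ContinuousLinearMap.adjoint_inner_right] using hw (ι v))
    have hle : ∀ n, ‖T (h n)‖ ≤ √(√(‖K (T (h n))‖ * (‖T‖ * R * R ^ 2))) := fun n => by
      have e1 : ‖T (h n)‖ ^ 2 ≤ ‖ι (T (h n))‖ * R := by
        rw [← real_inner_self_eq_norm_sq]
        nth_rewrite 2 [hT]
        rw [ContinuousLinearMap.adjoint_inner_right]
        exact (real_inner_le_norm _ _).trans (by gcongr; exact hR n)
      have e2 : ‖ι (T (h n))‖ ^ 2 ≤ ‖K (T (h n))‖ * (‖T‖ * R) := by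
        rw [← real_inner_self_eq_norm_sq, hι]
        exact (real_inner_le_norm _ _).trans (by gcongr; exact hg n)
      refine Real.le_sqrt_of_sq_le (Real.le_sqrt_of_sq_le ?_)
      calc (‖T (h n)‖ ^ 2) ^ 2 ≤ (‖ι (T (h n))‖ * R) ^ 2 := by gcongr
        _ = ‖ι (T (h n))‖ ^ 2 * R ^ 2 := by ring
        _ ≤ ‖K (T (h n))‖ * (‖T‖ * R) * R ^ 2 := by gcongr
        _ = _ := by ring
    refine squeeze_zero (fun _ => norm_nonneg _) hle ?_
    have := ((hlim.mul_const (‖T‖ * R * R ^ 2)).sqrt).sqrt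
    simpa using this

/-- Existence of a nonzero solution of the Hammerstein equation `u = K (f ∘ u)`. -/
theorem exists_hammerstein_solution [TopologicalSpace.SeparableSpace (Lp ℝ 2 μ)]
    (hk : IsGreenKernel μ k) (hf : Continuous f) (hodd : ∀ s : ℝ, f (-s) = - f s)
    (hf1 : ∃ C > 0, ∀ s : ℝ, |f s| ≤ C * Real.exp (4 * π * s ^ 2))
    (hf2 : Tendsto (fun s : ℝ => f s / s) (𝓝[≠] 0) (𝓝 0))
    (hH1 : ∃ s₀ > 0, ∃ M > 0, ∀ s : ℝ, s₀ ≤ |s| → 0 < primF f s ∧ primF f s ≤ M * |f s|)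
    (hH2 : ∀ s : ℝ, s ≠ 0 → 0 < primF f s ∧ primF f s ≤ (1/2) * f s * s)
    (hH3 : Tendsto (fun s : ℝ => s * f s * Real.exp (-(4 * π * s ^ 2))) atTop atTop)
    {φ : X → ℝ} (hφ : MemLp φ 2 μ) (hφ0 : ∫ x, (∫ y, k x y * φ y ∂μ) * φ x ∂μ ≠ 0)
    {c : ℝ} (hc : c < 1 / 2)
    (hray : ∀ t : ℝ, 1 / 2 * t ^ 2 * ∫ x, (∫ y, k x y * φ y ∂μ) * φ x ∂μ -
      ∫ x, primF f (t * ∫ y, k x y * φ y ∂μ) ∂μ ≤ c) :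
    ∃ u : X → ℝ, StronglyMeasurable u ∧ MemLp (fun x => f (u x)) 2 μ ∧
      (∀ᵐ x ∂μ, u x = ∫ y, k x y * f (u y) ∂μ) ∧ ¬ u =ᵐ[μ] 0 := by
  obtain ⟨K, hK⟩ := hk.exists_operator
  obtain ⟨H, _, _, _, ι, hd, hι⟩ := exists_gram_factorization K (hk.operator_symm hK)
    (hk.operator_pos hK)
  have : TopologicalSpace.SeparableSpace H := hd.separableSpace ι.continuous
  have hM := hk.isMoserEmbedding_adjoint hK hι hd
  have hadj := hk.adjoint_apply hK hι
  have hKφ : ∀ (g : X → ℝ) (hg : MemLp g 2 μ),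
      K (hg.toLp g) =ᵐ[μ] fun x => ∫ y, k x y * g y ∂μ := by
    intro g hg
    filter_upwards [hK (hg.toLp g)] with x hx
    rw [hx, hk.inner_vec]
    refine integral_congr_ae ?_
    filter_upwards [hg.coeFn_toLp] with y hy
    rw [hy]
  set Φ := hφ.toLp φ with hΦ
  have hE : ⟪K Φ, Φ⟫ = ∫ x, (∫ y, k x y * φ y ∂μ) * φ x ∂μ := by
    rw [L2.inner_def]
    refine integral_congr_ae ?_
    filter_upwards [hKφ φ hφ, hφ.coeFn_toLp] with x h1 h2
    rw [h1, h2]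
    simp [mul_comm]
  obtain ⟨C, hC0, hC⟩ := hk.exists_norm_vec_le
  let g : ℕ → Lp ℝ 2 μ := fun n =>
    Nat.rec Φ (fun j _ => TopologicalSpace.denseSeq (Lp ℝ 2 μ) j) n
  obtain ⟨h, hh0, hh⟩ := hM.exists_solution hf hodd hf1 hf2 hH1 hH2 hH3 (e := fun n => ι (g n))
    (fun j => ⟨C * ‖g j‖, by
      rw [hadj]
      filter_upwards [hK (g j)] with x hx
      rw [hx, ← Real.norm_eq_abs]
      exact (norm_inner_le_norm _ _).trans (by gcongr; exact hC x)⟩)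
    (fun h0 => hφ0 (by
      rw [← hE, ← hι, show ι Φ = 0 from h0, inner_zero_left]))
    hc (fun t => by
      refine le_trans (le_of_eq ?_) (hray t)
      change action f _ (t • ι Φ) = _
      rw [action]
      have e1 : ‖t • ι Φ‖ ^ 2 = t ^ 2 * ∫ x, (∫ y, k x y * φ y ∂μ) * φ x ∂μ := by
        rw [norm_smul, mul_pow, ← hE, ← hι, real_inner_self_eq_norm_sq, Real.norm_eq_abs, sq_abs]
      rw [e1, ← mul_assoc]
      congr 1
      refine integral_congr_ae ?_
      rw [map_smul, hadj]
      filter_upwards [Lp.coeFn_smul t (K Φ), hKφ φ hφ] with x h1 h2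
      rw [h1, Pi.smul_apply, h2, smul_eq_mul])
  set T := ContinuousLinearMap.adjoint ι with hT
  have hL := hM.memLp_comp hf hf1 h
  have hfix : T h = K (hL.toLp _) := by
    refine ext_inner_right ℝ fun v => ?_
    refine congrFun ((TopologicalSpace.denseRange_denseSeq (Lp ℝ 2 μ)).equalizer
      (g := fun v => ⟪T h, v⟫) (h := fun v => ⟪K (hL.toLp _), v⟫)
      (by fun_prop) (by fun_prop) (funext fun j => ?_)) v
    change ⟪T h, g (j + 1)⟫ = ⟪K (hL.toLp _), g (j + 1)⟫
    rw [hk.operator_symm hK, show ⟪T h, g (j + 1)⟫ = ⟪h, ι (g (j + 1))⟫ from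
      ContinuousLinearMap.adjoint_inner_left ι _ _, hh (j + 1), hadj, L2.inner_def]
    refine integral_congr_ae ?_
    filter_upwards [hL.coeFn_toLp] with x hx
    rw [hx]
    simp [mul_comm]
  refine ⟨T h, Lp.stronglyMeasurable _, hL, ?_, fun h0 => hh0 (hM.injective h
    ((Lp.eq_zero_iff_ae_eq_zero).2 h0))⟩
  nth_rewrite 1 [hfix]
  exact hKφ _ hL

end IsGreenKernel

theorem integrableOn_ball_norm_rpow {s : ℝ} (hs : s < 2) (r : ℝ) :
    IntegrableOn (fun z : ℂ => ‖z‖ ^ (-s)) (ball 0 r) := by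
  rw [integrableOn_fun_norm_addHaar (volume : Measure ℂ) (f := fun t : ℝ => t ^ (-s)),
    Complex.finrank_real_complex]
  rcases le_or_gt r 0 with hr | hr
  · simp [Ioo_eq_empty (not_lt.2 hr)]
  · refine ((intervalIntegral.integrableOn_Ioo_rpow_iff hr).2
      (show (-1 : ℝ) < 1 - s by linarith)).congr_fun (fun y hy => ?_) measurableSet_Ioo
    simp only [smul_eq_mul]
    rw [sub_eq_add_neg, rpow_add hy.1]
    simp

theorem integrableOn_ball_norm_sub_rpow {s : ℝ} (hs : s < 2) (x : ℂ) (r : ℝ) :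
    IntegrableOn (fun y : ℂ => ‖x - y‖ ^ (-s)) (ball x r) := by
  have h := integrableOn_ball_norm_rpow hs r
  have e := (Measure.measurePreserving_sub_left (volume : Measure ℂ) x).integrableOn_comp_preimage
    (MeasurableEquiv.subLeft x).measurableEmbedding (f := fun z : ℂ => ‖z‖ ^ (-s)) (s := ball 0 r)
  have hs : (fun y => x - y) ⁻¹' ball (0 : ℂ) r = ball x r := by
    ext y; simp [dist_eq_norm, norm_sub_rev x y]
  rw [hs] at e
  exact e.2 h

theorem setIntegral_ball_norm_sub_rpow (s : ℝ) (x : ℂ) (r : ℝ) :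
    ∫ y in ball x r, ‖x - y‖ ^ (-s) = ∫ z in ball (0 : ℂ) r, ‖z‖ ^ (-s) := by
  have e := (Measure.measurePreserving_sub_left (volume : Measure ℂ) x).setIntegral_preimage_emb
    (MeasurableEquiv.subLeft x).measurableEmbedding (fun z : ℂ => ‖z‖ ^ (-s)) (ball 0 r)
  have hs : (fun y => x - y) ⁻¹' ball (0 : ℂ) r = ball x r := by
    ext y; simp [dist_eq_norm, norm_sub_rev x y]
  rwa [hs] at e

theorem ball_zero_one_subset_ball {x : ℂ} (hx : ‖x‖ ≤ 1) : ball (0 : ℂ) 1 ⊆ ball x 2 := by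
  refine ball_subset_ball' ?_
  rw [dist_comm, dist_zero_right]
  linarith

/-- Riesz potentials of order `s < 2` are integrable on the unit disc. -/
theorem integrableOn_unitBall_norm_sub_rpow {s : ℝ} (hs : s < 2) {x : ℂ} (hx : ‖x‖ ≤ 1) :
    IntegrableOn (fun y : ℂ => ‖x - y‖ ^ (-s)) (ball 0 1) :=
  (integrableOn_ball_norm_sub_rpow hs x 2).mono_set (ball_zero_one_subset_ball hx)

theorem setIntegral_unitBall_norm_sub_rpow_le {s : ℝ} (hs : s < 2) {x : ℂ} (hx : ‖x‖ ≤ 1) :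
    ∫ y in ball (0 : ℂ) 1, ‖x - y‖ ^ (-s) ≤ ∫ z in ball (0 : ℂ) 2, ‖z‖ ^ (-s) := by
  rw [← setIntegral_ball_norm_sub_rpow s x 2]
  exact setIntegral_mono_set (integrableOn_ball_norm_sub_rpow hs x 2)
    (.of_forall fun y => by positivity) (ball_zero_one_subset_ball hx).eventuallyLE

/-- The Green function of the unit disc. -/
noncomputable def diskGreen (x y : ℂ) : ℝ :=
  1 / (2 * π) * Real.log (‖1 - x * starRingEnd ℂ y‖ / ‖x - y‖)

/-- The reflection `(x₁, x₂) ↦ (-x₁, x₂)`. -/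
noncomputable def reflect (y : ℂ) : ℂ := -starRingEnd ℂ y

@[simp] theorem reflect_re (y : ℂ) : (reflect y).re = -y.re := by simp [reflect]

@[simp] theorem reflect_im (y : ℂ) : (reflect y).im = y.im := by simp [reflect]

@[simp] theorem norm_reflect (y : ℂ) : ‖reflect y‖ = ‖y‖ := by simp [reflect]

@[simp] theorem reflect_reflect (y : ℂ) : reflect (reflect y) = y := by simp [reflect]

theorem continuous_reflect : Continuous reflect := by unfold reflect; fun_prop

theorem measurePreserving_reflect : MeasurePreserving reflect (volume : Measure ℂ) volume :=
  (Complex.conjLIE.trans (LinearIsometryEquiv.neg ℝ)).measurePreserving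

theorem measurableEmbedding_reflect : MeasurableEmbedding reflect :=
  (Complex.conjLIE.trans (LinearIsometryEquiv.neg ℝ)).toHomeomorph.measurableEmbedding

theorem normSq_one_sub_mul_conj (x y : ℂ) :
    ‖1 - x * starRingEnd ℂ y‖ ^ 2 = ‖x - y‖ ^ 2 + (1 - ‖x‖ ^ 2) * (1 - ‖y‖ ^ 2) := by
  simp only [← Complex.normSq_eq_norm_sq, Complex.normSq_apply]
  simp
  ring

theorem measurable_diskGreen : Measurable (Function.uncurry diskGreen) := by
  unfold diskGreen Function.uncurry
  refine (Real.measurable_log.comp (Measurable.div ?_ ?_)).const_mul _ <;> fun_prop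

theorem diskGreen_symm (x y : ℂ) : diskGreen x y = diskGreen y x := by
  have h : ‖1 - x * starRingEnd ℂ y‖ = ‖1 - y * starRingEnd ℂ x‖ := by
    rw [← Complex.norm_conj]
    simp [mul_comm]
  rw [diskGreen, diskGreen, norm_sub_rev x y, h]

theorem norm_reflect_sub (x y : ℂ) : ‖reflect x - y‖ = ‖x - reflect y‖ := by
  rw [← norm_reflect]
  congr 1
  simp [reflect, add_comm]

theorem diskGreen_reflect (x y : ℂ) : diskGreen (reflect x) y = diskGreen x (reflect y) := by
  have h : ‖1 - reflect x * starRingEnd ℂ y‖ = ‖1 - x * starRingEnd ℂ (reflect y)‖ := by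
    rw [← Complex.norm_conj]
    simp [reflect]
  rw [diskGreen, diskGreen, norm_reflect_sub, h]

theorem norm_sub_le_norm_one_sub {x y : ℂ} (hx : ‖x‖ ≤ 1) (hy : ‖y‖ ≤ 1) :
    ‖x - y‖ ≤ ‖1 - x * starRingEnd ℂ y‖ := by
  refine le_of_sq_le_sq ?_ (norm_nonneg _)
  rw [normSq_one_sub_mul_conj]
  have h1 : 0 ≤ 1 - ‖x‖ ^ 2 := by nlinarith [norm_nonneg x]
  have h2 : 0 ≤ 1 - ‖y‖ ^ 2 := by nlinarith [norm_nonneg y]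
  nlinarith [mul_nonneg h1 h2]

theorem diskGreen_nonneg {x y : ℂ} (hx : ‖x‖ ≤ 1) (hy : ‖y‖ ≤ 1) : 0 ≤ diskGreen x y := by
  rcases eq_or_ne x y with rfl | h
  · simp [diskGreen]
  have h0 : 0 < ‖x - y‖ := norm_pos_iff.2 (sub_ne_zero.2 h)
  refine mul_nonneg (by positivity) (Real.log_nonneg ?_)
  rw [le_div_iff₀ h0, one_mul]
  exact norm_sub_le_norm_one_sub hx hy

theorem norm_one_sub_mul_conj_le {x y : ℂ} (hx : ‖x‖ ≤ 1) (hy : ‖y‖ ≤ 1) :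
    ‖1 - x * starRingEnd ℂ y‖ ≤ 2 := by
  refine (norm_sub_le _ _).trans ?_
  rw [norm_one, norm_mul, Complex.norm_conj]
  nlinarith [norm_nonneg x, norm_nonneg y]

theorem diskGreen_le {x y : ℂ} (hx : ‖x‖ ≤ 1) (hy : ‖y‖ ≤ 1) :
    diskGreen x y ≤ 1 / (2 * π) * Real.log (2 / ‖x - y‖) := by
  rcases eq_or_ne x y with rfl | h
  · simp [diskGreen]
  have h0 : 0 < ‖x - y‖ := norm_pos_iff.2 (sub_ne_zero.2 h)
  have h1 := h0.trans_le (norm_sub_le_norm_one_sub hx hy)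
  rw [diskGreen]
  gcongr
  exact norm_one_sub_mul_conj_le hx hy

theorem diskGreen_reflect_le {x y : ℂ} (hx : ‖x‖ ≤ 1) (hy : ‖y‖ ≤ 1) (hx0 : 0 < x.re)
    (hy0 : 0 < y.re) (hxy : x ≠ y) : diskGreen x (reflect y) ≤ diskGreen x y := by
  have h0 : 0 < ‖x - y‖ := norm_pos_iff.2 (sub_ne_zero.2 hxy)
  have h0' : 0 < ‖x - reflect y‖ := by
    refine norm_pos_iff.2 (sub_ne_zero.2 fun h => ?_)
    have := congrArg Complex.re h
    simp at this
    linarith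
  have h1 := h0.trans_le (norm_sub_le_norm_one_sub hx hy)
  have h1' := h0'.trans_le (norm_sub_le_norm_one_sub hx (by simpa using hy))
  rw [diskGreen, diskGreen]
  refine mul_le_mul_of_nonneg_left (Real.log_le_log (div_pos h1' h0') ?_) (by positivity)
  rw [div_le_div_iff₀ h0' h0]
  refine le_of_sq_le_sq ?_ (by positivity)
  rw [mul_pow, mul_pow, normSq_one_sub_mul_conj, normSq_one_sub_mul_conj, norm_reflect]
  have h2 : 0 ≤ 1 - ‖x‖ ^ 2 := by nlinarith [norm_nonneg x]
  have h3 : 0 ≤ 1 - ‖y‖ ^ 2 := by nlinarith [norm_nonneg y]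
  have h4 : ‖x - y‖ ^ 2 ≤ ‖x - reflect y‖ ^ 2 := by
    simp only [← Complex.normSq_eq_norm_sq, Complex.normSq_apply]
    simp
    nlinarith [mul_pos hx0 hy0]
  nlinarith [mul_nonneg h2 h3]

theorem diskGreen_le_rpow {x y : ℂ} (hx : ‖x‖ ≤ 1) (hy : ‖y‖ ≤ 1) :
    diskGreen x y ≤ ‖x - y‖ ^ (-(1 / 2) : ℝ) := by
  refine (diskGreen_le hx hy).trans ?_
  rcases eq_or_ne x y with rfl | h
  · simp only [sub_self, norm_zero, div_zero, Real.log_zero, mul_zero]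
    positivity
  have h0 : 0 < ‖x - y‖ := norm_pos_iff.2 (sub_ne_zero.2 h)
  have h1 := Real.log_le_rpow_div (x := 2 / ‖x - y‖) (ε := 1 / 2) (by positivity) (by norm_num)
  have h2 : (2 / ‖x - y‖) ^ (1 / 2 : ℝ) = √2 * ‖x - y‖ ^ (-(1 / 2) : ℝ) := by
    rw [Real.div_rpow (by norm_num) h0.le, ← Real.sqrt_eq_rpow, Real.rpow_neg h0.le, div_eq_mul_inv]
  have h3 : √2 ≤ 3 / 2 := by
    rw [Real.sqrt_le_left (by norm_num)]; norm_num
  have h4 : 0 ≤ ‖x - y‖ ^ (-(1 / 2) : ℝ) := by positivity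
  calc 1 / (2 * π) * Real.log (2 / ‖x - y‖)
      ≤ 1 / (2 * 3) * (√2 * ‖x - y‖ ^ (-(1 / 2) : ℝ) / (1 / 2)) := by
        rw [← h2]
        have : 0 ≤ (2 / ‖x - y‖) ^ (1 / 2 : ℝ) / (1 / 2) := by positivity
        refine (mul_le_mul_of_nonneg_left h1 (by positivity)).trans ?_
        refine mul_le_mul_of_nonneg_right ?_ this
        have := pi_gt_three
        gcongr
    _ ≤ ‖x - y‖ ^ (-(1 / 2) : ℝ) := by nlinarith

theorem exp_mul_diskGreen_le {α : ℝ} (hα : 0 ≤ α) {x y : ℂ} (hx : ‖x‖ ≤ 1) (hy : ‖y‖ ≤ 1)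
    (h : x ≠ y) :
    Real.exp (α * diskGreen x y) ≤ 2 ^ (α / (2 * π)) * ‖x - y‖ ^ (-(α / (2 * π))) := by
  have h0 : 0 < ‖x - y‖ := norm_pos_iff.2 (sub_ne_zero.2 h)
  have h1 : 2 ^ (α / (2 * π)) * ‖x - y‖ ^ (-(α / (2 * π))) =
      Real.exp (α * (1 / (2 * π) * Real.log (2 / ‖x - y‖))) := by
    rw [Real.rpow_neg h0.le, ← div_eq_mul_inv, ← Real.div_rpow (by norm_num) h0.le,
      Real.rpow_def_of_pos (by positivity)]
    congr 1
    ring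
  rw [h1]
  gcongr
  exact diskGreen_le hx hy

theorem ae_mem_unitBall : ∀ᵐ x ∂(volume.restrict (ball (0 : ℂ) 1)), ‖x‖ < 1 := by
  filter_upwards [ae_restrict_mem (measurableSet_ball (x := (0 : ℂ)) (ε := 1))] with x hx
  simpa using hx

theorem ae_prod_mem_unitBall :
    ∀ᵐ p ∂((volume.restrict (ball (0 : ℂ) 1)).prod (volume.restrict (ball (0 : ℂ) 1))),
      ‖p.1‖ < 1 ∧ ‖p.2‖ < 1 := by
  have h1 := Measure.quasiMeasurePreserving_fst (μ := volume.restrict (ball (0 : ℂ) 1))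
    (ν := volume.restrict (ball (0 : ℂ) 1)) |>.ae ae_mem_unitBall
  have h2 := Measure.quasiMeasurePreserving_snd (μ := volume.restrict (ball (0 : ℂ) 1))
    (ν := volume.restrict (ball (0 : ℂ) 1)) |>.ae ae_mem_unitBall
  filter_upwards [h1, h2] with p h1 h2 using ⟨h1, h2⟩

theorem integrable_prod_riesz_mul_snd {s : ℝ} (hs : s < 2) {q : ℂ → ℝ}
    (hq : IntegrableOn q (ball 0 1)) :
    Integrable (fun p : ℂ × ℂ => ‖p.1 - p.2‖ ^ (-s) * q p.2)
      ((volume.restrict (ball (0 : ℂ) 1)).prod (volume.restrict (ball (0 : ℂ) 1))) := by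
  have hm : AEStronglyMeasurable (fun p : ℂ × ℂ => ‖p.1 - p.2‖ ^ (-s) * q p.2)
      ((volume.restrict (ball (0 : ℂ) 1)).prod (volume.restrict (ball (0 : ℂ) 1))) := by
    refine AEStronglyMeasurable.mul ?_ hq.aestronglyMeasurable.comp_snd
    exact Measurable.aestronglyMeasurable (by fun_prop)
  have hInt : ∀ y : ℂ, ‖y‖ ≤ 1 → IntegrableOn (fun x : ℂ => ‖x - y‖ ^ (-s)) (ball 0 1) := by
    intro y hy
    simpa only [norm_sub_rev] using integrableOn_unitBall_norm_sub_rpow hs hy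
  rw [integrable_prod_iff' hm]
  constructor
  · filter_upwards [ae_mem_unitBall] with y hy
    exact (hInt y hy.le).mul_const _
  · refine Integrable.mono' (hq.norm.const_mul (∫ z in ball (0 : ℂ) 2, ‖z‖ ^ (-s)))
      hm.norm.prod_swap.integral_prod_right' ?_
    filter_upwards [ae_mem_unitBall] with y hy
    rw [Real.norm_of_nonneg (integral_nonneg fun x => norm_nonneg _)]
    simp only [norm_mul]
    rw [integral_mul_const]
    gcongr
    refine le_trans (le_of_eq ?_) (setIntegral_unitBall_norm_sub_rpow_le hs hy.le)
    refine integral_congr_ae (.of_forall fun x => ?_)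
    simp only [norm_sub_rev x y]
    exact Real.norm_of_nonneg (by positivity)

theorem integrable_prod_riesz_mul_fst {s : ℝ} (hs : s < 2) {q : ℂ → ℝ}
    (hq : IntegrableOn q (ball 0 1)) :
    Integrable (fun p : ℂ × ℂ => ‖p.1 - p.2‖ ^ (-s) * q p.1)
      ((volume.restrict (ball (0 : ℂ) 1)).prod (volume.restrict (ball (0 : ℂ) 1))) := by
  refine (integrable_prod_riesz_mul_snd hs hq).swap.congr (.of_forall fun p => ?_)
  simp [norm_sub_rev p.2]

theorem integrable_prod_diskGreen_mul_mul {g h : ℂ → ℝ}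
    (hg : MemLp g 2 (volume.restrict (ball 0 1))) (hh : MemLp h 2 (volume.restrict (ball 0 1))) :
    Integrable (fun p : ℂ × ℂ => diskGreen p.1 p.2 * g p.2 * h p.1)
      ((volume.restrict (ball (0 : ℂ) 1)).prod (volume.restrict (ball (0 : ℂ) 1))) := by
  refine Integrable.mono' ((integrable_prod_riesz_mul_snd (s := 1 / 2) (by norm_num)
    (hg.integrable_sq)).add (integrable_prod_riesz_mul_fst (s := 1 / 2) (by norm_num)
    (hh.integrable_sq))) ?_ ?_
  · exact (measurable_diskGreen.aestronglyMeasurable.mul hg.aestronglyMeasurable.comp_snd).mul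
      hh.aestronglyMeasurable.comp_fst
  · filter_upwards [ae_prod_mem_unitBall] with p hp
    rw [Pi.add_apply, ← mul_add, norm_mul, norm_mul,
      Real.norm_of_nonneg (diskGreen_nonneg hp.1.le hp.2.le), mul_assoc]
    refine mul_le_mul (diskGreen_le_rpow hp.1.le hp.2.le) ?_ (by positivity) (by positivity)
    rw [Real.norm_eq_abs, Real.norm_eq_abs, ← sq_abs (g p.2), ← sq_abs (h p.1)]
    nlinarith [sq_nonneg (|g p.2| - |h p.1|), abs_nonneg (g p.2), abs_nonneg (h p.1)]

theorem diskGreen_sq_le {x y : ℂ} (hx : ‖x‖ ≤ 1) (hy : ‖y‖ ≤ 1) :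
    diskGreen x y ^ 2 ≤ ‖x - y‖ ^ (-(1 : ℝ)) := by
  calc diskGreen x y ^ 2 ≤ (‖x - y‖ ^ (-(1 / 2) : ℝ)) ^ 2 := by
        gcongr
        · exact diskGreen_nonneg hx hy
        · exact diskGreen_le_rpow hx hy
    _ = ‖x - y‖ ^ (-(1 : ℝ)) := by
        rw [← Real.rpow_mul_natCast (norm_nonneg _)]
        norm_num

theorem memLp_diskGreen {x : ℂ} (hx : ‖x‖ ≤ 1) :
    MemLp (diskGreen x) 2 (volume.restrict (ball 0 1)) := by
  have hm : Measurable (fun y => diskGreen x y) := measurable_diskGreen.of_uncurry_left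
  rw [memLp_two_iff_integrable_sq hm.aestronglyMeasurable]
  have hI : Integrable (fun y => ‖x - y‖ ^ (-(1 : ℝ))) (volume.restrict (ball (0 : ℂ) 1)) :=
    integrableOn_unitBall_norm_sub_rpow (by norm_num) hx
  refine hI.mono' (by fun_prop) ?_
  filter_upwards [ae_mem_unitBall] with y hy
  rw [Real.norm_of_nonneg (sq_nonneg _)]
  exact diskGreen_sq_le hx hy.le

/-- The quantity `1 - |(x - y) / (1 - x ȳ)|²`. -/
noncomputable def diskRatio (x y : ℂ) : ℝ :=
  (1 - ‖x‖ ^ 2) * (1 - ‖y‖ ^ 2) / ‖1 - x * starRingEnd ℂ y‖ ^ 2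

theorem measurable_diskRatio : Measurable (fun p : ℂ × ℂ => diskRatio p.1 p.2) := by
  unfold diskRatio
  fun_prop

theorem one_sub_mul_conj_ne_zero {x y : ℂ} (hx : ‖x‖ < 1) (hy : ‖y‖ ≤ 1) :
    1 - x * starRingEnd ℂ y ≠ 0 := by
  intro h
  have h1 : ‖x * starRingEnd ℂ y‖ = 1 := by rw [← sub_eq_zero.1 h]; simp
  rw [norm_mul, RCLike.norm_conj] at h1
  nlinarith [norm_nonneg x, norm_nonneg y]

theorem diskRatio_nonneg {x y : ℂ} (hx : ‖x‖ < 1) (hy : ‖y‖ < 1) : 0 ≤ diskRatio x y := by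
  have h1 : 0 ≤ 1 - ‖x‖ ^ 2 := by nlinarith [norm_nonneg x]
  have h2 : 0 ≤ 1 - ‖y‖ ^ 2 := by nlinarith [norm_nonneg y]
  unfold diskRatio
  positivity

theorem one_sub_diskRatio {x y : ℂ} (hx : ‖x‖ < 1) (hy : ‖y‖ < 1) :
    1 - diskRatio x y = (‖x - y‖ / ‖1 - x * starRingEnd ℂ y‖) ^ 2 := by
  have h := norm_ne_zero_iff.2 (one_sub_mul_conj_ne_zero hx hy.le)
  have h1 := normSq_one_sub_mul_conj x y
  unfold diskRatio
  field_simp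
  linarith

theorem diskRatio_le_one {x y : ℂ} (hx : ‖x‖ < 1) (hy : ‖y‖ < 1) : diskRatio x y ≤ 1 := by
  have := one_sub_diskRatio hx hy
  nlinarith [sq_nonneg (‖x - y‖ / ‖1 - x * starRingEnd ℂ y‖)]

theorem hasSum_diskGreen {x y : ℂ} (hx : ‖x‖ < 1) (hy : ‖y‖ < 1) (h : x ≠ y) :
    HasSum (fun n : ℕ => diskRatio x y ^ (n + 1) / (n + 1)) (4 * π * diskGreen x y) := by
  have h0 : 0 < ‖x - y‖ := norm_pos_iff.2 (sub_ne_zero.2 h)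
  have h1 := norm_pos_iff.2 (one_sub_mul_conj_ne_zero hx hy.le)
  have h2 := one_sub_diskRatio hx hy
  have h3 : diskRatio x y < 1 := by
    have : 0 < (‖x - y‖ / ‖1 - x * starRingEnd ℂ y‖) ^ 2 := by positivity
    linarith
  have h4 := Real.hasSum_pow_div_log_of_abs_lt_one (x := diskRatio x y)
    (by rw [abs_of_nonneg (diskRatio_nonneg hx hy)]; exact h3)
  convert h4 using 1
  rw [h2, Real.log_pow, diskGreen, ← inv_div ‖x - y‖, Real.log_inv]
  field_simp
  push_cast
  ring

theorem norm_geom_sum_mul_conj_sq_le {x y : ℂ} (hx : ‖x‖ < 1) (hy : ‖y‖ < 1) (N : ℕ) :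
    (1 - ‖x‖ ^ 2) * (1 - ‖y‖ ^ 2) * ‖∑ n ∈ Finset.range N, (x * starRingEnd ℂ y) ^ n‖ ^ 2 ≤ 1 := by
  have hr0 : 0 ≤ ‖x‖ * ‖y‖ := by positivity
  have hr : ‖x‖ * ‖y‖ < 1 := by nlinarith [norm_nonneg x, norm_nonneg y]
  have h1 : ‖∑ n ∈ Finset.range N, (x * starRingEnd ℂ y) ^ n‖ ≤ (1 - ‖x‖ * ‖y‖)⁻¹ := by
    calc ‖∑ n ∈ Finset.range N, (x * starRingEnd ℂ y) ^ n‖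
        ≤ ∑ n ∈ Finset.range N, (‖x‖ * ‖y‖) ^ n := by
          refine (norm_sum_le _ _).trans (le_of_eq ?_)
          simp [mul_pow]
      _ ≤ ∑' n : ℕ, (‖x‖ * ‖y‖) ^ n :=
          (summable_geometric_of_lt_one hr0 hr).sum_le_tsum _ fun _ _ => by positivity
      _ = _ := tsum_geometric_of_lt_one hr0 hr
  have h2 : (1 - ‖x‖ ^ 2) * (1 - ‖y‖ ^ 2) ≤ (1 - ‖x‖ * ‖y‖) ^ 2 := by
    nlinarith [sq_nonneg (‖x‖ - ‖y‖)]
  have h3 : 0 < 1 - ‖x‖ * ‖y‖ := by linarith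
  calc _ ≤ (1 - ‖x‖ * ‖y‖) ^ 2 * ((1 - ‖x‖ * ‖y‖)⁻¹) ^ 2 := by gcongr
    _ = 1 := by field_simp

theorem diskRatio_form_nonneg (k : ℕ) : ∀ w : ℂ → ℂ, IntegrableOn w (ball 0 1) →
    0 ≤ (∫ p : ℂ × ℂ, ((diskRatio p.1 p.2 ^ k : ℝ) : ℂ) * (w p.1 * starRingEnd ℂ (w p.2))
      ∂((volume.restrict (ball 0 1)).prod (volume.restrict (ball 0 1)))).re := by
  have hprod : ∀ w : ℂ → ℂ, IntegrableOn w (ball 0 1) →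
      Integrable (fun p : ℂ × ℂ => w p.1 * starRingEnd ℂ (w p.2))
        ((volume.restrict (ball 0 1)).prod (volume.restrict (ball 0 1))) := fun w hw =>
    Integrable.mul_prod hw
      ((RCLike.conjLIE (K := ℂ)).toContinuousLinearEquiv.integrable_comp_iff.2 hw)
  have hm : ∀ k : ℕ, Measurable (fun p : ℂ × ℂ => ((diskRatio p.1 p.2 ^ k : ℝ) : ℂ)) := fun k =>
    Complex.measurable_ofReal.comp (measurable_diskRatio.pow_const k)
  have hle : ∀ k : ℕ, ∀ᵐ p : ℂ × ℂ
      ∂((volume.restrict (ball (0 : ℂ) 1)).prod (volume.restrict (ball (0 : ℂ) 1))),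
      ‖((diskRatio p.1 p.2 ^ k : ℝ) : ℂ)‖ ≤ 1 := fun k => by
    filter_upwards [ae_prod_mem_unitBall] with p hp
    rw [Complex.norm_real, Real.norm_of_nonneg (pow_nonneg (diskRatio_nonneg hp.1 hp.2) k)]
    exact pow_le_one₀ (diskRatio_nonneg hp.1 hp.2) (diskRatio_le_one hp.1 hp.2)
  induction k with
  | zero =>
    intro w hw
    simp only [pow_zero, Complex.ofReal_one, one_mul]
    rw [integral_prod_mul w (fun y => starRingEnd ℂ (w y)), integral_conj, Complex.mul_conj,
      Complex.ofReal_re]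
    exact Complex.normSq_nonneg _
  | succ k ih =>
    intro w hw
    set W : ℕ → ℕ → ℂ → ℂ := fun n m x =>
      ((1 - ‖x‖ ^ 2 : ℝ) : ℂ) * x ^ n * starRingEnd ℂ x ^ m * w x with hW
    have hWint : ∀ n m, IntegrableOn (W n m) (ball 0 1) := by
      intro n m
      refine Integrable.bdd_mul (c := 1) hw (Measurable.aestronglyMeasurable (by fun_prop)) ?_
      filter_upwards [ae_mem_unitBall] with x hx
      rw [norm_mul, norm_mul, norm_pow, norm_pow, RCLike.norm_conj, Complex.norm_real,
        Real.norm_of_nonneg (by nlinarith [norm_nonneg x])]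
      have h1 := pow_le_one₀ (n := n) (norm_nonneg x) hx.le
      have h2 := pow_le_one₀ (n := m) (norm_nonneg x) hx.le
      have h3 : 1 - ‖x‖ ^ 2 ≤ 1 := by nlinarith [norm_nonneg x]
      exact mul_le_one₀ (mul_le_one₀ h3 (by positivity) h1) (by positivity) h2
    set T : ℕ → ℂ × ℂ → ℂ := fun N p => ((diskRatio p.1 p.2 ^ k : ℝ) : ℂ) *
      ((((1 - ‖p.1‖ ^ 2) * (1 - ‖p.2‖ ^ 2) *
        ‖∑ n ∈ Finset.range N, (p.1 * starRingEnd ℂ p.2) ^ n‖ ^ 2 : ℝ) : ℂ) *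
        (w p.1 * starRingEnd ℂ (w p.2))) with hT
    have hTW : ∀ N p, T N p = ∑ n ∈ Finset.range N, ∑ m ∈ Finset.range N,
        ((diskRatio p.1 p.2 ^ k : ℝ) : ℂ) * (W n m p.1 * starRingEnd ℂ (W n m p.2)) := by
      intro N p
      simp only [hT, hW, ← Finset.mul_sum]
      congr 1
      have h1 : ((‖∑ n ∈ Finset.range N, (p.1 * starRingEnd ℂ p.2) ^ n‖ ^ 2 : ℝ) : ℂ) =
          ∑ n ∈ Finset.range N, ∑ m ∈ Finset.range N, (p.1 * starRingEnd ℂ p.2) ^ n *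
            starRingEnd ℂ ((p.1 * starRingEnd ℂ p.2) ^ m) := by
        rw [← Finset.sum_mul_sum, ← map_sum, Complex.mul_conj, Complex.normSq_eq_norm_sq]
      rw [Complex.ofReal_mul, h1, Finset.mul_sum, Finset.sum_mul]
      refine Finset.sum_congr rfl fun n _ => ?_
      rw [Finset.mul_sum, Finset.sum_mul]
      refine Finset.sum_congr rfl fun m _ => ?_
      simp only [map_mul, map_pow, Complex.conj_conj, Complex.conj_ofReal, mul_pow,
        Complex.ofReal_mul]
      ring
    have hpos : ∀ N, 0 ≤ (∫ p, T N p
        ∂((volume.restrict (ball (0 : ℂ) 1)).prod (volume.restrict (ball (0 : ℂ) 1)))).re := by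
      intro N
      simp only [hTW]
      have hi : ∀ n m, Integrable (fun p : ℂ × ℂ => ((diskRatio p.1 p.2 ^ k : ℝ) : ℂ) *
          (W n m p.1 * starRingEnd ℂ (W n m p.2)))
          ((volume.restrict (ball (0 : ℂ) 1)).prod (volume.restrict (ball (0 : ℂ) 1))) :=
        fun n m => (hprod _ (hWint n m)).bdd_mul (hm k).aestronglyMeasurable (hle k)
      rw [integral_finsetSum _ fun n _ => integrable_finsetSum _ fun m _ => hi n m, Complex.re_sum]
      refine Finset.sum_nonneg fun n _ => ?_
      rw [integral_finsetSum _ fun m _ => hi n m, Complex.re_sum]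
      exact Finset.sum_nonneg fun m _ => ih _ (hWint n m)
    have hlim : Tendsto (fun N => ∫ p, T N p
        ∂((volume.restrict (ball (0 : ℂ) 1)).prod (volume.restrict (ball (0 : ℂ) 1)))) atTop
        (𝓝 (∫ p : ℂ × ℂ, ((diskRatio p.1 p.2 ^ (k + 1) : ℝ) : ℂ) * (w p.1 * starRingEnd ℂ (w p.2))
      ∂((volume.restrict (ball 0 1)).prod (volume.restrict (ball 0 1))))) := by
      refine tendsto_integral_of_dominated_convergence
        (fun p => ‖w p.1 * starRingEnd ℂ (w p.2)‖) (fun N => ?_) (hprod w hw).norm (fun N => ?_) ?_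
      · exact (hm k).aestronglyMeasurable.mul ((Measurable.aestronglyMeasurable (by fun_prop)).mul
          (hprod w hw).aestronglyMeasurable)
      · filter_upwards [ae_prod_mem_unitBall, hle k] with p hp hk
        have h1 : 0 ≤ 1 - ‖p.1‖ ^ 2 := by nlinarith [norm_nonneg p.1]
        have h2 : 0 ≤ 1 - ‖p.2‖ ^ 2 := by nlinarith [norm_nonneg p.2]
        rw [hT, norm_mul, norm_mul, Complex.norm_real (_ * _),
          Real.norm_of_nonneg (mul_nonneg (mul_nonneg h1 h2) (sq_nonneg _))]
        refine mul_le_of_le_one_left (by positivity) hk |>.trans ?_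
        exact mul_le_of_le_one_left (by positivity) (norm_geom_sum_mul_conj_sq_le hp.1 hp.2 N)
      · filter_upwards [ae_prod_mem_unitBall] with p hp
        have h1 : ‖p.1 * starRingEnd ℂ p.2‖ < 1 := by
          rw [norm_mul, RCLike.norm_conj]; nlinarith [norm_nonneg p.1, norm_nonneg p.2, hp.1, hp.2]
        have h2 := (hasSum_geometric_of_norm_lt_one h1).tendsto_sum_nat
        have h3 := (((h2.norm.pow 2).const_mul
          ((1 - ‖p.1‖ ^ 2) * (1 - ‖p.2‖ ^ 2))).ofReal.mul_const (w p.1 * starRingEnd ℂ (w p.2))).const_mul ((diskRatio p.1 p.2 ^ k : ℝ) : ℂ)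
        convert h3 using 2
        rw [pow_succ, Complex.ofReal_mul, mul_assoc, diskRatio, norm_inv, inv_pow, div_eq_mul_inv]
    exact ge_of_tendsto' ((Complex.continuous_re.tendsto _).comp hlim) hpos

theorem diskRatio_form_nonneg_real (k : ℕ) {h : ℂ → ℝ} (hh : IntegrableOn h (ball 0 1)) :
    0 ≤ ∫ p : ℂ × ℂ, diskRatio p.1 p.2 ^ k * (h p.1 * h p.2)
      ∂((volume.restrict (ball 0 1)).prod (volume.restrict (ball 0 1))) := by
  have h1 := diskRatio_form_nonneg k (fun x => (h x : ℂ)) hh.ofReal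
  simp only [Complex.conj_ofReal, ← Complex.ofReal_mul] at h1
  rwa [integral_complex_ofReal, Complex.ofReal_re] at h1

theorem ae_prod_ne {μ : Measure ℂ} [SFinite μ] [NullSingletonClass μ] :
    ∀ᵐ p ∂(μ.prod μ), p.1 ≠ p.2 := by
  have hms : MeasurableSet {p : ℂ × ℂ | p.1 ≠ p.2} :=
    (measurableSet_eq_fun measurable_fst measurable_snd).compl
  rw [Measure.ae_prod_iff_ae_ae hms]
  refine .of_forall fun x => ?_
  filter_upwards [compl_mem_ae_iff.2 (measure_singleton (μ := μ) x)] with y hy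
  exact fun h => hy h.symm

instance isFiniteMeasure_restrict_unitBall :
    IsFiniteMeasure (volume.restrict (ball (0 : ℂ) 1)) :=
  isFiniteMeasure_restrict.2 measure_ball_lt_top.ne

theorem diskGreen_form_nonneg {h : ℂ → ℝ} (hh : MemLp h 2 (volume.restrict (ball 0 1))) :
    0 ≤ ∫ p : ℂ × ℂ, diskGreen p.1 p.2 * h p.2 * h p.1
      ∂((volume.restrict (ball 0 1)).prod (volume.restrict (ball 0 1))) := by
  have hI := integrable_prod_diskGreen_mul_mul hh hh
  have hh1 : IntegrableOn h (ball 0 1) := hh.integrable one_le_two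
  have hlim : Tendsto (fun N : ℕ => ∫ p : ℂ × ℂ, ∑ n ∈ Finset.range N,
      (1 / (n + 1 : ℝ)) * (diskRatio p.1 p.2 ^ (n + 1) * (h p.1 * h p.2))
      ∂((volume.restrict (ball 0 1)).prod (volume.restrict (ball 0 1)))) atTop
      (𝓝 (∫ p : ℂ × ℂ, (4 * π) * (diskGreen p.1 p.2 * h p.2 * h p.1)
      ∂((volume.restrict (ball 0 1)).prod (volume.restrict (ball 0 1))))) := by
    refine tendsto_integral_of_dominated_convergence
      (fun p => ‖(4 * π) * (diskGreen p.1 p.2 * h p.2 * h p.1)‖) (fun N => ?_)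
      (hI.const_mul _).norm (fun N => ?_) ?_
    · refine Finset.aestronglyMeasurable_fun_sum _ fun n _ => ?_
      exact ((measurable_diskRatio.pow_const _).aestronglyMeasurable.mul
        (hh1.aestronglyMeasurable.comp_fst.mul hh1.aestronglyMeasurable.comp_snd)).const_mul _
    · filter_upwards [ae_prod_mem_unitBall, ae_prod_ne] with p hp hne
      have h1 := hasSum_diskGreen hp.1 hp.2 hne
      have h0 := diskRatio_nonneg hp.1 hp.2
      have h2 := sum_le_hasSum (Finset.range N) (fun n _ => by positivity) h1
      calc _ = ‖(∑ n ∈ Finset.range N, diskRatio p.1 p.2 ^ (n + 1) / (n + 1)) *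
              (h p.1 * h p.2)‖ := by
            rw [Finset.sum_mul]
            congr 1
            refine Finset.sum_congr rfl fun n _ => ?_
            ring
        _ ≤ ‖4 * π * diskGreen p.1 p.2‖ * ‖h p.1 * h p.2‖ := by
            rw [norm_mul]
            gcongr
            rw [Real.norm_of_nonneg (Finset.sum_nonneg fun n _ => by positivity)]
            exact h2.trans (le_abs_self _)
        _ = _ := by rw [← norm_mul]; congr 1; ring
    · filter_upwards [ae_prod_mem_unitBall, ae_prod_ne] with p hp hne
      have h1 := (hasSum_diskGreen hp.1 hp.2 hne).tendsto_sum_nat.mul_const (h p.1 * h p.2)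
      convert h1 using 1
      · ext N
        rw [Finset.sum_mul]
        refine Finset.sum_congr rfl fun n _ => ?_
        ring
      · congr 1; ring
  have h4 : 0 ≤ ∫ p : ℂ × ℂ, (4 * π) * (diskGreen p.1 p.2 * h p.2 * h p.1)
      ∂((volume.restrict (ball 0 1)).prod (volume.restrict (ball 0 1))) := by
    refine ge_of_tendsto' hlim fun N => ?_
    rw [integral_finsetSum]
    · refine Finset.sum_nonneg fun n _ => ?_
      rw [integral_const_mul]
      exact mul_nonneg (by positivity) (diskRatio_form_nonneg_real _ hh1)
    · intro n _
      refine ((Integrable.bdd_mul (c := 1) (hh1.mul_prod hh1)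
        (measurable_diskRatio.pow_const _).aestronglyMeasurable ?_)).const_mul _
      filter_upwards [ae_prod_mem_unitBall] with p hp
      rw [Real.norm_of_nonneg (pow_nonneg (diskRatio_nonneg hp.1 hp.2) _)]
      exact pow_le_one₀ (diskRatio_nonneg hp.1 hp.2) (diskRatio_le_one hp.1 hp.2)
  rw [integral_const_mul] at h4
  exact nonneg_of_mul_nonneg_right h4 (by positivity)

theorem measurable_diskGreen_comp {X : Type*} [MeasurableSpace X] {u v : X → ℂ}
    (hu : Measurable u) (hv : Measurable v) : Measurable fun p => diskGreen (u p) (v p) := by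
  change Measurable (Function.uncurry diskGreen ∘ fun p => (u p, v p))
  exact measurable_diskGreen.comp (hu.prodMk hv)

/-- The right half of the open unit disk. -/
def halfDisk : Set ℂ := {x | ‖x‖ < 1 ∧ 0 < x.re}

theorem isOpen_halfDisk : IsOpen halfDisk :=
  (isOpen_lt continuous_norm continuous_const).inter
    (isOpen_lt continuous_const Complex.continuous_re)

theorem measurableSet_halfDisk : MeasurableSet halfDisk := isOpen_halfDisk.measurableSet

theorem halfDisk_subset_ball : halfDisk ⊆ ball 0 1 := fun x hx => by simpa using hx.1

instance isFiniteMeasure_restrict_halfDisk : IsFiniteMeasure (volume.restrict halfDisk) :=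
  isFiniteMeasure_restrict.2
    ((measure_mono halfDisk_subset_ball).trans_lt measure_ball_lt_top).ne

/-- The extension of a function on the half disk which is odd under `reflect`. -/
noncomputable def oddExtension (g : ℂ → ℝ) (x : ℂ) : ℝ :=
  halfDisk.indicator g x - halfDisk.indicator g (reflect x)

theorem oddExtension_reflect (g : ℂ → ℝ) (x : ℂ) :
    oddExtension g (reflect x) = -oddExtension g x := by
  simp [oddExtension]

theorem reflect_notMem_halfDisk {x : ℂ} (hx : x ∈ halfDisk) : reflect x ∉ halfDisk := fun h => by
  have h1 := hx.2
  have h2 := h.2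
  rw [reflect_re] at h2
  linarith

theorem oddExtension_of_mem (g : ℂ → ℝ) {x : ℂ} (hx : x ∈ halfDisk) : oddExtension g x = g x := by
  simp [oddExtension, hx, reflect_notMem_halfDisk hx]

theorem comp_oddExtension {f : ℝ → ℝ} (hf : ∀ s, f (-s) = -f s) (g : ℂ → ℝ) (x : ℂ) :
    f (oddExtension g x) = oddExtension (fun y => f (g y)) x := by
  have hf0 : f 0 = 0 := by have := hf 0; rw [neg_zero] at this; linarith
  by_cases h1 : x ∈ halfDisk
  · rw [oddExtension_of_mem _ h1, oddExtension_of_mem _ h1]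
  · by_cases h2 : reflect x ∈ halfDisk <;> simp [oddExtension, h1, h2, hf, hf0]

theorem memLp_oddExtension {g : ℂ → ℝ} {q : ℝ≥0∞} (hg : MemLp g q (volume.restrict halfDisk)) :
    MemLp (oddExtension g) q volume := by
  have h1 := (memLp_indicator_iff_restrict measurableSet_halfDisk).2 hg
  exact h1.sub (h1.comp_measurePreserving measurePreserving_reflect)

theorem setIntegral_mul_oddExtension {F g : ℂ → ℝ} (h1 : IntegrableOn (fun y => F y * g y) halfDisk)
    (h2 : IntegrableOn (fun y => F (reflect y) * g y) halfDisk) :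
    ∫ y in ball 0 1, F y * oddExtension g y =
      ∫ y in halfDisk, (F y - F (reflect y)) * g y := by
  have e1 : ∀ y, F y * oddExtension g y = halfDisk.indicator (fun y => F y * g y) y -
      halfDisk.indicator (fun y => F (reflect y) * g y) (reflect y) := by
    intro y
    by_cases h1 : y ∈ halfDisk <;> by_cases h2 : reflect y ∈ halfDisk <;>
      simp [oddExtension, h1, h2, mul_sub]
  have i1 := (integrable_indicator_iff measurableSet_halfDisk).2 h1
  have i2 := (integrable_indicator_iff measurableSet_halfDisk).2 h2
  rw [setIntegral_eq_integral_of_forall_compl_eq_zero]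
  · simp only [e1]
    have i3 : Integrable fun x => halfDisk.indicator (fun y => F (reflect y) * g y) (reflect x) :=
      measurePreserving_reflect.integrable_comp_of_integrable i2
    rw [integral_sub i1 i3,
      measurePreserving_reflect.integral_comp measurableEmbedding_reflect,
      integral_indicator measurableSet_halfDisk, integral_indicator measurableSet_halfDisk,
      ← integral_sub h1 h2]
    simp only [sub_mul]
  · intro x hx
    have h1 : x ∉ halfDisk := fun h => hx (halfDisk_subset_ball h)
    have h2 : reflect x ∉ halfDisk := fun h => hx (by simpa using halfDisk_subset_ball h)
    simp [oddExtension, h1, h2]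

theorem memLp_diskGreen_halfDisk {x : ℂ} (hx : ‖x‖ ≤ 1) :
    MemLp (diskGreen x) 2 (volume.restrict halfDisk) :=
  (memLp_diskGreen hx).mono_measure (Measure.restrict_mono halfDisk_subset_ball le_rfl)

theorem integrableOn_diskGreen_mul {x : ℂ} (hx : ‖x‖ ≤ 1) {g : ℂ → ℝ}
    (hg : MemLp g 2 (volume.restrict halfDisk)) :
    IntegrableOn (fun y => diskGreen x y * g y) halfDisk :=
  (memLp_diskGreen_halfDisk hx).integrable_mul hg

theorem integrableOn_diskGreen_reflect_mul {x : ℂ} (hx : ‖x‖ ≤ 1) {g : ℂ → ℝ}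
    (hg : MemLp g 2 (volume.restrict halfDisk)) :
    IntegrableOn (fun y => diskGreen x (reflect y) * g y) halfDisk := by
  simp only [← diskGreen_reflect]
  exact integrableOn_diskGreen_mul (by simpa using hx) hg

/-- The Green potential in the unit disk of the odd extension of `g`. -/
noncomputable def greenPotential (g : ℂ → ℝ) (x : ℂ) : ℝ :=
  ∫ y in ball 0 1, diskGreen x y * oddExtension g y

theorem greenPotential_eq {x : ℂ} (hx : ‖x‖ ≤ 1) {g : ℂ → ℝ}
    (hg : MemLp g 2 (volume.restrict halfDisk)) :
    greenPotential g x = ∫ y in halfDisk, (diskGreen x y - diskGreen x (reflect y)) * g y :=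
  setIntegral_mul_oddExtension (integrableOn_diskGreen_mul hx hg)
    (integrableOn_diskGreen_reflect_mul hx hg)

theorem greenPotential_reflect {x : ℂ} (hx : ‖x‖ ≤ 1) {g : ℂ → ℝ}
    (hg : MemLp g 2 (volume.restrict halfDisk)) :
    greenPotential g (reflect x) = -greenPotential g x := by
  rw [greenPotential_eq hx hg, greenPotential_eq (by simpa using hx) hg, ← integral_neg]
  simp only [diskGreen_reflect, reflect_reflect]
  congr 1 with y
  ring

/-- The Green function of the half disk, obtained by reflection. -/
noncomputable def halfDiskGreen (x y : ℂ) : ℝ :=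
  halfDisk.indicator (fun x => halfDisk.indicator
    (fun y => max 0 (diskGreen x y - diskGreen x (reflect y))) y) x

theorem halfDiskGreen_eq {x y : ℂ} (hx : x ∈ halfDisk) (hy : y ∈ halfDisk) (h : x ≠ y) :
    halfDiskGreen x y = diskGreen x y - diskGreen x (reflect y) := by
  simp only [halfDiskGreen, hx, hy, indicator_of_mem]
  exact max_eq_right (sub_nonneg.2 (diskGreen_reflect_le hx.1.le hy.1.le hx.2 hy.2 h))

theorem halfDiskGreen_of_notMem_left {x : ℂ} (hx : x ∉ halfDisk) (y : ℂ) :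
    halfDiskGreen x y = 0 := by
  simp [halfDiskGreen, hx]

theorem ae_halfDiskGreen_eq {x : ℂ} (hx : x ∈ halfDisk) : ∀ᵐ y ∂(volume.restrict halfDisk),
    halfDiskGreen x y = diskGreen x y - diskGreen x (reflect y) := by
  filter_upwards [ae_restrict_mem measurableSet_halfDisk,
    compl_mem_ae_iff.2 (measure_singleton (μ := volume.restrict halfDisk) x)] with y hy hne
  exact halfDiskGreen_eq hx hy fun h => hne h.symm

theorem integral_halfDiskGreen_mul {x : ℂ} (hx : x ∈ halfDisk) {g : ℂ → ℝ}
    (hg : MemLp g 2 (volume.restrict halfDisk)) :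
    ∫ y in halfDisk, halfDiskGreen x y * g y = greenPotential g x := by
  rw [greenPotential_eq hx.1.le hg]
  refine integral_congr_ae ?_
  filter_upwards [ae_halfDiskGreen_eq hx] with y hy
  rw [hy]

theorem isGreenKernel_halfDiskGreen : IsGreenKernel (volume.restrict halfDisk) halfDiskGreen where
  meas := by
    have h : Function.uncurry halfDiskGreen = (halfDisk ×ˢ halfDisk).indicator
        (fun p : ℂ × ℂ => max 0 (diskGreen p.1 p.2 - diskGreen p.1 (reflect p.2))) := by
      ext p
      by_cases h1 : p.1 ∈ halfDisk <;> by_cases h2 : p.2 ∈ halfDisk <;>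
        simp [halfDiskGreen, Function.uncurry, h1, h2, indicator]
    rw [h]
    refine Measurable.indicator (measurable_const.max ?_)
      (measurableSet_halfDisk.prod measurableSet_halfDisk)
    exact (measurable_diskGreen_comp measurable_fst measurable_snd).sub
      (measurable_diskGreen_comp measurable_fst (continuous_reflect.measurable.comp measurable_snd))
  symm x y := by
    by_cases h1 : x ∈ halfDisk <;> by_cases h2 : y ∈ halfDisk <;> simp only [halfDiskGreen, h1, h2,
      indicator_of_mem, not_false_eq_true, indicator_of_notMem]
    rw [diskGreen_symm x y, ← diskGreen_reflect x y, diskGreen_symm (reflect x)]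
  nonneg x y := by
    refine indicator_nonneg (fun x _ => indicator_nonneg (fun y _ => le_max_left _ _) y) x
  exp_bound α hα hα4 := by
    set s := α / (2 * π) with hs
    have hs2 : s < 2 := by rw [hs, div_lt_iff₀ (by positivity)]; linarith
    set I := ∫ z in ball (0 : ℂ) 2, ‖z‖ ^ (-s) with hI
    refine ⟨max (volume.real halfDisk) (2 ^ s * I), fun x => ?_⟩
    by_cases hx : x ∈ halfDisk
    · refine le_trans ?_ (ENNReal.ofReal_le_ofReal (le_max_right _ _))
      have hInt := integrableOn_unitBall_norm_sub_rpow hs2 hx.1.le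
      calc ∫⁻ y in halfDisk, ENNReal.ofReal (Real.exp (α * halfDiskGreen x y))
          ≤ ∫⁻ y in halfDisk, ENNReal.ofReal (2 ^ s * ‖x - y‖ ^ (-s)) := by
            refine lintegral_mono_ae ?_
            filter_upwards [ae_restrict_mem measurableSet_halfDisk, ae_halfDiskGreen_eq hx,
              compl_mem_ae_iff.2 (measure_singleton (μ := volume.restrict halfDisk) x)]
              with y hy h1 hne
            refine ENNReal.ofReal_le_ofReal (le_trans ?_ (exp_mul_diskGreen_le hα.le hx.1.le hy.1.le
              fun h => hne h.symm))
            rw [h1]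
            have := diskGreen_nonneg (y := reflect y) hx.1.le (by simpa using hy.1.le)
            gcongr
            linarith
        _ ≤ ∫⁻ y in ball 0 1, ENNReal.ofReal (2 ^ s * ‖x - y‖ ^ (-s)) :=
            lintegral_mono_set halfDisk_subset_ball
        _ = ENNReal.ofReal (∫ y in ball 0 1, 2 ^ s * ‖x - y‖ ^ (-s)) := by
            rw [ofReal_integral_eq_lintegral_ofReal (hInt.const_mul _)]
            exact .of_forall fun y => by positivity
        _ ≤ _ := by
            rw [integral_const_mul]
            gcongr
            exact setIntegral_unitBall_norm_sub_rpow_le hs2 hx.1.le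
    · refine le_trans ?_ (ENNReal.ofReal_le_ofReal (le_max_left _ _))
      simp [halfDiskGreen_of_notMem_left hx, Measure.real, ENNReal.ofReal_toReal,
        ((measure_mono halfDisk_subset_ball).trans_lt measure_ball_lt_top).ne]
  pos g hg := by
    have hg' := (memLp_oddExtension hg).restrict (ball (0 : ℂ) 1)
    have h0 := diskGreen_form_nonneg hg'
    have hI := integrable_prod_diskGreen_mul_mul hg' hg'
    rw [integral_prod _ hI] at h0
    simp only [integral_mul_const] at h0
    have hI1 : IntegrableOn (fun x => greenPotential g x * oddExtension g x) (ball 0 1) := by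
      have := hI.integral_prod_left
      simp only [integral_mul_const] at this
      exact this
    have hI2 : IntegrableOn (fun x => greenPotential g x * g x) halfDisk := by
      refine (hI1.mono_set halfDisk_subset_ball).congr_fun (fun x hx => ?_) measurableSet_halfDisk
      simp only [oddExtension_of_mem g hx]
    have h1 : ∫ x in ball 0 1, greenPotential g x * oddExtension g x =
        2 * ∫ x in halfDisk, greenPotential g x * g x := by
      rw [setIntegral_mul_oddExtension hI2, ← integral_const_mul]
      · refine setIntegral_congr_fun measurableSet_halfDisk fun x hx => ?_
        simp only [greenPotential_reflect hx.1.le hg]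
        ring
      · refine hI2.neg.congr_fun (fun x hx => ?_) measurableSet_halfDisk
        simp [greenPotential_reflect hx.1.le hg]
    have h2 : ∫ x in halfDisk, (∫ y in halfDisk, halfDiskGreen x y * g y) * g x =
        ∫ x in halfDisk, greenPotential g x * g x := by
      refine setIntegral_congr_fun measurableSet_halfDisk fun x hx => ?_
      simp only [integral_halfDiskGreen_mul hx hg]
    rw [h2]
    have h3 : 0 ≤ ∫ x in ball 0 1, greenPotential g x * oddExtension g x := h0
    linarith

theorem monotoneOn_primF {f : ℝ → ℝ} (hf : Continuous f)
    (hH2 : ∀ s : ℝ, s ≠ 0 → 0 < primF f s ∧ primF f s ≤ (1/2) * f s * s) :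
    MonotoneOn (primF f) (Ici 0) := by
  refine monotoneOn_of_deriv_nonneg (convex_Ici 0) (continuous_primF hf).continuousOn
    (fun s _ => (hasDerivAt_primF hf s).differentiableAt.differentiableWithinAt) fun s hs => ?_
  rw [interior_Ici, mem_Ioi] at hs
  rw [(hasDerivAt_primF hf s).deriv]
  exact nonneg_of_mul_nonneg_right (mul_self_nonneg_of_superquadratic hH2 s) hs

theorem exists_moser_level_lt {f : ℝ → ℝ} (hf : Continuous f) (hodd : ∀ s : ℝ, f (-s) = - f s)
    (hH2 : ∀ s : ℝ, s ≠ 0 → 0 < primF f s ∧ primF f s ≤ (1/2) * f s * s)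
    (hH3 : Tendsto (fun s : ℝ => s * f s * Real.exp (-(4 * π * s ^ 2))) atTop atTop)
    {C κ : ℝ} (hC : 0 < C) (hκ : 0 < κ) :
    ∃ Λ, ∀ l ≥ Λ, ∃ c < 1 / 2, ∀ t : ℝ,
      1 / 2 * t ^ 2 * ((l + C) / (2 * π)) -
        κ * exp (-(2 * l)) * primF f (t * ((l - C) / (2 * π))) ≤ c := by
  set L := exp (6 * C) / (2 * π * κ) with hL
  have hL0 : 0 < L := by positivity
  obtain ⟨R, hR0, hR⟩ := exists_exp_le_primF hf hH2 hH3 L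
  refine ⟨max 2 (max (6 * C) (3 * C + 2 * π * R ^ 2)), fun l hl => ?_⟩
  have hl2 : 2 ≤ l := (le_max_left _ _).trans hl
  have hl6 : 6 * C ≤ l := (le_max_left _ _).trans ((le_max_right _ _).trans hl)
  have hlR : 3 * C + 2 * π * R ^ 2 ≤ l := (le_max_right _ _).trans ((le_max_right _ _).trans hl)
  set a := (l - C) / (2 * π) with ha
  set b := (l + C) / (2 * π) with hb
  have ha0 : 0 < a := div_pos (by linarith) (by positivity)
  have hb0 : 0 < b := div_pos (by linarith) (by positivity)
  have hab : (l - 3 * C) / (2 * π) ≤ a ^ 2 / b := by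
    rw [le_div_iff₀ hb0, ha, hb, div_pow, div_mul_div_comm, ← sq]
    gcongr
    nlinarith
  have hab' : a ^ 2 / b ≤ l / (2 * π) := by
    rw [div_le_iff₀ hb0, ha, hb, div_pow, div_mul_div_comm, ← sq]
    gcongr
    nlinarith
  have hmono := monotoneOn_primF hf hH2
  have hsq : ∀ t : ℝ, (|t| * a) ^ 2 = t ^ 2 * b * (a ^ 2 / b) := fun t => by
    rw [mul_pow, sq_abs]; field_simp
  set s₁ := √(1 / 2 * (a ^ 2 / b)) with hs₁
  have hs₁0 : 0 < s₁ := Real.sqrt_pos.2 (by positivity)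
  have hF1 : 0 < primF f s₁ := (hH2 s₁ hs₁0.ne').1
  set c := max (1 / 4) (max (1 / 2 - κ * exp (-(2 * l)) * primF f s₁) (1 / 2 - 1 / l)) with hc
  have hc1 : c < 1 / 2 := by
    refine max_lt (by norm_num) (max_lt ?_ ?_)
    · have : 0 < κ * exp (-(2 * l)) * primF f s₁ := by positivity
      linarith
    · have : 0 < 1 / l := by positivity
      linarith
  refine ⟨c, hc1, fun t => ?_⟩
  have hFt : primF f (t * a) = primF f (|t| * a) := by
    rw [← primF_abs hodd (t * a), abs_mul, abs_of_pos ha0]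
  have hF0 := primF_nonneg hH2 (|t| * a)
  rw [hFt]
  set T := t ^ 2 * b with hT
  have hT' : 1 / 2 * t ^ 2 * b = T / 2 := by rw [hT]; ring
  rw [hT']
  have hs0 : 0 ≤ |t| * a := by positivity
  rcases le_total T (1 / 2) with h1 | h1
  · refine le_trans ?_ (le_max_left _ _)
    have : 0 ≤ κ * exp (-(2 * l)) * primF f (|t| * a) := by positivity
    linarith
  rcases le_total T 1 with h2 | h2
  · refine le_trans ?_ ((le_max_left _ _).trans (le_max_right _ _))
    have h3 : s₁ ≤ |t| * a := by
      refine Real.sqrt_le_iff.2 ⟨hs0, ?_⟩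
      rw [hsq]
      gcongr
    have h4 : primF f s₁ ≤ primF f (|t| * a) := hmono hs₁0.le hs0 h3
    have : κ * exp (-(2 * l)) * primF f s₁ ≤ κ * exp (-(2 * l)) * primF f (|t| * a) := by gcongr
    linarith
  · refine le_trans ?_ ((le_max_right _ _).trans (le_max_right _ _))
    have hTpos : 0 < T := by linarith
    have hR' : R ≤ |t| * a := by
      refine le_of_sq_le_sq ?_ hs0
      rw [hsq]
      have h3 : R ^ 2 ≤ (l - 3 * C) / (2 * π) := by
        rw [le_div_iff₀ (by positivity)]; linarith
      have h4 : 0 ≤ a ^ 2 / b := by positivity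
      nlinarith
    have h5 := hR _ hR'
    rw [hsq] at h5
    have h6 : L * exp (2 * T * (l - 3 * C)) / (T * (l / (2 * π))) ≤ primF f (|t| * a) := by
      refine le_trans ?_ h5
      refine div_le_div₀ (by positivity) (mul_le_mul_of_nonneg_left (exp_le_exp.2 ?_) hL0.le)
        (by positivity) (by gcongr)
      have : 4 * π * (T * ((l - 3 * C) / (2 * π))) ≤ 4 * π * (T * (a ^ 2 / b)) := by gcongr
      refine le_trans (le_of_eq ?_) this
      field_simp
      ring
    set x := T - 1 with hx
    have hx0 : 0 ≤ x := by linarith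
    have h7 : (1 + x) * (1 + l * x / 2) ≤ exp (2 * x * (l - 3 * C)) := by
      calc (1 + x) * (1 + l * x / 2) ≤ (1 + l * x / 2) ^ 2 := by
            rw [sq]
            refine mul_le_mul_of_nonneg_right ?_ (by positivity)
            nlinarith
        _ ≤ exp (l * x / 2) ^ 2 := by
            gcongr
            linarith [add_one_le_exp (l * x / 2)]
        _ = exp (l * x) := by rw [← exp_nat_mul]; congr 1; push_cast; ring
        _ ≤ _ := exp_le_exp.2 (by nlinarith)
    have h8 : 1 / l + x / 2 ≤ κ * exp (-(2 * l)) * primF f (|t| * a) := by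
      calc 1 / l + x / 2 = (1 + x) * (1 + l * x / 2) / ((1 + x) * l) := by
            field_simp
        _ ≤ exp (2 * x * (l - 3 * C)) / ((1 + x) * l) := by gcongr
        _ = κ * exp (-(2 * l)) * (L * exp (2 * T * (l - 3 * C)) / (T * (l / (2 * π)))) := by
            have e1 : exp (2 * x * (l - 3 * C)) =
                exp (-(2 * l)) * exp (6 * C) * exp (2 * T * (l - 3 * C)) := by
              rw [← exp_add, ← exp_add]; congr 1; rw [hx]; ring
            have e2 : 1 + x = T := by rw [hx]; ring
            rw [e1, e2, hL]
            field_simp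
        _ ≤ _ := by gcongr
    linarith

namespace IsGreenKernel

variable {X : Type*} [MeasurableSpace X] {μ : Measure X} {k : X → X → ℝ}

theorem integral_mul_eq_inner_vec (hk : IsGreenKernel μ k) {φ : X → ℝ} (hφ : MemLp φ 2 μ) (x : X) :
    ∫ y, k x y * φ y ∂μ = ⟪hk.vec x, hφ.toLp φ⟫ := by
  rw [inner_vec]
  refine integral_congr_ae ?_
  filter_upwards [hφ.coeFn_toLp] with y hy
  rw [hy]

theorem integrable_comp_potential [IsFiniteMeasure μ] (hk : IsGreenKernel μ k) {φ : X → ℝ}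
    (hφ : MemLp φ 2 μ)
    {F : ℝ → ℝ} (hF : Continuous F) : Integrable (fun x => F (∫ y, k x y * φ y ∂μ)) μ := by
  obtain ⟨C, hC0, hC⟩ := hk.exists_norm_vec_le
  obtain ⟨M, hM⟩ := (isCompact_Icc (a := -(C * ‖hφ.toLp φ‖))
    (b := C * ‖hφ.toLp φ‖)).exists_bound_of_continuousOn hF.continuousOn
  simp only [hk.integral_mul_eq_inner_vec hφ]
  refine Integrable.of_bound
    (hF.comp_stronglyMeasurable (hk.stronglyMeasurable_inner_vec _)).aestronglyMeasurable M
    (.of_forall fun x => hM _ (abs_le.1 ((abs_real_inner_le_norm _ _).trans ?_)))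
  gcongr
  exact hC x

theorem measureReal_mul_primF_le [IsFiniteMeasure μ] (hk : IsGreenKernel μ k) {f : ℝ → ℝ}
    (hf : Continuous f)
    (hodd : ∀ s : ℝ, f (-s) = - f s)
    (hH2 : ∀ s : ℝ, s ≠ 0 → 0 < primF f s ∧ primF f s ≤ (1/2) * f s * s)
    {φ : X → ℝ} (hφ : MemLp φ 2 μ) {S : Set X} (hS : MeasurableSet S) {a : ℝ} (ha : 0 ≤ a)
    (haS : ∀ x ∈ S, a ≤ ∫ y, k x y * φ y ∂μ) (t : ℝ) :
    μ.real S * primF f (t * a) ≤ ∫ x, primF f (t * ∫ y, k x y * φ y ∂μ) ∂μ := by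
  have hi := hk.integrable_comp_potential hφ
    (F := fun s => primF f (t * s)) ((continuous_primF hf).comp (continuous_const_mul t))
  have h1 : ∫ x in S, primF f (t * ∫ y, k x y * φ y ∂μ) ∂μ ≤
      ∫ x, primF f (t * ∫ y, k x y * φ y ∂μ) ∂μ :=
    setIntegral_le_integral hi (.of_forall fun x => primF_nonneg hH2 _)
  refine le_trans ?_ h1
  rw [← smul_eq_mul, ← setIntegral_const]
  refine setIntegral_mono_on (integrable_const _) hi.integrableOn hS fun x hx => ?_
  rw [← primF_abs hodd (t * a), ← primF_abs hodd (t * _), abs_mul, abs_mul, abs_of_nonneg ha,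
    abs_of_nonneg (ha.trans (haS x hx))]
  have h0 : 0 ≤ |t| * a := by positivity
  have h2 : |t| * a ≤ |t| * ∫ y, k x y * φ y ∂μ := by gcongr; exact haS x hx
  exact monotoneOn_primF hf hH2 h0 (h0.trans h2) h2

end IsGreenKernel

theorem ball_half_subset_halfDisk {δ : ℝ} (hδ : δ ≤ 1 / 4) : ball (1 / 2 : ℂ) δ ⊆ halfDisk := by
  intro x hx
  have h1 : ‖x - 1 / 2‖ < 1 / 4 := (mem_ball_iff_norm.1 hx).trans_le hδ
  constructor
  · calc ‖x‖ = ‖(x - 1 / 2) + 1 / 2‖ := by ring_nf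
      _ ≤ ‖x - 1 / 2‖ + ‖(1 / 2 : ℂ)‖ := norm_add_le _ _
      _ < 1 := by norm_num; linarith
  · have h2 := (abs_lt.1 ((Complex.abs_re_le_norm _).trans_lt h1)).1
    rw [Complex.sub_re] at h2
    norm_num at h2
    linarith

theorem abs_log_le_of_mem_Icc {v : ℝ} (h1 : 1 / 4 ≤ v) (h2 : v ≤ 2) :
    -(7 / 5) ≤ Real.log v ∧ Real.log v ≤ 7 / 10 := by
  have hl := Real.log_two_lt_d9
  have h3 : Real.log (1 / 4) = -(2 * Real.log 2) := by
    rw [one_div, Real.log_inv, show (4 : ℝ) = 2 ^ 2 by norm_num, Real.log_pow]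
    norm_num
  have h4 := Real.log_le_log (by norm_num) h1
  have h5 := Real.log_le_log (by linarith) h2
  constructor <;> linarith

theorem abs_halfDiskGreen_add_log_le {x y : ℂ} (hx : x ∈ ball (1 / 2 : ℂ) (1 / 4))
    (hy : y ∈ ball (1 / 2 : ℂ) (1 / 4)) (h : x ≠ y) :
    |2 * π * halfDiskGreen x y + Real.log ‖x - y‖| ≤ 4 := by
  have hxD := ball_half_subset_halfDisk le_rfl hx
  have hyD := ball_half_subset_halfDisk le_rfl hy
  have hn : ∀ z ∈ ball (1 / 2 : ℂ) (1 / 4), ‖z‖ ≤ 3 / 4 ∧ 1 / 4 ≤ z.re := by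
    intro z hz
    have h1 : ‖z - 1 / 2‖ < 1 / 4 := mem_ball_iff_norm.1 hz
    constructor
    · calc ‖z‖ = ‖(z - 1 / 2) + 1 / 2‖ := by ring_nf
        _ ≤ ‖z - 1 / 2‖ + ‖(1 / 2 : ℂ)‖ := norm_add_le _ _
        _ ≤ _ := by norm_num; linarith
    · have h2 := (abs_lt.1 ((Complex.abs_re_le_norm _).trans_lt h1)).1
      rw [Complex.sub_re] at h2
      norm_num at h2
      linarith
  have hA : ∀ z, ‖z‖ ≤ 3 / 4 → 1 / 4 ≤ ‖1 - x * starRingEnd ℂ z‖ ∧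
      ‖1 - x * starRingEnd ℂ z‖ ≤ 2 := by
    intro z hz
    have h1 : ‖x * starRingEnd ℂ z‖ ≤ 3 / 4 := by
      rw [norm_mul, RCLike.norm_conj]
      nlinarith [(hn x hx).1, norm_nonneg x, norm_nonneg z]
    have h2 := norm_sub_norm_le 1 (x * starRingEnd ℂ z)
    have h3 := norm_sub_le 1 (x * starRingEnd ℂ z)
    rw [norm_one] at h2 h3
    constructor <;> linarith
  obtain ⟨a1, a2⟩ := hA y (hn y hy).1
  obtain ⟨b1, b2⟩ := hA (reflect y) (by simpa using (hn y hy).1)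
  have c1 : 1 / 4 ≤ ‖x - reflect y‖ := by
    have h1 := Complex.re_le_norm (x - reflect y)
    rw [Complex.sub_re, reflect_re] at h1
    linarith [(hn x hx).2, (hn y hy).2]
  have c2 : ‖x - reflect y‖ ≤ 2 := by
    have h1 := norm_sub_le x (reflect y)
    rw [norm_reflect] at h1
    linarith [(hn x hx).1, (hn y hy).1]
  have h0 : 0 < ‖x - y‖ := norm_pos_iff.2 (sub_ne_zero.2 h)
  rw [halfDiskGreen_eq hxD hyD h, diskGreen, diskGreen, ← mul_sub, ← mul_assoc,
    mul_one_div_cancel (by positivity), one_mul, Real.log_div (by linarith) h0.ne',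
    Real.log_div (by linarith) (by linarith), abs_le]
  have := abs_log_le_of_mem_Icc a1 a2
  have := abs_log_le_of_mem_Icc b1 b2
  have := abs_log_le_of_mem_Icc c1 c2
  constructor <;> linarith

theorem setIntegral_ball_inv_norm {r : ℝ} (hr : 0 < r) :
    ∫ z in ball (0 : ℂ) r, ‖z‖ ^ (-(1 : ℝ)) = r * ∫ z in ball (0 : ℂ) 1, ‖z‖ ^ (-(1 : ℝ)) := by
  have h := Measure.setIntegral_comp_smul_of_pos volume (fun z : ℂ => ‖z‖ ^ (-(1 : ℝ)))
    (ball (0 : ℂ) 1) hr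
  rw [_root_.smul_ball hr.ne', smul_zero, mul_one, Real.norm_of_nonneg hr.le,
    Complex.finrank_real_complex]
    at h
  have h1 : ∀ z : ℂ, ‖r • z‖ ^ (-(1 : ℝ)) = r⁻¹ * ‖z‖ ^ (-(1 : ℝ)) := fun z => by
    rw [norm_smul, Real.norm_of_nonneg hr.le, Real.mul_rpow hr.le (norm_nonneg _),
      Real.rpow_neg_one r]
  simp only [h1] at h
  rw [integral_const_mul, smul_eq_mul] at h
  field_simp at h
  linarith

/-- A constant controlling the logarithmic potentials of small disks. -/
noncomputable def moserConst : ℝ := 5 + 2 * (∫ z in ball (0 : ℂ) 1, ‖z‖ ^ (-(1 : ℝ))) / π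

theorem five_le_moserConst : 5 ≤ moserConst := by
  have : 0 ≤ ∫ z in ball (0 : ℂ) 1, ‖z‖ ^ (-(1 : ℝ)) := integral_nonneg fun z => by positivity
  unfold moserConst
  have : 0 ≤ 2 * (∫ z in ball (0 : ℂ) 1, ‖z‖ ^ (-(1 : ℝ))) / π := by positivity
  linarith

theorem volume_real_ball (x : ℂ) {δ : ℝ} (hδ : 0 ≤ δ) : volume.real (ball x δ) = π * δ ^ 2 := by
  rw [Measure.real, Complex.volume_ball, ENNReal.toReal_mul, ENNReal.toReal_pow,
    ENNReal.toReal_ofReal hδ, mul_comm]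
  rfl

theorem average_halfDiskGreen_mem_Icc {δ : ℝ} (hδ0 : 0 < δ) (hδ : δ ≤ 1 / 4) {x : ℂ}
    (hx : x ∈ ball (1 / 2 : ℂ) δ) :
    (-Real.log δ - moserConst) / (2 * π) ≤
        (π * δ ^ 2)⁻¹ * ∫ y in ball (1 / 2 : ℂ) δ, halfDiskGreen x y ∧
      (π * δ ^ 2)⁻¹ * ∫ y in ball (1 / 2 : ℂ) δ, halfDiskGreen x y ≤
        (-Real.log δ + moserConst) / (2 * π) := by
  have hsub : ball (1 / 2 : ℂ) δ ⊆ ball (1 / 2) (1 / 4) := ball_subset_ball hδ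
  have hV : 0 < π * δ ^ 2 := by positivity
  have hI0 : 0 ≤ ∫ z in ball (0 : ℂ) 1, ‖z‖ ^ (-(1 : ℝ)) := integral_nonneg fun z => by positivity
  have hfin : IsFiniteMeasure (volume.restrict (ball (1 / 2 : ℂ) δ)) :=
    isFiniteMeasure_restrict.2 measure_ball_lt_top.ne
  have hdist : ∀ y ∈ ball (1 / 2 : ℂ) δ, ‖x - y‖ < 2 * δ := fun y hy => by
    have := dist_triangle_right x y (1 / 2)
    rw [dist_eq_norm] at this
    have h1 : dist x (1 / 2) < δ := hx
    have h2 : dist y (1 / 2) < δ := hy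
    linarith
  have hae : ∀ᵐ y ∂(volume.restrict (ball (1 / 2 : ℂ) δ)),
      (-Real.log δ - 5) / (2 * π) ≤ halfDiskGreen x y ∧ halfDiskGreen x y ≤
        (-Real.log δ + 4) / (2 * π) + δ / (2 * π) * ‖x - y‖ ^ (-(1 : ℝ)) := by
    filter_upwards [ae_restrict_mem measurableSet_ball, compl_mem_ae_iff.2
      (measure_singleton (μ := volume.restrict (ball (1 / 2 : ℂ) δ)) x)] with y hy hne
    have hne : x ≠ y := fun h => hne h.symm
    have h0 : 0 < ‖x - y‖ := norm_pos_iff.2 (sub_ne_zero.2 hne)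
    have h1 := abs_le.1 (abs_halfDiskGreen_add_log_le (hsub hx) (hsub hy) hne)
    have h2 : Real.log ‖x - y‖ ≤ 1 + Real.log δ := by
      have := Real.log_le_log h0 (hdist y hy).le
      rw [Real.log_mul (by norm_num) hδ0.ne'] at this
      linarith [Real.log_two_lt_d9]
    have h3 : Real.log δ - Real.log ‖x - y‖ ≤ δ * ‖x - y‖ ^ (-(1 : ℝ)) := by
      rw [← Real.log_div hδ0.ne' h0.ne', Real.rpow_neg_one, ← div_eq_mul_inv]
      exact Real.log_le_self (by positivity)
    constructor
    · rw [div_le_iff₀ (by positivity)]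
      linarith
    · rw [div_mul_eq_mul_div, ← add_div, le_div_iff₀ (by positivity)]
      linarith
  have hInt : IntegrableOn (fun y => ‖x - y‖ ^ (-(1 : ℝ))) (ball x (2 * δ)) :=
    integrableOn_ball_norm_sub_rpow (by norm_num) x _
  have hsub2 : ball (1 / 2 : ℂ) δ ⊆ ball x (2 * δ) := fun y hy => by
    rw [mem_ball_iff_norm, norm_sub_rev]
    exact hdist y hy
  have hint2 := hInt.mono_set hsub2
  have hk : Integrable (fun y => halfDiskGreen x y) (volume.restrict (ball (1 / 2 : ℂ) δ)) := by
    refine Integrable.mono' ((integrable_const ((-Real.log δ + 4) / (2 * π))).add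
      (hint2.const_mul (δ / (2 * π))))
      (isGreenKernel_halfDiskGreen.measurable_right x).aestronglyMeasurable ?_
    filter_upwards [hae] with y hy
    rw [Real.norm_of_nonneg (isGreenKernel_halfDiskGreen.nonneg x y)]
    exact hy.2
  constructor
  · have h1 : ∫ y in ball (1 / 2 : ℂ) δ, (-Real.log δ - 5) / (2 * π) ≤
        ∫ y in ball (1 / 2 : ℂ) δ, halfDiskGreen x y :=
      integral_mono_ae (integrable_const _) hk (hae.mono fun y hy => hy.1)
    rw [setIntegral_const, volume_real_ball _ hδ0.le, smul_eq_mul] at h1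
    rw [le_inv_mul_iff₀ hV]
    refine le_trans ?_ h1
    gcongr
    exact five_le_moserConst
  · have h1 : ∫ y in ball (1 / 2 : ℂ) δ, halfDiskGreen x y ≤ ∫ y in ball (1 / 2 : ℂ) δ,
        ((-Real.log δ + 4) / (2 * π) + δ / (2 * π) * ‖x - y‖ ^ (-(1 : ℝ))) :=
      integral_mono_ae hk ((integrable_const _).add (hint2.const_mul _)) (hae.mono fun y hy => hy.2)
    rw [integral_add (integrable_const _) (hint2.const_mul _), setIntegral_const,
      volume_real_ball _ hδ0.le, smul_eq_mul, integral_const_mul] at h1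
    have h2 : ∫ y in ball (1 / 2 : ℂ) δ, ‖x - y‖ ^ (-(1 : ℝ)) ≤
        2 * δ * ∫ z in ball (0 : ℂ) 1, ‖z‖ ^ (-(1 : ℝ)) := by
      rw [← setIntegral_ball_inv_norm (by positivity), ← setIntegral_ball_norm_sub_rpow _ x]
      exact setIntegral_mono_set hInt (.of_forall fun y => by positivity)
        (ae_of_all _ hsub2)
    rw [inv_mul_le_iff₀ hV]
    refine h1.trans ?_
    calc _ ≤ π * δ ^ 2 * ((-Real.log δ + 4) / (2 * π)) + δ / (2 * π) *
          (2 * δ * ∫ z in ball (0 : ℂ) 1, ‖z‖ ^ (-(1 : ℝ))) := by gcongr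
      _ = π * δ ^ 2 * ((-Real.log δ + (moserConst - 1)) / (2 * π)) := by
          unfold moserConst; field_simp; ring
      _ ≤ _ := by gcongr; linarith

/-- Moser-type functions in the half disk stay below the critical level. -/
theorem exists_halfDisk_level_lt {f : ℝ → ℝ} (hf : Continuous f) (hodd : ∀ s : ℝ, f (-s) = - f s)
    (hH2 : ∀ s : ℝ, s ≠ 0 → 0 < primF f s ∧ primF f s ≤ (1/2) * f s * s)
    (hH3 : Tendsto (fun s : ℝ => s * f s * Real.exp (-(4 * π * s ^ 2))) atTop atTop) :
    ∃ φ : ℂ → ℝ, MemLp φ 2 (volume.restrict halfDisk) ∧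
      ∫ x in halfDisk, (∫ y in halfDisk, halfDiskGreen x y * φ y) * φ x ≠ 0 ∧
      ∃ c < 1 / 2, ∀ t : ℝ, 1 / 2 * t ^ 2 *
        (∫ x in halfDisk, (∫ y in halfDisk, halfDiskGreen x y * φ y) * φ x) -
        ∫ x in halfDisk, primF f (t * ∫ y in halfDisk, halfDiskGreen x y * φ y) ≤ c := by
  have hC := five_le_moserConst
  obtain ⟨Λ, hΛ⟩ := exists_moser_level_lt hf hodd hH2 hH3 (C := moserConst) (by linarith) pi_pos
  set l := max Λ (max (moserConst + 1) (Real.log 4)) with hl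
  obtain ⟨c, hc, hray⟩ := hΛ l (le_max_left _ _)
  have hlC : moserConst + 1 ≤ l := (le_max_left _ _).trans (le_max_right _ _)
  set δ := exp (-l) with hδ
  have hδ0 : 0 < δ := exp_pos _
  have hδ1 : δ ≤ 1 / 4 := by
    have h1 : Real.log 4 ≤ l := (le_max_right _ _).trans (le_max_right _ _)
    rw [hδ, exp_neg, one_div]
    gcongr
    exact (Real.log_le_iff_le_exp (by norm_num)).1 h1
  have hδl : -Real.log δ = l := by rw [hδ, Real.log_exp, neg_neg]
  set B := ball (1 / 2 : ℂ) δ with hB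
  have hBD : B ⊆ halfDisk := ball_half_subset_halfDisk hδ1
  set φ : ℂ → ℝ := B.indicator fun _ => (π * δ ^ 2)⁻¹ with hφ
  have hφL : MemLp φ 2 (volume.restrict halfDisk) := by
    exact memLp_indicator_const 2 measurableSet_ball _ (.inr (measure_ne_top _ _))
  have hmul : ∀ g : ℂ → ℝ, ∫ x in halfDisk, g x * φ x = (π * δ ^ 2)⁻¹ * ∫ x in B, g x := by
    intro g
    have h1 : (fun x => g x * φ x) = B.indicator fun x => (π * δ ^ 2)⁻¹ * g x := by
      ext x
      by_cases hx : x ∈ B <;> simp [hφ, hx, mul_comm]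
    rw [h1, setIntegral_indicator measurableSet_ball, inter_eq_right.2 hBD, integral_const_mul]
  have hw : ∀ x ∈ B, (l - moserConst) / (2 * π) ≤ ∫ y in halfDisk, halfDiskGreen x y * φ y ∧
      ∫ y in halfDisk, halfDiskGreen x y * φ y ≤ (l + moserConst) / (2 * π) := by
    intro x hx
    rw [hmul, ← hδl]
    exact average_halfDiskGreen_mem_Icc hδ0 hδ1 hx
  have ha : 0 < (l - moserConst) / (2 * π) := div_pos (by linarith) (by positivity)
  have hvol : volume.real B = π * δ ^ 2 := volume_real_ball _ hδ0.le
  have hV : 0 < π * δ ^ 2 := by positivity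
  have hfin : IsFiniteMeasure (volume.restrict B) :=
    isFiniteMeasure_restrict.2 measure_ball_lt_top.ne
  have hwi : IntegrableOn (fun x => ∫ y in halfDisk, halfDiskGreen x y * φ y) B :=
    IntegrableOn.mono_set
      (isGreenKernel_halfDiskGreen.integrable_comp_potential hφL (F := fun s => s) continuous_id)
      hBD
  have hE1 : (l - moserConst) / (2 * π) ≤
      ∫ x in halfDisk, (∫ y in halfDisk, halfDiskGreen x y * φ y) * φ x := by
    rw [hmul, le_inv_mul_iff₀ hV, ← hvol, ← smul_eq_mul, ← setIntegral_const]
    exact setIntegral_mono_on (integrable_const _) hwi measurableSet_ball fun x hx => (hw x hx).1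
  have hE2 : ∫ x in halfDisk, (∫ y in halfDisk, halfDiskGreen x y * φ y) * φ x ≤
      (l + moserConst) / (2 * π) := by
    rw [hmul, inv_mul_le_iff₀ hV, ← hvol, ← smul_eq_mul, ← setIntegral_const]
    exact setIntegral_mono_on hwi (integrable_const _) measurableSet_ball fun x hx => (hw x hx).2
  refine ⟨φ, hφL, (ha.trans_le hE1).ne', c, hc, fun t => le_trans ?_ (hray t)⟩
  have h1 := isGreenKernel_halfDiskGreen.measureReal_mul_primF_le hf hodd hH2 hφL
    (S := B) measurableSet_ball ha.le (fun x hx => (hw x hx).1) t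
  rw [Measure.real, Measure.restrict_apply measurableSet_ball, inter_eq_left.2 hBD] at h1
  change volume.real B * _ ≤ _ at h1
  rw [hvol] at h1
  have h2 : δ ^ 2 = exp (-(2 * l)) := by
    rw [hδ, ← exp_nat_mul]; congr 1; push_cast; ring
  rw [h2] at h1
  have h3 := mul_le_mul_of_nonneg_left hE2 (a := 1 / 2 * t ^ 2) (by positivity)
  linarith

/-- Regularisation of `2π` times the Green function of the unit disc. -/
noncomputable def regKernel (ε : ℝ) (x y : ℂ) : ℝ :=
  Real.log ‖1 - x * starRingEnd ℂ y‖ - 1 / 2 * Real.log (‖x - y‖ ^ 2 + ε ^ 2)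

/-- The gradient of `regKernel` in its first point. -/
noncomputable def regGrad (ε : ℝ) (x y : ℂ) : ℂ :=
  -((‖1 - x * starRingEnd ℂ y‖ ^ 2)⁻¹ • ((1 - x * starRingEnd ℂ y) * y)) -
    (‖x - y‖ ^ 2 + ε ^ 2)⁻¹ • (x - y)

theorem measurable_regKernel (ε : ℝ) (x : ℂ) : Measurable (regKernel ε x) := by
  unfold regKernel
  have : Measurable (fun y : ℂ => starRingEnd ℂ y) := Complex.continuous_conj.measurable
  fun_prop

theorem measurable_regGrad (ε : ℝ) : Measurable (fun p : ℂ × ℂ => regGrad ε p.1 p.2) := by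
  unfold regGrad
  have : Measurable (fun y : ℂ × ℂ => starRingEnd ℂ y.2) :=
    (Complex.continuous_conj.comp continuous_snd).measurable
  fun_prop

theorem one_sub_norm_le_norm_one_sub_mul_conj {x y : ℂ} (hy : ‖y‖ ≤ 1) :
    1 - ‖x‖ ≤ ‖1 - x * starRingEnd ℂ y‖ := by
  have h := norm_sub_norm_le (1 : ℂ) (x * starRingEnd ℂ y)
  rw [norm_one, norm_mul, RCLike.norm_conj] at h
  nlinarith [norm_nonneg x, norm_nonneg y]

theorem real_inner_mul_conj (a b w : ℂ) : ⟪a, w * starRingEnd ℂ b⟫ = ⟪a * b, w⟫ := by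
  simp only [Complex.inner, Complex.mul_re, Complex.mul_im, Complex.conj_re, Complex.conj_im]
  ring

theorem hasFDerivAt_regKernel {ε : ℝ} {x y : ℂ} (h1 : 1 - x * starRingEnd ℂ y ≠ 0)
    (h2 : ‖x - y‖ ^ 2 + ε ^ 2 ≠ 0) :
    HasFDerivAt (fun x => regKernel ε x y) (innerSL ℝ (regGrad ε x y)) x := by
  have e : (fun x => regKernel ε x y) = fun x => 1 / 2 * Real.log (‖1 - x * starRingEnd ℂ y‖ ^ 2) -
      1 / 2 * Real.log (‖x - y‖ ^ 2 + ε ^ 2) := by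
    ext x
    rw [regKernel, Real.log_pow]
    push_cast
    ring
  rw [e]
  have d1 : HasFDerivAt (fun x : ℂ => 1 - x * starRingEnd ℂ y)
      (-((ContinuousLinearMap.id ℝ ℂ).smulRight (starRingEnd ℂ y))) x := by
    have := ((hasFDerivAt_id (𝕜 := ℝ) x).mul_const (starRingEnd ℂ y)).const_sub 1
    refine this.congr_fderiv ?_
    ext w
    simp [mul_comm]
  have d2 : HasFDerivAt (fun x : ℂ => x - y) (ContinuousLinearMap.id ℝ ℂ) x :=
    (hasFDerivAt_id x).sub_const y
  have h3 := ((d1.norm_sq.log (by positivity)).const_mul (1 / 2)).sub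
    (((d2.norm_sq.add_const (ε ^ 2)).log h2).const_mul (1 / 2))
  refine h3.congr_fderiv ?_
  ext w
  rw [innerSL_apply_apply, regGrad, inner_sub_left, inner_neg_left, real_inner_smul_left,
    real_inner_smul_left, ← real_inner_mul_conj]
  simp [-Complex.inner, inner_sub_left]
  ring

theorem norm_inv_smul_le (ε : ℝ) (z : ℂ) : ‖(‖z‖ ^ 2 + ε ^ 2)⁻¹ • z‖ ≤ ‖z‖⁻¹ := by
  rcases eq_or_ne z 0 with rfl | hz
  · simp
  have h0 : 0 < ‖z‖ := norm_pos_iff.2 hz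
  rw [norm_smul, norm_inv, Real.norm_of_nonneg (by positivity), ← div_eq_inv_mul,
    div_le_iff₀ (by positivity)]
  field_simp
  nlinarith [sq_nonneg ε]

theorem norm_inv_smul_le_inv {ε : ℝ} (hε : 0 < ε) (z : ℂ) :
    ‖(‖z‖ ^ 2 + ε ^ 2)⁻¹ • z‖ ≤ ε⁻¹ := by
  rw [norm_smul, norm_inv, Real.norm_of_nonneg (by positivity), ← div_eq_inv_mul,
    div_le_iff₀ (by positivity)]
  field_simp
  nlinarith [sq_nonneg (‖z‖ - ε), sq_nonneg ‖z‖]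

theorem norm_inv_smul_sub_le {ε : ℝ} (hε : 0 < ε) (z : ℂ) :
    ‖(‖z‖ ^ 2 + ε ^ 2)⁻¹ • z - (‖z‖ ^ 2 + 0 ^ 2)⁻¹ • z‖ ≤ √ε * ‖z‖ ^ (-(3 / 2) : ℝ) := by
  rcases eq_or_ne z 0 with rfl | hz
  · simp
  have h0 : 0 < ‖z‖ := norm_pos_iff.2 hz
  have e : (‖z‖ ^ 2 + ε ^ 2)⁻¹ - (‖z‖ ^ 2 + 0 ^ 2)⁻¹ =
      -(ε ^ 2 / (‖z‖ ^ 2 * (‖z‖ ^ 2 + ε ^ 2))) := by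
    field_simp
    ring
  rw [← sub_smul, e, norm_smul, norm_neg, Real.norm_of_nonneg (by positivity)]
  have e2 : ‖z‖ ^ (-(3 / 2) : ℝ) = (√‖z‖ ^ 3)⁻¹ := by
    rw [Real.rpow_neg h0.le, Real.sqrt_eq_rpow, ← Real.rpow_mul_natCast h0.le]
    norm_num
  rw [e2]
  obtain ⟨a, ha, hza⟩ : ∃ a, 0 < a ∧ ‖z‖ = a ^ 2 := ⟨√‖z‖, by positivity, (Real.sq_sqrt h0.le).symm⟩
  obtain ⟨b, hb, hεb⟩ : ∃ b, 0 < b ∧ ε = b ^ 2 := ⟨√ε, by positivity, (Real.sq_sqrt hε.le).symm⟩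
  rw [hza, hεb, Real.sqrt_sq ha.le, Real.sqrt_sq hb.le]
  rw [← div_eq_mul_inv, div_mul_eq_mul_div, div_le_div_iff₀ (by positivity) (by positivity)]
  have key : a * b ^ 3 ≤ a ^ 4 + b ^ 4 := by
    nlinarith [sq_nonneg (a * b - b ^ 2), sq_nonneg (a ^ 2 - b ^ 2), sq_nonneg (a * b),
      sq_nonneg (a ^ 2)]
  calc (b ^ 2) ^ 2 * a ^ 2 * a ^ 3 = (a ^ 4 * b) * (a * b ^ 3) := by ring
    _ ≤ (a ^ 4 * b) * (a ^ 4 + b ^ 4) := by gcongr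
    _ = b * ((a ^ 2) ^ 2 * ((a ^ 2) ^ 2 + (b ^ 2) ^ 2)) := by ring

theorem norm_reflected_grad_le {x y : ℂ} (hx : ‖x‖ < 1) (hy : ‖y‖ ≤ 1) :
    ‖(‖1 - x * starRingEnd ℂ y‖ ^ 2)⁻¹ • ((1 - x * starRingEnd ℂ y) * y)‖ ≤ (1 - ‖x‖)⁻¹ := by
  have h1 := one_sub_norm_le_norm_one_sub_mul_conj (x := x) hy
  have h0 : 0 < 1 - ‖x‖ := by linarith
  have h2 : 0 < ‖1 - x * starRingEnd ℂ y‖ := by linarith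
  rw [norm_smul, norm_mul, norm_inv, Real.norm_of_nonneg (by positivity)]
  calc (‖1 - x * starRingEnd ℂ y‖ ^ 2)⁻¹ * (‖1 - x * starRingEnd ℂ y‖ * ‖y‖)
      ≤ (‖1 - x * starRingEnd ℂ y‖ ^ 2)⁻¹ * (‖1 - x * starRingEnd ℂ y‖ * 1) := by gcongr
    _ = (‖1 - x * starRingEnd ℂ y‖)⁻¹ := by field_simp
    _ ≤ _ := by gcongr

theorem norm_regGrad_le (ε : ℝ) {x y : ℂ} (hx : ‖x‖ < 1) (hy : ‖y‖ ≤ 1) :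
    ‖regGrad ε x y‖ ≤ (1 - ‖x‖)⁻¹ + ‖x - y‖⁻¹ := by
  rw [regGrad]
  refine (norm_sub_le _ _).trans ?_
  rw [norm_neg]
  exact add_le_add (norm_reflected_grad_le hx hy) (norm_inv_smul_le ε _)

theorem norm_regGrad_le_inv {ε : ℝ} (hε : 0 < ε) {x y : ℂ} (hx : ‖x‖ < 1) (hy : ‖y‖ ≤ 1) :
    ‖regGrad ε x y‖ ≤ (1 - ‖x‖)⁻¹ + ε⁻¹ := by
  rw [regGrad]
  refine (norm_sub_le _ _).trans ?_
  rw [norm_neg]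
  exact add_le_add (norm_reflected_grad_le hx hy) (norm_inv_smul_le_inv hε _)

theorem norm_regGrad_sub_le {ε : ℝ} (hε : 0 < ε) (x y : ℂ) :
    ‖regGrad ε x y - regGrad 0 x y‖ ≤ √ε * ‖x - y‖ ^ (-(3 / 2) : ℝ) := by
  have := norm_inv_smul_sub_le hε (x - y)
  rw [regGrad, regGrad, sub_sub_sub_cancel_left, norm_sub_rev]
  exact this

theorem abs_regKernel_le {ε : ℝ} (hε : |ε| ≤ 1) {x y : ℂ} (hx : ‖x‖ < 1) (hy : ‖y‖ ≤ 1)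
    (hxy : x ≠ y) : |regKernel ε x y| ≤ 4 + (1 - ‖x‖)⁻¹ + ‖x - y‖⁻¹ := by
  have h0 : 0 < 1 - ‖x‖ := by linarith
  have h1 := one_sub_norm_le_norm_one_sub_mul_conj (x := x) hy
  have h2 := norm_one_sub_mul_conj_le hx.le hy
  have hp : 0 < ‖1 - x * starRingEnd ℂ y‖ := by linarith
  have hr : 0 < ‖x - y‖ := norm_pos_iff.2 (sub_ne_zero.2 hxy)
  have hr2 : ‖x - y‖ ≤ 2 := by
    refine (norm_sub_le _ _).trans ?_
    linarith
  have hε2 : ε ^ 2 ≤ 1 := by rw [← sq_abs]; nlinarith [abs_nonneg ε]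
  have e : 1 / 2 * Real.log (‖x - y‖ ^ 2 + ε ^ 2) = Real.log √(‖x - y‖ ^ 2 + ε ^ 2) := by
    rw [Real.log_sqrt (by positivity)]
    ring
  have hs1 : ‖x - y‖ ≤ √(‖x - y‖ ^ 2 + ε ^ 2) := Real.le_sqrt_of_sq_le (by nlinarith [sq_nonneg ε])
  have hs2 : √(‖x - y‖ ^ 2 + ε ^ 2) ≤ 3 := by
    rw [Real.sqrt_le_left (by norm_num)]; nlinarith
  have hs0 : 0 < √(‖x - y‖ ^ 2 + ε ^ 2) := by linarith
  have a1 := Real.log_le_sub_one_of_pos hp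
  have a2 := Real.one_sub_inv_le_log_of_pos hp
  have a3 := Real.log_le_sub_one_of_pos hs0
  have a4 := Real.one_sub_inv_le_log_of_pos hs0
  have a5 : ‖1 - x * starRingEnd ℂ y‖⁻¹ ≤ (1 - ‖x‖)⁻¹ := by gcongr
  have a6 : (√(‖x - y‖ ^ 2 + ε ^ 2))⁻¹ ≤ ‖x - y‖⁻¹ := by gcongr
  have a7 : 0 < (1 - ‖x‖)⁻¹ := by positivity
  have a8 : 0 < ‖x - y‖⁻¹ := by positivity
  rw [regKernel, e, abs_le]
  constructor <;> linarith

/-- `2π` times the regularised Green potential of `q` on the unit disc. -/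
noncomputable def regPotential (ε : ℝ) (q : ℂ → ℝ) (x : ℂ) : ℝ :=
  ∫ y in ball 0 1, q y * regKernel ε x y

/-- The gradient of `regPotential`. -/
noncomputable def regGradPotential (ε : ℝ) (q : ℂ → ℝ) (x : ℂ) : ℂ :=
  ∫ y in ball 0 1, q y • regGrad ε x y

theorem integrable_unitBall_inv_norm_sub {x : ℂ} (hx : ‖x‖ ≤ 1) :
    Integrable (fun y => ‖x - y‖⁻¹) (volume.restrict (ball (0 : ℂ) 1)) := by
  have := integrableOn_unitBall_norm_sub_rpow (s := 1) (by norm_num) hx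
  simp only [Real.rpow_neg_one] at this
  exact this

theorem ae_unitBall_ne (x : ℂ) : ∀ᵐ y ∂(volume.restrict (ball (0 : ℂ) 1)), x ≠ y := by
  filter_upwards [compl_mem_ae_iff.2 (measure_singleton (μ := volume.restrict (ball (0 : ℂ) 1)) x)]
    with y hy h
  exact hy h.symm

section

variable {q : ℂ → ℝ} {M : ℝ}

theorem aestronglyMeasurable_smul_regGrad
    (hq : AEStronglyMeasurable q (volume.restrict (ball 0 1))) (ε : ℝ) (x : ℂ) :
    AEStronglyMeasurable (fun y => q y • regGrad ε x y) (volume.restrict (ball 0 1)) :=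
  hq.smul ((measurable_regGrad ε).of_uncurry_left (x := x)).aestronglyMeasurable

theorem integrable_smul_regGrad (hq : AEStronglyMeasurable q (volume.restrict (ball 0 1)))
    (hM : ∀ᵐ y ∂(volume.restrict (ball (0 : ℂ) 1)), |q y| ≤ M) (ε : ℝ) {x : ℂ} (hx : ‖x‖ < 1) :
    Integrable (fun y => q y • regGrad ε x y) (volume.restrict (ball 0 1)) := by
  refine Integrable.mono' (((integrable_const (1 - ‖x‖)⁻¹).add
    (integrable_unitBall_inv_norm_sub hx.le)).const_mul M)
    (aestronglyMeasurable_smul_regGrad hq ε x) ?_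
  filter_upwards [hM, ae_mem_unitBall] with y h1 h2
  rw [norm_smul, Real.norm_eq_abs, Pi.add_apply]
  exact mul_le_mul h1 (norm_regGrad_le ε hx h2.le) (norm_nonneg _) ((abs_nonneg _).trans h1)

theorem integrable_mul_regKernel (hq : AEStronglyMeasurable q (volume.restrict (ball 0 1)))
    (hM : ∀ᵐ y ∂(volume.restrict (ball (0 : ℂ) 1)), |q y| ≤ M) {ε : ℝ} (hε : |ε| ≤ 1)
    {x : ℂ} (hx : ‖x‖ < 1) :
    Integrable (fun y => q y * regKernel ε x y) (volume.restrict (ball 0 1)) := by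
  refine Integrable.mono' (((integrable_const (4 + (1 - ‖x‖)⁻¹)).add
    (integrable_unitBall_inv_norm_sub hx.le)).const_mul M)
    (hq.mul (measurable_regKernel ε x).aestronglyMeasurable) ?_
  filter_upwards [hM, ae_mem_unitBall, ae_unitBall_ne x] with y h1 h2 h3
  rw [norm_mul, Real.norm_eq_abs, Real.norm_eq_abs, Pi.add_apply]
  exact mul_le_mul h1 (abs_regKernel_le hε hx h2.le h3) (abs_nonneg _) ((abs_nonneg _).trans h1)

theorem hasFDerivAt_regPotential_of_pos (hq : AEStronglyMeasurable q (volume.restrict (ball 0 1)))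
    (hM : ∀ᵐ y ∂(volume.restrict (ball (0 : ℂ) 1)), |q y| ≤ M) {ε : ℝ} (hε : 0 < ε) (hε1 : ε ≤ 1)
    {x : ℂ} (hx : ‖x‖ < 1) :
    HasFDerivAt (regPotential ε q) (innerSL ℝ (regGradPotential ε q x)) x := by
  have hε' : |ε| ≤ 1 := by rwa [abs_of_pos hε]
  obtain ⟨r, hxr, hr⟩ := exists_between hx
  have hs : ball (0 : ℂ) r ∈ 𝓝 x := isOpen_ball.mem_nhds (by simpa using hxr)
  have hlt : ∀ z ∈ ball (0 : ℂ) r, ‖z‖ < 1 := fun z hz => (by simpa using hz : ‖z‖ < r).trans hr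
  have e : innerSL ℝ (regGradPotential ε q x) =
      ∫ y in ball 0 1, innerSL ℝ (q y • regGrad ε x y) :=
    ((innerSL ℝ : ℂ →L[ℝ] ℂ →L[ℝ] ℝ).integral_comp_comm
      (integrable_smul_regGrad hq hM ε hx)).symm
  rw [e]
  refine hasFDerivAt_integral_of_dominated_of_fderiv_le (bound := fun _ => M * ((1 - r)⁻¹ + ε⁻¹))
    (F' := fun x y => innerSL ℝ (q y • regGrad ε x y)) hs ?_
    (integrable_mul_regKernel hq hM hε' hx) ?_ ?_ (integrable_const _) ?_
  · filter_upwards with z using hq.mul (measurable_regKernel ε z).aestronglyMeasurable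
  · exact (innerSL ℝ : ℂ →L[ℝ] ℂ →L[ℝ] ℝ).continuous.comp_aestronglyMeasurable
      (aestronglyMeasurable_smul_regGrad hq ε x)
  · filter_upwards [hM, ae_mem_unitBall] with y h1 h2 z hz
    rw [innerSL_apply_norm, norm_smul, Real.norm_eq_abs]
    refine mul_le_mul h1 ((norm_regGrad_le_inv hε (hlt z hz) h2.le).trans ?_) (norm_nonneg _)
      ((abs_nonneg _).trans h1)
    have : ‖z‖ < r := by simpa using hz
    have : 0 < 1 - r := by linarith
    gcongr
  · filter_upwards [ae_mem_unitBall] with y h2 z hz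
    have := (hasFDerivAt_regKernel (ε := ε) (one_sub_mul_conj_ne_zero (hlt z hz) h2.le)
      (by positivity)).const_mul (q y)
    refine this.congr_fderiv ?_
    exact ((innerSL ℝ : ℂ →L[ℝ] ℂ →L[ℝ] ℝ).map_smul (q y) _).symm

theorem norm_regGradPotential_sub_le (hq : AEStronglyMeasurable q (volume.restrict (ball 0 1)))
    (hM : ∀ᵐ y ∂(volume.restrict (ball (0 : ℂ) 1)), |q y| ≤ M) {ε : ℝ} (hε : 0 < ε)
    {x : ℂ} (hx : ‖x‖ < 1) :
    ‖regGradPotential ε q x - regGradPotential 0 q x‖ ≤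
      √ε * (M * ∫ z in ball (0 : ℂ) 2, ‖z‖ ^ (-(3 / 2) : ℝ)) := by
  have hM0 : 0 ≤ M := by
    have : (ae (volume.restrict (ball (0 : ℂ) 1))).NeBot :=
      ae_neBot.2 (by
        rw [Ne, Measure.restrict_eq_zero]
        exact (measure_ball_pos volume (0 : ℂ) one_pos).ne')
    obtain ⟨y, hy⟩ := hM.exists
    exact (abs_nonneg _).trans hy
  rw [regGradPotential, regGradPotential, ← integral_sub (integrable_smul_regGrad hq hM ε hx)
    (integrable_smul_regGrad hq hM 0 hx)]
  have hI := integrableOn_unitBall_norm_sub_rpow (s := 3 / 2) (by norm_num) hx.le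
  calc ‖∫ y in ball 0 1, (q y • regGrad ε x y - q y • regGrad 0 x y)‖
      ≤ ∫ y in ball 0 1, M * √ε * ‖x - y‖ ^ (-(3 / 2) : ℝ) := by
        refine norm_integral_le_of_norm_le (hI.const_mul _) ?_
        filter_upwards [hM] with y h1
        rw [← smul_sub, norm_smul, Real.norm_eq_abs, mul_assoc]
        exact mul_le_mul h1 (norm_regGrad_sub_le hε x y) (norm_nonneg _) hM0
    _ = √ε * (M * ∫ y in ball 0 1, ‖x - y‖ ^ (-(3 / 2) : ℝ)) := by
        rw [integral_const_mul]
        ring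
    _ ≤ _ := by
        gcongr
        exact setIntegral_unitBall_norm_sub_rpow_le (by norm_num) hx.le

theorem tendsto_regPotential (hq : AEStronglyMeasurable q (volume.restrict (ball 0 1)))
    (hM : ∀ᵐ y ∂(volume.restrict (ball (0 : ℂ) 1)), |q y| ≤ M) {ε : ℕ → ℝ} (hε : ∀ n, |ε n| ≤ 1)
    (hlim : Tendsto ε atTop (𝓝 0)) {x : ℂ} (hx : ‖x‖ < 1) :
    Tendsto (fun n => regPotential (ε n) q x) atTop (𝓝 (regPotential 0 q x)) := by
  refine tendsto_integral_of_dominated_convergence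
    (fun y => M * (4 + (1 - ‖x‖)⁻¹ + ‖x - y‖⁻¹))
    (fun n => hq.mul (measurable_regKernel _ x).aestronglyMeasurable)
    (((integrable_const _).add (integrable_unitBall_inv_norm_sub hx.le)).const_mul M) ?_ ?_
  · intro n
    filter_upwards [hM, ae_mem_unitBall, ae_unitBall_ne x] with y h1 h2 h3
    rw [norm_mul, Real.norm_eq_abs, Real.norm_eq_abs]
    exact mul_le_mul h1 (abs_regKernel_le (hε n) hx h2.le h3) (abs_nonneg _)
      ((abs_nonneg _).trans h1)
  · filter_upwards [ae_unitBall_ne x] with y h3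
    have hr : 0 < ‖x - y‖ := norm_pos_iff.2 (sub_ne_zero.2 h3)
    refine Tendsto.const_mul _ (Tendsto.const_sub _ (Tendsto.const_mul _ (Tendsto.log ?_ ?_)))
    · exact (hlim.pow 2).const_add _
    · positivity

theorem continuousOn_regGradPotential_of_pos
    (hq : AEStronglyMeasurable q (volume.restrict (ball 0 1)))
    (hM : ∀ᵐ y ∂(volume.restrict (ball (0 : ℂ) 1)), |q y| ≤ M) {ε : ℝ} (hε : 0 < ε) :
    ContinuousOn (regGradPotential ε q) (ball 0 1) := by
  intro x hx
  refine ContinuousAt.continuousWithinAt ?_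
  obtain ⟨r, hxr, hr⟩ := exists_between (by simpa using hx : ‖x‖ < 1)
  have hs : ball (0 : ℂ) r ∈ 𝓝 x := isOpen_ball.mem_nhds (by simpa using hxr)
  refine continuousAt_of_dominated (bound := fun _ => M * ((1 - r)⁻¹ + ε⁻¹))
    (.of_forall fun z => aestronglyMeasurable_smul_regGrad hq ε z) ?_ (integrable_const _) ?_
  · filter_upwards [hs] with z hz
    have hz : ‖z‖ < r := by simpa using hz
    filter_upwards [hM, ae_mem_unitBall] with y h1 h2
    rw [norm_smul, Real.norm_eq_abs]
    refine mul_le_mul h1 ((norm_regGrad_le_inv hε (hz.trans hr) h2.le).trans ?_) (norm_nonneg _)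
      ((abs_nonneg _).trans h1)
    have : 0 < 1 - r := by linarith
    gcongr
  · filter_upwards [ae_mem_unitBall] with y h2
    have h0 := norm_pos_iff.2 (one_sub_mul_conj_ne_zero (x := x) (by simpa using hx) h2.le)
    refine ContinuousAt.const_smul (?_ : ContinuousAt (fun z => regGrad ε z y) x) (q y)
    unfold regGrad
    have h1 : ‖1 - x * starRingEnd ℂ y‖ ^ 2 ≠ 0 := by positivity
    have h3 : ‖x - y‖ ^ 2 + ε ^ 2 ≠ 0 := by positivity
    fun_prop (disch := assumption)

theorem tendstoUniformlyOn_regGradPotential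
    (hq : AEStronglyMeasurable q (volume.restrict (ball 0 1)))
    (hM : ∀ᵐ y ∂(volume.restrict (ball (0 : ℂ) 1)), |q y| ≤ M) {ε : ℕ → ℝ} (hε : ∀ n, 0 < ε n)
    (hlim : Tendsto ε atTop (𝓝 0)) :
    TendstoUniformlyOn (fun n => regGradPotential (ε n) q) (regGradPotential 0 q) atTop
      (ball 0 1) := by
  have h0 : Tendsto (fun n => √(ε n) * (M * ∫ z in ball (0 : ℂ) 2, ‖z‖ ^ (-(3 / 2) : ℝ)))
      atTop (𝓝 0) := by
    have := (hlim.sqrt).mul_const (M * ∫ z in ball (0 : ℂ) 2, ‖z‖ ^ (-(3 / 2) : ℝ))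
    simpa using this
  rw [Metric.tendstoUniformlyOn_iff]
  intro δ hδ
  filter_upwards [h0.eventually_lt_const hδ] with n hn x hx
  rw [dist_comm, dist_eq_norm]
  exact (norm_regGradPotential_sub_le hq hM (hε n) (by simpa using hx)).trans_lt hn

theorem continuousOn_regGradPotential
    (hq : AEStronglyMeasurable q (volume.restrict (ball 0 1)))
    (hM : ∀ᵐ y ∂(volume.restrict (ball (0 : ℂ) 1)), |q y| ≤ M) :
    ContinuousOn (regGradPotential 0 q) (ball 0 1) :=
  (tendstoUniformlyOn_regGradPotential hq hM (fun _ => by positivity)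
    (tendsto_one_div_add_atTop_nhds_zero_nat (𝕜 := ℝ))).continuousOn
    (.of_forall fun _ => continuousOn_regGradPotential_of_pos hq hM (by positivity))

theorem hasFDerivAt_regPotential (hq : AEStronglyMeasurable q (volume.restrict (ball 0 1)))
    (hM : ∀ᵐ y ∂(volume.restrict (ball (0 : ℂ) 1)), |q y| ≤ M) {x : ℂ} (hx : ‖x‖ < 1) :
    HasFDerivAt (regPotential 0 q) (innerSL ℝ (regGradPotential 0 q x)) x := by
  have hlim := tendsto_one_div_add_atTop_nhds_zero_nat (𝕜 := ℝ)
  have hle : ∀ n : ℕ, 1 / ((n : ℝ) + 1) ≤ 1 := fun n => by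
    rw [div_le_one (by positivity)]; linarith [(Nat.cast_nonneg n : (0 : ℝ) ≤ n)]
  have hpos : ∀ n : ℕ, 0 < 1 / ((n : ℝ) + 1) := fun n => by positivity
  refine hasFDerivAt_of_tendstoUniformlyOn (l := atTop) (s := ball 0 1)
    (f := fun n : ℕ => regPotential (1 / ((n : ℝ) + 1)) q)
    (f' := fun n x => innerSL ℝ (regGradPotential (1 / ((n : ℝ) + 1)) q x))
    (g' := fun x => innerSL ℝ (regGradPotential 0 q x)) isOpen_ball ?_ ?_ ?_ (by simpa using hx)
  · exact (innerSL ℝ : ℂ →L[ℝ] ℂ →L[ℝ] ℝ).uniformContinuous.comp_tendstoUniformlyOn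
      (tendstoUniformlyOn_regGradPotential hq hM hpos hlim)
  · intro n x hx
    exact hasFDerivAt_regPotential_of_pos hq hM (hpos n) (hle n) (by simpa using hx)
  · intro x hx
    exact tendsto_regPotential hq hM (fun n => by rw [abs_of_pos (hpos n)]; exact hle n) hlim
      (by simpa using hx)

end

section

variable {q : ℂ → ℝ} {M : ℝ}

theorem integral_diskGreen_mul_eq {x : ℂ} (hx : ‖x‖ < 1) :
    ∫ y in ball 0 1, diskGreen x y * q y = 1 / (2 * π) * regPotential 0 q x := by
  rw [regPotential, ← integral_const_mul]
  refine integral_congr_ae ?_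
  filter_upwards [ae_mem_unitBall, ae_unitBall_ne x] with y h1 h2
  have hr : 0 < ‖x - y‖ := norm_pos_iff.2 (sub_ne_zero.2 h2)
  have h0 := norm_pos_iff.2 (one_sub_mul_conj_ne_zero hx h1.le)
  rw [diskGreen, regKernel, Real.log_div h0.ne' hr.ne', zero_pow two_ne_zero, add_zero,
    Real.log_pow]
  push_cast
  ring

theorem hasFDerivAt_integral_diskGreen_mul
    (hq : AEStronglyMeasurable q (volume.restrict (ball 0 1)))
    (hM : ∀ᵐ y ∂(volume.restrict (ball (0 : ℂ) 1)), |q y| ≤ M) {x : ℂ} (hx : ‖x‖ < 1) :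
    HasFDerivAt (fun x => ∫ y in ball 0 1, diskGreen x y * q y)
      (innerSL ℝ ((1 / (2 * π)) • regGradPotential 0 q x)) x := by
  have h := (hasFDerivAt_regPotential hq hM hx).const_mul (1 / (2 * π))
  rw [← (innerSL ℝ : ℂ →L[ℝ] ℂ →L[ℝ] ℝ).map_smul (1 / (2 * π))] at h
  refine h.congr_of_eventuallyEq ?_
  filter_upwards [isOpen_ball.mem_nhds (show x ∈ ball (0 : ℂ) 1 by simpa using hx)] with z hz
  exact integral_diskGreen_mul_eq (by simpa using hz)

theorem contDiffOn_integral_diskGreen_mul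
    (hq : AEStronglyMeasurable q (volume.restrict (ball 0 1)))
    (hM : ∀ᵐ y ∂(volume.restrict (ball (0 : ℂ) 1)), |q y| ≤ M) :
    ContDiffOn ℝ 1 (fun x => ∫ y in ball 0 1, diskGreen x y * q y) (ball 0 1) := by
  have hd : ∀ x ∈ ball (0 : ℂ) 1, HasFDerivAt (fun x => ∫ y in ball 0 1, diskGreen x y * q y)
      (innerSL ℝ ((1 / (2 * π)) • regGradPotential 0 q x)) x := fun x hx =>
    hasFDerivAt_integral_diskGreen_mul hq hM (by simpa using hx)
  rw [← zero_add (1 : WithTop ℕ∞)]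
  refine (contDiffOn_succ_iff_fderiv_of_isOpen isOpen_ball).2
    ⟨fun x hx => (hd x hx).differentiableAt.differentiableWithinAt, by simp, contDiffOn_zero.2 ?_⟩
  refine ContinuousOn.congr ?_ fun x hx => (hd x hx).fderiv
  exact (innerSL ℝ : ℂ →L[ℝ] ℂ →L[ℝ] ℝ).continuous.comp_continuousOn
    ((continuousOn_regGradPotential hq hM).const_smul (1 / (2 * π)))

theorem diskGreen_eq_zero_of_norm_eq_one {x : ℂ} (hx : ‖x‖ = 1) (y : ℂ) : diskGreen x y = 0 := by
  have h := normSq_one_sub_mul_conj x y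
  rw [hx] at h
  have h2 : ‖1 - x * starRingEnd ℂ y‖ = ‖x - y‖ := by
    refine (sq_eq_sq₀ (norm_nonneg _) (norm_nonneg _)).1 ?_
    rw [h]
    ring
  rw [diskGreen, h2]
  rcases eq_or_ne ‖x - y‖ 0 with h0 | h0
  · simp [h0]
  · simp [div_self h0]

theorem sub_min_le_sq_div {a N : ℝ} (hN : 0 < N) : a - min a N ≤ a ^ 2 / N := by
  rcases le_total a N with h | h
  · rw [min_eq_left h, sub_self]
    positivity
  · rw [min_eq_right h, le_div_iff₀ hN]
    nlinarith

theorem continuousOn_integral_min_diskGreen_mul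
    (hq : AEStronglyMeasurable q (volume.restrict (ball 0 1)))
    (hM : ∀ᵐ y ∂(volume.restrict (ball (0 : ℂ) 1)), |q y| ≤ M) {N : ℝ} (hN : 0 ≤ N) :
    ContinuousOn (fun x => ∫ y in ball 0 1, min (diskGreen x y) N * q y) (closedBall 0 1) := by
  intro x hx
  have hx : ‖x‖ ≤ 1 := by simpa using hx
  refine continuousWithinAt_of_dominated (bound := fun _ => N * M) (.of_forall fun z => ?_) ?_
    (integrable_const _) ?_
  · exact ((measurable_diskGreen.of_uncurry_left (x := z)).min
      measurable_const).aestronglyMeasurable.mul hq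
  · filter_upwards [self_mem_nhdsWithin] with z hz
    have hz : ‖z‖ ≤ 1 := by simpa using hz
    filter_upwards [hM, ae_mem_unitBall] with y h1 h2
    rw [norm_mul, Real.norm_of_nonneg (le_min (diskGreen_nonneg hz h2.le) hN), Real.norm_eq_abs]
    exact mul_le_mul (min_le_right _ _) h1 (abs_nonneg _) hN
  · filter_upwards [ae_mem_unitBall, ae_unitBall_ne x] with y h1 h2
    have hr : ‖x - y‖ ≠ 0 := (norm_pos_iff.2 (sub_ne_zero.2 h2)).ne'
    have h0 : ‖1 - x * starRingEnd ℂ y‖ ≠ 0 := by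
      have : ‖x * starRingEnd ℂ y‖ < 1 := by
        rw [norm_mul, RCLike.norm_conj]
        nlinarith [norm_nonneg x, norm_nonneg y]
      intro h
      rw [norm_eq_zero, sub_eq_zero] at h
      rw [← h, norm_one] at this
      exact lt_irrefl _ this
    have h3 : ‖1 - x * starRingEnd ℂ y‖ / ‖x - y‖ ≠ 0 := div_ne_zero h0 hr
    refine ContinuousAt.continuousWithinAt ?_
    unfold diskGreen
    fun_prop (disch := assumption)

theorem continuousOn_integral_diskGreen_mul
    (hq : AEStronglyMeasurable q (volume.restrict (ball 0 1)))
    (hM : ∀ᵐ y ∂(volume.restrict (ball (0 : ℂ) 1)), |q y| ≤ M) :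
    ContinuousOn (fun x => ∫ y in ball 0 1, diskGreen x y * q y) (closedBall 0 1) := by
  set C := ∫ z in ball (0 : ℂ) 2, ‖z‖ ^ (-(1 : ℝ)) with hC
  have hbound : ∀ N : ℝ, 0 < N → ∀ x ∈ closedBall (0 : ℂ) 1,
      |(∫ y in ball 0 1, diskGreen x y * q y) - ∫ y in ball 0 1, min (diskGreen x y) N * q y| ≤
        |M| * C / N := by
    intro N hN x hx
    have hx : ‖x‖ ≤ 1 := by simpa using hx
    have hG := measurable_diskGreen.of_uncurry_left (x := x)
    have hI := integrableOn_unitBall_norm_sub_rpow (s := 1) (by norm_num) hx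
    have hGi : Integrable (diskGreen x) (volume.restrict (ball 0 1)) :=
      (memLp_diskGreen hx).integrable one_le_two
    have i1 : Integrable (fun y => diskGreen x y * q y) (volume.restrict (ball 0 1)) :=
      hGi.mul_bdd (c := M) hq (by simpa only [Real.norm_eq_abs] using hM)
    have i2 : Integrable (fun y => min (diskGreen x y) N * q y) (volume.restrict (ball 0 1)) :=
      (hGi.inf (integrable_const N)).mul_bdd (c := M) hq (by simpa only [Real.norm_eq_abs] using hM)
    rw [← integral_sub i1 i2, ← Real.norm_eq_abs]
    calc ‖∫ y in ball 0 1, (diskGreen x y * q y - min (diskGreen x y) N * q y)‖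
        ≤ ∫ y in ball 0 1, |M| / N * ‖x - y‖ ^ (-(1 : ℝ)) := by
          refine norm_integral_le_of_norm_le (hI.const_mul _) ?_
          filter_upwards [hM, ae_mem_unitBall] with y h1 h2
          rw [← sub_mul, norm_mul, Real.norm_of_nonneg (sub_nonneg.2 (min_le_left _ _)),
            Real.norm_eq_abs]
          calc (diskGreen x y - min (diskGreen x y) N) * |q y|
              ≤ (‖x - y‖ ^ (-(1 : ℝ)) / N) * |M| := by
                refine mul_le_mul ((sub_min_le_sq_div hN).trans ?_) (h1.trans (le_abs_self _))
                  (abs_nonneg _) (by positivity)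
                gcongr
                exact diskGreen_sq_le hx h2.le
            _ = _ := by ring
      _ = |M| / N * ∫ y in ball 0 1, ‖x - y‖ ^ (-(1 : ℝ)) := integral_const_mul _ _
      _ ≤ |M| / N * C := by
          gcongr
          exact setIntegral_unitBall_norm_sub_rpow_le (by norm_num) hx
      _ = |M| * C / N := by ring
  have h0 : Tendsto (fun n : ℕ => |M| * C / ((n : ℝ) + 1)) atTop (𝓝 0) := by
    have := (tendsto_one_div_add_atTop_nhds_zero_nat (𝕜 := ℝ)).const_mul (|M| * C)
    simpa [div_eq_mul_inv] using this
  refine TendstoUniformlyOn.continuousOn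
    (F := fun (n : ℕ) x => ∫ y in ball 0 1, min (diskGreen x y) ((n : ℝ) + 1) * q y) (p := atTop) ?_
    (.of_forall fun n => continuousOn_integral_min_diskGreen_mul hq hM (by positivity))
  rw [Metric.tendstoUniformlyOn_iff]
  intro δ hδ
  filter_upwards [h0.eventually_lt_const hδ] with n hn x hx
  rw [Real.dist_eq]
  exact (hbound _ (by positivity) x hx).trans_lt hn

end

theorem integral_fderiv_radial {ψ : ℂ → ℝ} (hψ : ContDiff ℝ 1 ψ) (hc : HasCompactSupport ψ) :
    ∫ z, (‖z‖ ^ 2)⁻¹ * fderiv ℝ ψ z z = -(2 * π * ψ 0) := by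
  set e : ℝ → ℂ := fun θ => Real.cos θ + Real.sin θ * Complex.I with he
  have hen : ∀ θ, ‖e θ‖ = 1 := fun θ => by
    rw [he]
    simp only [Complex.ofReal_cos, Complex.ofReal_sin]
    rw [← Complex.exp_mul_I, Complex.norm_exp_ofReal_mul_I]
  have hec : Continuous e := by fun_prop
  set h : ℝ × ℝ → ℝ := fun p => fderiv ℝ ψ (p.1 * e p.2) (e p.2) with hh
  have hcont : Continuous h := by
    have := hψ.continuous_fderiv one_ne_zero
    refine (this.comp ?_).clm_apply ?_ <;> fun_prop
  obtain ⟨R, hR⟩ := hc.isCompact.isBounded.subset_closedBall 0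
  have hzero : ∀ p : ℝ × ℝ, 0 < p.1 → R < p.1 → h p = 0 := by
    intro p hp0 hp
    have hn : (p.1 : ℂ) * e p.2 ∉ tsupport ψ := fun hmem => by
      have := hR hmem
      rw [mem_closedBall_zero_iff, norm_mul, hen, mul_one, Complex.norm_real, Real.norm_eq_abs,
        abs_of_pos hp0] at this
      linarith
    have : fderiv ℝ ψ (p.1 * e p.2) = 0 := by
      by_contra hne
      exact hn (support_fderiv_subset ℝ hne)
    simp [hh, this]
  have hInt : IntegrableOn h (Ioi 0 ×ˢ Ioo (-π) π) (volume.prod volume) := by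
    have h1 : IntegrableOn h (Icc 0 R ×ˢ Icc (-π) π) (volume.prod volume) :=
      hcont.continuousOn.integrableOn_compact (isCompact_Icc.prod isCompact_Icc)
    refine h1.of_forall_sdiff_eq_zero (measurableSet_Ioi.prod measurableSet_Ioo) fun p hp => ?_
    refine hzero p hp.1.1 ?_
    by_contra! hle
    exact hp.2 ⟨⟨(show 0 < p.1 from hp.1.1).le, hle⟩, Ioo_subset_Icc_self hp.1.2⟩
  rw [← Complex.integral_comp_polarCoord_symm, polarCoord_target]
  have e1 : ∫ p in Ioi (0 : ℝ) ×ˢ Ioo (-π) π, p.1 • ((‖Complex.polarCoord.symm p‖ ^ 2)⁻¹ *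
      fderiv ℝ ψ (Complex.polarCoord.symm p) (Complex.polarCoord.symm p)) =
      ∫ p in Ioi (0 : ℝ) ×ˢ Ioo (-π) π, h p := by
    refine setIntegral_congr_fun (measurableSet_Ioi.prod measurableSet_Ioo) fun p hp => ?_
    have hp0 : 0 < p.1 := hp.1
    simp only [Complex.polarCoord_symm_apply]
    rw [show ((Real.cos p.2 : ℂ) + Real.sin p.2 * Complex.I) = e p.2 from rfl, norm_mul, hen,
      Complex.norm_real, Real.norm_of_nonneg hp0.le, mul_one]
    rw [show fderiv ℝ ψ (p.1 * e p.2) (p.1 * e p.2) = p.1 * fderiv ℝ ψ (p.1 * e p.2) (e p.2) by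
      rw [← smul_eq_mul (p.1), ← (fderiv ℝ ψ (p.1 * e p.2)).map_smul, Complex.real_smul]]
    simp only [smul_eq_mul, hh]
    field_simp
  rw [e1, Measure.volume_eq_prod, ← setIntegral_prod_swap,
    setIntegral_prod (fun z : ℝ × ℝ => h z.swap) hInt.swap]
  have e2 : ∀ θ : ℝ, ∫ r in Ioi (0 : ℝ), h (r, θ) = -ψ 0 := by
    intro θ
    have hd : ∀ r : ℝ, HasDerivAt (fun r : ℝ => ψ (r * e θ)) (h (r, θ)) r := by
      intro r
      have h1 : HasDerivAt (fun r : ℝ => (r : ℂ) * e θ) (e θ) r := by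
        simpa using (Complex.ofRealCLM.hasDerivAt (x := r)).mul_const (e θ)
      exact ((hψ.differentiable one_ne_zero) _).hasFDerivAt.comp_hasDerivAt r h1
    have hcd : ContDiff ℝ 1 (fun r : ℝ => ψ (r * e θ)) :=
      hψ.comp ((Complex.ofRealCLM.contDiff).mul contDiff_const)
    have hcs : HasCompactSupport (fun r : ℝ => ψ (r * e θ)) := by
      refine HasCompactSupport.intro (isCompact_closedBall (0 : ℝ) R) fun r hr => ?_
      refine image_eq_zero_of_notMem_tsupport fun hmem => hr ?_
      have := hR hmem
      rw [mem_closedBall_zero_iff, norm_mul, hen, mul_one, Complex.norm_real] at this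
      simpa using this
    have := hcs.integral_Ioi_deriv_eq hcd 0
    simp only [(hd _).deriv] at this
    simpa using this
  simp only [Prod.swap_prod_mk, e2]
  rw [setIntegral_const]
  rw [measureReal_def, Real.volume_Ioo, ENNReal.toReal_ofReal (by linarith [pi_pos]), smul_eq_mul]
  ring

theorem integral_fderiv_inv_norm_sq {φ : ℂ → ℝ} (hφ : ContDiff ℝ 1 φ) (hc : HasCompactSupport φ)
    (p : ℂ) : ∫ x, (‖x - p‖ ^ 2)⁻¹ * fderiv ℝ φ x (x - p) = -(2 * π * φ p) := by
  have h := integral_fderiv_radial (ψ := fun z => φ (z + p))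
    (hφ.comp (contDiff_id.add contDiff_const))
    (hc.comp_homeomorph (Homeomorph.addRight p))
  simp only [zero_add, fderiv_comp_add_right] at h
  rw [← h, ← integral_add_right_eq_self _ p]
  simp

section

variable {φ : ℂ → ℝ}

theorem fderiv_eq_zero_of_notMem_ball (hs : tsupport φ ⊆ ball 0 1) {x : ℂ}
    (hx : x ∉ ball (0 : ℂ) 1) : fderiv ℝ φ x = 0 := by
  by_contra h
  exact hx (hs (support_fderiv_subset ℝ h))

theorem exists_norm_fderiv_le (hφ : ContDiff ℝ 1 φ) (hc : HasCompactSupport φ) :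
    ∃ C, ∀ x, ‖fderiv ℝ φ x‖ ≤ C :=
  (hc.fderiv ℝ).exists_bound_of_continuous (hφ.continuous_fderiv one_ne_zero)

theorem integrable_fderiv_inv_norm_sq (hφ : ContDiff ℝ 1 φ) (hc : HasCompactSupport φ)
    (hs : tsupport φ ⊆ ball 0 1) (p : ℂ) :
    Integrable (fun x => (‖x - p‖ ^ 2)⁻¹ * fderiv ℝ φ x (x - p)) := by
  obtain ⟨C, hC⟩ := exists_norm_fderiv_le hφ hc
  have hC0 : 0 ≤ C := (norm_nonneg _).trans (hC 0)
  rw [← integrableOn_iff_integrable_of_support_subset (s := ball 0 1)]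
  · have h1 : IntegrableOn (fun x => ‖p - x‖ ^ (-(1 : ℝ))) (ball (0 : ℂ) 1) := by
      refine (integrableOn_ball_norm_sub_rpow (by norm_num) p (‖p‖ + 1)).mono_set ?_
      refine ball_subset_ball' ?_
      rw [dist_comm, dist_zero_right, add_comm]
    refine (h1.const_mul C).mono' ?_ (.of_forall fun x => ?_)
    · have h2 : Continuous fun x => fderiv ℝ φ x (x - p) :=
        (hφ.continuous_fderiv one_ne_zero).clm_apply (by fun_prop)
      have h3 : Measurable fun x : ℂ => (‖x - p‖ ^ 2)⁻¹ := by fun_prop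
      exact (h3.mul h2.measurable).aestronglyMeasurable
    · rw [norm_mul, Real.rpow_neg_one, norm_inv, norm_pow, norm_norm, norm_sub_rev p]
      rcases eq_or_ne x p with rfl | h
      · simp
      have h0 : 0 < ‖x - p‖ := norm_pos_iff.2 (sub_ne_zero.2 h)
      calc (‖x - p‖ ^ 2)⁻¹ * ‖fderiv ℝ φ x (x - p)‖ ≤ (‖x - p‖ ^ 2)⁻¹ * (C * ‖x - p‖) := by
            gcongr
            exact (fderiv ℝ φ x).le_of_opNorm_le (hC x) _
        _ = C * ‖x - p‖⁻¹ := by field_simp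
  · intro x hx
    by_contra h
    exact hx (by simp [fderiv_eq_zero_of_notMem_ball hs h])

theorem regGrad_zero_eq {y : ℂ} (hy : y ≠ 0) (x : ℂ) :
    regGrad 0 x y = (‖x - (starRingEnd ℂ y)⁻¹‖ ^ 2)⁻¹ • (x - (starRingEnd ℂ y)⁻¹) -
      (‖x - y‖ ^ 2)⁻¹ • (x - y) := by
  have hy' : starRingEnd ℂ y ≠ 0 := by simpa using hy
  have hn : ‖y‖ ≠ 0 := norm_ne_zero_iff.2 hy
  have e1 : 1 - x * starRingEnd ℂ y = -(starRingEnd ℂ y * (x - (starRingEnd ℂ y)⁻¹)) := by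
    field_simp
    ring
  have e2 : -(starRingEnd ℂ y * (x - (starRingEnd ℂ y)⁻¹)) * y =
      -((‖y‖ ^ 2 : ℝ) • (x - (starRingEnd ℂ y)⁻¹)) := by
    rw [Complex.real_smul, ← Complex.normSq_eq_norm_sq, Complex.normSq_eq_conj_mul_self]
    ring
  rw [regGrad, zero_pow two_ne_zero, add_zero, e1, e2, norm_neg, norm_mul, RCLike.norm_conj,
    smul_neg, neg_neg, smul_smul]
  congr 2
  field_simp

theorem integral_fderiv_regGrad (hφ : ContDiff ℝ 1 φ) (hc : HasCompactSupport φ)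
    (hs : tsupport φ ⊆ ball 0 1) {y : ℂ} (hy : ‖y‖ < 1) (hy0 : y ≠ 0) :
    ∫ x in ball 0 1, fderiv ℝ φ x (regGrad 0 x y) = 2 * π * φ y := by
  rw [setIntegral_eq_integral_of_forall_compl_eq_zero fun x hx => by
    simp [fderiv_eq_zero_of_notMem_ball hs hx]]
  simp only [regGrad_zero_eq hy0, map_sub, map_smul, smul_eq_mul]
  simp only [← map_sub]
  rw [integral_sub (integrable_fderiv_inv_norm_sq hφ hc hs _)
    (integrable_fderiv_inv_norm_sq hφ hc hs _), integral_fderiv_inv_norm_sq hφ hc,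
    integral_fderiv_inv_norm_sq hφ hc]
  have : φ (starRingEnd ℂ y)⁻¹ = 0 := by
    refine image_eq_zero_of_notMem_tsupport fun h => ?_
    have := hs h
    rw [mem_ball_zero_iff, norm_inv, RCLike.norm_conj] at this
    exact absurd ((one_le_inv₀ (norm_pos_iff.2 hy0)).2 hy.le) (not_le.2 this)
  rw [this]
  ring

theorem integral_fderiv_regGradPotential {q : ℂ → ℝ} {M : ℝ}
    (hq : AEStronglyMeasurable q (volume.restrict (ball 0 1)))
    (hM : ∀ᵐ y ∂(volume.restrict (ball (0 : ℂ) 1)), |q y| ≤ M)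
    (hφ : ContDiff ℝ 1 φ) (hc : HasCompactSupport φ) (hs : tsupport φ ⊆ ball 0 1) :
    ∫ x in ball 0 1, fderiv ℝ φ x ((1 / (2 * π)) • regGradPotential 0 q x) =
      ∫ x in ball 0 1, q x * φ x := by
  set μ := volume.restrict (ball (0 : ℂ) 1) with hμ
  obtain ⟨C, hC⟩ := exists_norm_fderiv_le hφ hc
  obtain ⟨r, hr, hsr⟩ := exists_lt_subset_ball (isClosed_tsupport φ) hs
  have hbound : ∀ x y : ℂ, ‖y‖ < 1 → ‖fderiv ℝ φ x (regGrad 0 x y)‖ ≤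
      C * ((1 - r)⁻¹ + ‖x - y‖⁻¹) := by
    intro x y hy
    have h1r : 0 < 1 - r := by linarith
    by_cases hx : x ∈ tsupport φ
    · have hxr : ‖x‖ < r := by simpa using hsr hx
      refine ((fderiv ℝ φ x).le_of_opNorm_le (hC x) _).trans ?_
      have := (norm_nonneg _).trans (hC 0)
      gcongr
      refine (norm_regGrad_le 0 (hxr.trans hr) hy.le).trans ?_
      gcongr
    · have : fderiv ℝ φ x = 0 := by
        by_contra h
        exact hx (support_fderiv_subset ℝ h)
      have := (norm_nonneg _).trans (hC 0)
      rw [‹fderiv ℝ φ x = 0›, _root_.zero_apply, norm_zero]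
      positivity
  have hInt : Integrable (fun p : ℂ × ℂ => q p.2 * fderiv ℝ φ p.1 (regGrad 0 p.1 p.2))
      (μ.prod μ) := by
    have h1 := integrable_prod_riesz_mul_snd (s := 1) (by norm_num) (q := fun _ => 1)
      (integrable_const _)
    refine (((integrable_const ((1 - r)⁻¹)).add h1).const_mul (M * C)).mono' ?_ ?_
    · refine hq.comp_snd.mul ?_
      have h2 : Measurable fun p : ℂ × ℂ => fderiv ℝ φ p.1 :=
        (hφ.continuous_fderiv one_ne_zero).measurable.comp measurable_fst
      exact (isBoundedBilinearMap_apply.continuous.comp_stronglyMeasurable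
        (h2.stronglyMeasurable.prodMk
          (measurable_regGrad 0).stronglyMeasurable)).aestronglyMeasurable
    · have h3 := Measure.quasiMeasurePreserving_snd (μ := μ) (ν := μ) |>.ae hM
      filter_upwards [h3, ae_prod_mem_unitBall] with p h3 h4
      rw [norm_mul, Pi.add_apply, Real.rpow_neg_one, mul_one, mul_assoc M]
      exact mul_le_mul h3 (hbound _ _ h4.2) (norm_nonneg _) ((abs_nonneg _).trans h3)
  calc ∫ x, fderiv ℝ φ x ((1 / (2 * π)) • regGradPotential 0 q x) ∂μ
      = ∫ x, 1 / (2 * π) * ∫ y, q y * fderiv ℝ φ x (regGrad 0 x y) ∂μ ∂μ := by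
        refine integral_congr_ae ?_
        filter_upwards [ae_mem_unitBall] with x hx
        rw [map_smul, regGradPotential, ← ContinuousLinearMap.integral_comp_comm _
          (integrable_smul_regGrad hq hM 0 hx)]
        simp only [map_smul, smul_eq_mul, hμ]
    _ = 1 / (2 * π) * ∫ y, ∫ x, q y * fderiv ℝ φ x (regGrad 0 x y) ∂μ ∂μ := by
        rw [integral_const_mul, integral_integral_swap hInt]
    _ = 1 / (2 * π) * ∫ y, 2 * π * (q y * φ y) ∂μ := by
        congr 1
        refine integral_congr_ae ?_
        filter_upwards [ae_mem_unitBall, ae_unitBall_ne 0] with y h1 h2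
        rw [integral_const_mul, integral_fderiv_regGrad hφ hc hs h1 h2.symm]
        ring
    _ = ∫ x, q x * φ x ∂μ := by
        rw [integral_const_mul]
        field_simp

end

theorem exists_abs_integral_diskGreen_mul_le {q : ℂ → ℝ}
    (hq : MemLp q 2 (volume.restrict (ball 0 1))) :
    ∃ C, ∀ x : ℂ, ‖x‖ ≤ 1 → |∫ y in ball 0 1, diskGreen x y * q y| ≤ C := by
  refine ⟨(∫ z in ball (0 : ℂ) 2, ‖z‖ ^ (-(1 : ℝ))) + ∫ y in ball 0 1, q y ^ 2, fun x hx => ?_⟩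
  have hI := integrableOn_unitBall_norm_sub_rpow (s := 1) (by norm_num) hx
  rw [← Real.norm_eq_abs]
  calc ‖∫ y in ball 0 1, diskGreen x y * q y‖
      ≤ ∫ y in ball 0 1, (‖x - y‖ ^ (-(1 : ℝ)) + q y ^ 2) := by
        refine norm_integral_le_of_norm_le (Integrable.add hI hq.integrable_sq) ?_
        filter_upwards [ae_mem_unitBall] with y hy
        have h := diskGreen_sq_le hx hy.le
        rw [norm_mul, Real.norm_eq_abs, Real.norm_eq_abs]
        rw [← sq_abs] at h
        rw [← sq_abs (q y)]
        nlinarith [sq_nonneg (|diskGreen x y| - |q y|), abs_nonneg (diskGreen x y),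
          abs_nonneg (q y)]
    _ = (∫ y in ball 0 1, ‖x - y‖ ^ (-(1 : ℝ))) + ∫ y in ball 0 1, q y ^ 2 :=
        integral_add hI hq.integrable_sq
    _ ≤ _ := by
        gcongr
        exact setIntegral_unitBall_norm_sub_rpow_le (by norm_num) hx

theorem ae_oddExtension_eq {u U : ℂ → ℝ} (h : ∀ᵐ x ∂(volume.restrict halfDisk), u x = U x)
    (hU : ∀ x : ℂ, ‖x‖ ≤ 1 → U (reflect x) = -U x) :
    ∀ᵐ x ∂(volume.restrict (ball (0 : ℂ) 1)), oddExtension u x = U x := by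
  rw [ae_restrict_iff' measurableSet_halfDisk] at h
  have h' := measurePreserving_reflect.quasiMeasurePreserving.ae h
  filter_upwards [ae_restrict_of_ae h, ae_restrict_of_ae h', ae_mem_unitBall] with x h1 h2 hx
  by_cases hxD : x ∈ halfDisk
  · rw [oddExtension_of_mem u hxD, h1 hxD]
  have hUx := hU x hx.le
  by_cases hxR : reflect x ∈ halfDisk
  · have := oddExtension_reflect u x
    rw [oddExtension_of_mem u hxR, h2 hxR, hUx] at this
    linarith
  · have hre : x.re = 0 := by
      have a : ¬ 0 < x.re := fun h => hxD ⟨hx, h⟩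
      have b : ¬ x.re < 0 := fun h => hxR ⟨by simpa using hx, by simpa using h⟩
      linarith
    have hrx : reflect x = x := by
      apply Complex.ext <;> simp [hre]
    rw [hrx] at hUx
    have hU0 : U x = 0 := by linarith
    simp [oddExtension, hxD, hxR, hU0]

/-- A nontrivial solution of the Dirichlet problem in the unit disc that is odd with respect to
the reflection across the second coordinate axis. -/
theorem exists_odd_solution {f : ℝ → ℝ} (hcont : Continuous f) (hodd : ∀ s : ℝ, f (-s) = - f s)
    (hf1 : ∃ C > 0, ∀ s : ℝ, |f s| ≤ C * Real.exp (4 * π * s ^ 2))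
    (hf2 : Tendsto (fun s : ℝ => f s / s) (𝓝[≠] 0) (𝓝 0))
    (hH1 : ∃ s₀ > 0, ∃ M > 0, ∀ s : ℝ, s₀ ≤ |s| → 0 < primF f s ∧ primF f s ≤ M * |f s|)
    (hH2 : ∀ s : ℝ, s ≠ 0 → 0 < primF f s ∧ primF f s ≤ (1/2) * f s * s)
    (hH3 : Tendsto (fun s : ℝ => s * f s * Real.exp (-(4 * π * s ^ 2))) atTop atTop) :
    ∃ (U : ℂ → ℝ) (V : ℂ → ℂ), ContinuousOn U (closedBall 0 1) ∧ ContDiffOn ℝ 1 U (ball 0 1) ∧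
      (∀ x, ‖x‖ = 1 → U x = 0) ∧ (∀ x, ‖x‖ ≤ 1 → U (reflect x) = -U x) ∧
      (∃ x ∈ ball 0 1, U x ≠ 0) ∧ (∀ x ∈ ball 0 1, HasFDerivAt U (innerSL ℝ (V x)) x) ∧
      ∀ φ : ℂ → ℝ, ContDiff ℝ 1 φ → HasCompactSupport φ → tsupport φ ⊆ ball 0 1 →
        ∫ x in ball 0 1, fderiv ℝ φ x (V x) = ∫ x in ball 0 1, f (U x) * φ x := by
  obtain ⟨φ, hφ, hφ0, c, hc, hray⟩ := exists_halfDisk_level_lt hcont hodd hH2 hH3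
  have : Fact ((2 : ℝ≥0∞) ≠ ∞) := ⟨by simp⟩
  have : SecondCountableTopology (Lp ℝ 2 (volume.restrict halfDisk)) := Lp.SecondCountableTopology
  obtain ⟨u, -, hfu, hu, hu0⟩ := isGreenKernel_halfDiskGreen.exists_hammerstein_solution hcont hodd
    hf1 hf2 hH1 hH2 hH3 hφ hφ0 hc hray
  set g : ℂ → ℝ := fun x => f (u x) with hg
  set U := greenPotential g with hU
  have hUodd : ∀ x : ℂ, ‖x‖ ≤ 1 → U (reflect x) = -U x := fun x hx => greenPotential_reflect hx hfu
  have huU : ∀ᵐ x ∂(volume.restrict halfDisk), u x = U x := by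
    filter_upwards [hu, ae_restrict_mem measurableSet_halfDisk] with x h1 h2
    rw [h1, integral_halfDiskGreen_mul h2 hfu]
  have hq2 : MemLp (oddExtension g) 2 (volume.restrict (ball 0 1)) :=
    (memLp_oddExtension hfu).restrict _
  have hqU : ∀ᵐ x ∂(volume.restrict (ball (0 : ℂ) 1)), oddExtension g x = f (U x) := by
    filter_upwards [ae_oddExtension_eq huU hUodd] with x hx
    rw [← hx, comp_oddExtension hodd]
  obtain ⟨C, hC⟩ := exists_abs_integral_diskGreen_mul_le hq2
  obtain ⟨M, hM⟩ := (isCompact_Icc (a := -C) (b := C)).exists_bound_of_continuousOn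
    hcont.continuousOn
  have hqM : ∀ᵐ x ∂(volume.restrict (ball (0 : ℂ) 1)), |oddExtension g x| ≤ M := by
    filter_upwards [hqU, ae_mem_unitBall] with x h1 h2
    rw [h1]
    exact hM _ (abs_le.1 (hC x h2.le))
  have hqm := hq2.aestronglyMeasurable
  refine ⟨U, fun x => (1 / (2 * π)) • regGradPotential 0 (oddExtension g) x,
    continuousOn_integral_diskGreen_mul hqm hqM, contDiffOn_integral_diskGreen_mul hqm hqM,
    fun x hx => ?_, hUodd, ?_,
    fun x hx => hasFDerivAt_integral_diskGreen_mul hqm hqM (by simpa using hx),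
    fun ψ hψ hψc hψs => ?_⟩
  · simp [hU, greenPotential, diskGreen_eq_zero_of_norm_eq_one hx]
  · by_contra! h
    refine hu0 ?_
    filter_upwards [huU, ae_restrict_mem measurableSet_halfDisk] with x h1 h2
    rw [h1, h x (halfDisk_subset_ball h2), Pi.zero_apply]
  · rw [integral_fderiv_regGradPotential hqm hqM hψ hψc hψs]
    refine integral_congr_ae ?_
    filter_upwards [hqU] with x hx
    rw [hx]

theorem integral_inner_gradient_comp_linearIsometryEquiv
    {E : Type*} [NormedAddCommGroup E] [InnerProductSpace ℝ E] [FiniteDimensional ℝ E]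
    [MeasurableSpace E] [BorelSpace E] (L : E ≃ₗᵢ[ℝ] ℂ)
    {U : ℂ → ℝ} {V : ℂ → ℂ} {q : ℂ → ℝ}
    (hUV : ∀ x ∈ ball 0 1, HasFDerivAt U (innerSL ℝ (V x)) x)
    (hw : ∀ φ : ℂ → ℝ, ContDiff ℝ 1 φ → HasCompactSupport φ → tsupport φ ⊆ ball 0 1 →
      ∫ x in ball 0 1, fderiv ℝ φ x (V x) = ∫ x in ball 0 1, q x * φ x)
    {φ : E → ℝ} (hφ : ContDiff ℝ 1 φ) (hc : HasCompactSupport φ) (hs : tsupport φ ⊆ ball 0 1) :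
    (∫ x in ball (0 : E) 1, ⟪gradient (fun y => U (L y)) x, gradient φ x⟫) =
      ∫ x in ball (0 : E) 1, q (L x) * φ x := by
  have hball : L ⁻¹' ball 0 1 = ball 0 1 := by
    rw [L.preimage_ball, map_zero]
  have hemb : MeasurableEmbedding L := L.toHomeomorph.measurableEmbedding
  have hcv (g : ℂ → ℝ) : ∫ x in ball 0 1, g x = ∫ x in ball (0 : E) 1, g (L x) := by
    rw [← L.measurePreserving.setIntegral_preimage_emb hemb, hball]
  have hφ' : ContDiff ℝ 1 (fun z => φ (L.symm z)) := hφ.comp L.symm.contDiff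
  have key := hw (fun z => φ (L.symm z)) hφ' (hc.comp_homeomorph L.symm.toHomeomorph) (by
    intro z hz
    have := (Set.ext_iff.mp (tsupport_comp_eq_preimage φ L.symm.toHomeomorph) z).mp hz
    simpa using hs this)
  rw [hcv, hcv] at key
  simp only [L.symm_apply_apply] at key
  rw [← key]
  refine setIntegral_congr_fun measurableSet_ball fun x hx => ?_
  have hLx : L x ∈ ball (0 : ℂ) 1 := by simpa using hx
  have hφd : DifferentiableAt ℝ φ x := hφ.differentiable (by simp) x
  have hφd' : HasFDerivAt φ (fderiv ℝ φ x) (L.symm (L x)) := by simpa using hφd.hasFDerivAt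
  have hL := L.toContinuousLinearEquiv.hasFDerivAt (x := x)
  have hLs := L.symm.toContinuousLinearEquiv.hasFDerivAt (x := L x)
  have h1 : fderiv ℝ (fun y => U (L y)) x =
      (innerSL ℝ (V (L x))).comp (L.toContinuousLinearEquiv : E →L[ℝ] ℂ) :=
    ((hUV _ hLx).comp x hL).fderiv
  have h2 : fderiv ℝ (fun z => φ (L.symm z)) (L x) =
      (fderiv ℝ φ x).comp (L.symm.toContinuousLinearEquiv : ℂ →L[ℝ] E) :=
    (hφd'.comp (L x) hLs).fderiv
  have : CompleteSpace E := FiniteDimensional.complete ℝ E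
  simp only [inner_gradient_left, h1, h2]
  have h3 := L.inner_map_map (L.symm (V (L x))) (gradient φ x)
  rw [L.apply_symm_apply, real_inner_comm (gradient φ x), inner_gradient_left] at h3
  simp only [ContinuousLinearMap.comp_apply]
  exact h3

theorem exists_circle_smul_eq {x y : ℂ} (h : ‖y‖ = ‖x‖) : ∃ a : Circle, a * x = y := by
  by_cases hx : x = 0
  · refine ⟨1, ?_⟩
    rw [hx, norm_zero, norm_eq_zero] at h
    simp [hx, h]
  · refine ⟨⟨y / x, mem_sphere_zero_iff_norm.2 ?_⟩, div_mul_cancel₀ _ hx⟩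
    rw [norm_div, h, div_self (norm_ne_zero_iff.2 hx)]

theorem infinite_range_comp_rotation {E : Type*} {L : E → ℂ} (hL : Function.Surjective L)
    {U : ℂ → ℝ} (hU : ContinuousOn U (ball 0 1)) {x y : ℂ} (hx : x ∈ ball (0 : ℂ) 1)
    (hxy : ‖y‖ = ‖x‖) (hne : U y ≠ U x) :
    (range fun (a : Circle) (z : E) => U (a * L z)).Infinite := by
  obtain ⟨z, rfl⟩ := hL x
  obtain ⟨a, rfl⟩ := exists_circle_smul_eq hxy
  have hc : Continuous fun a : Circle => U (a * L z) :=
    hU.comp_continuous (by fun_prop) fun a => by simpa [Circle.norm_coe] using hx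
  have hinf : (range fun a : Circle => U (a * L z)).Infinite :=
    (isPreconnected_range hc).infinite_of_nontrivial
      ⟨_, ⟨a, rfl⟩, _, ⟨1, rfl⟩, by simpa using hne⟩
  intro hfin
  refine hinf ((hfin.image fun u => u z).subset ?_)
  rintro _ ⟨a, rfl⟩
  exact ⟨_, ⟨a, rfl⟩, rfl⟩

end

/-- under (f₁), (f₂), (H₁), (H₂), (H₃), the problem `-Δu = f(u)` in the
unit ball `B ⊂ ℝ²` with Dirichlet boundary condition has infinitely many (pairwise
distinct) sign-changing weak solutions. -/
theorem infinitely_many_sign_changing_solutions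
    (f : ℝ → ℝ) (hcont : Continuous f) (hodd : ∀ s : ℝ, f (-s) = - f s)
    (hf1 : ∃ C > 0, ∀ s : ℝ, |f s| ≤ C * Real.exp (4 * π * s ^ 2))
    (hf2 : Tendsto (fun s : ℝ => f s / s) (𝓝[≠] 0) (𝓝 0))
    (hH1 : ∃ s₀ > 0, ∃ M > 0, ∀ s : ℝ, s₀ ≤ |s| → 0 < primF f s ∧ primF f s ≤ M * |f s|)
    (hH2 : ∀ s : ℝ, s ≠ 0 → 0 < primF f s ∧ primF f s ≤ (1/2) * f s * s)
    (hH3 : Tendsto (fun s : ℝ => s * f s * Real.exp (-(4 * π * s ^ 2))) atTop atTop) :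
    ∃ S : Set (EuclideanSpace ℝ (Fin 2) → ℝ), S.Infinite ∧
      ∀ u ∈ S,
        ContinuousOn u (closedBall (0 : EuclideanSpace ℝ (Fin 2)) 1) ∧
        ContDiffOn ℝ 1 u (ball (0 : EuclideanSpace ℝ (Fin 2)) 1) ∧
        (∀ x ∈ sphere (0 : EuclideanSpace ℝ (Fin 2)) 1, u x = 0) ∧
        (∃ x ∈ ball (0 : EuclideanSpace ℝ (Fin 2)) 1, 0 < u x) ∧
        (∃ x ∈ ball (0 : EuclideanSpace ℝ (Fin 2)) 1, u x < 0) ∧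
        ∀ φ : EuclideanSpace ℝ (Fin 2) → ℝ, ContDiff ℝ (⊤ : ℕ∞) φ → HasCompactSupport φ →
          tsupport φ ⊆ ball (0 : EuclideanSpace ℝ (Fin 2)) 1 →
          (∫ x in ball (0 : EuclideanSpace ℝ (Fin 2)) 1, ⟪gradient u x, gradient φ x⟫) =
            ∫ x in ball (0 : EuclideanSpace ℝ (Fin 2)) 1, f (u x) * φ x := by
  obtain ⟨U, V, hUc, hUd, hU0, hUodd, ⟨x, hx, hxU⟩, hUV, hw⟩ :=
    exists_odd_solution hcont hodd hf1 hf2 hH1 hH2 hH3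
  set L₀ : EuclideanSpace ℝ (Fin 2) ≃ₗᵢ[ℝ] ℂ := Complex.orthonormalBasisOneI.repr.symm
  have hrx : reflect x ∈ ball (0 : ℂ) 1 := by simpa using hx
  have hxodd := hUodd x (mem_ball_zero_iff.1 hx).le
  refine ⟨range fun (a : Circle) z => U (a * L₀ z),
    infinite_range_comp_rotation L₀.surjective (hUc.mono ball_subset_closedBall) hx
      (norm_reflect x) (by rw [hxodd]; exact fun h => hxU (by linarith)), ?_⟩
  rintro _ ⟨a, rfl⟩
  set L : EuclideanSpace ℝ (Fin 2) ≃ₗᵢ[ℝ] ℂ := L₀.trans (rotation a) with hL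
  have hsymm {y : ℂ} (hy : y ∈ ball (0 : ℂ) 1) : L.symm y ∈ ball 0 1 := by simpa using hy
  change ContinuousOn (fun z => U (L z)) _ ∧ ContDiffOn ℝ 1 (fun z => U (L z)) _ ∧
    (∀ x ∈ _, U (L x) = 0) ∧ (∃ x ∈ _, 0 < U (L x)) ∧ (∃ x ∈ _, U (L x) < 0) ∧
    ∀ φ : EuclideanSpace ℝ (Fin 2) → ℝ, _ → _ → _ →
      (∫ x in _, ⟪gradient (fun z => U (L z)) x, gradient φ x⟫) = ∫ x in _, f (U (L x)) * φ x
  refine ⟨hUc.comp L.continuous.continuousOn fun z hz => by simpa using hz,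
    hUd.comp L.contDiff.contDiffOn fun z hz => by simpa using hz,
    fun z hz => hU0 _ (by simpa using hz), ?_, ?_, fun φ hφ hc hs =>
      integral_inner_gradient_comp_linearIsometryEquiv L (q := fun z => f (U z)) hUV hw
        (hφ.of_le (by exact_mod_cast le_top)) hc hs⟩
  · rcases hxU.lt_or_gt with h | h
    · exact ⟨_, hsymm hrx, by rw [L.apply_symm_apply]; linarith⟩
    · exact ⟨_, hsymm hx, by rwa [L.apply_symm_apply]⟩
  · rcases hxU.lt_or_gt with h | h
    · exact ⟨_, hsymm hx, by rwa [L.apply_symm_apply]⟩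
    · exact ⟨_, hsymm hrx, by rw [L.apply_symm_apply]; linarith⟩
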